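/- arXiv:0811.4159 — 5 statements merged into one kernel-verified Lean document; each statement's English description precedes it below -/
import Mathlib

section
/- Let p be a prime, let λ be a power-of-p multiset of cardinality k with sum n, and let 0 ≤ m ≤ k − 2 satisfy either m ≤ p − 2 or k = σ_p(n) (i.e., λ is the shortest power-of-p multiset of sum n). Then there exists a nonzero symmetric polynomial f ∈ Z_p[x_1,…,x_{k−m}], homogeneous of degree n, with δ_2(f) = 0, whose exponent-multiset support is exactly T^m(λ); that is, the m-fold gatherings of λ can be resymmetrized and assigned nonzero coefficients so as to form a symmetric 2-cocycle over Z_p. -/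
open MvPolynomial

/-- The `m`-coboundary map `δ_m` on polynomials in `k` variables `x_1, …, x_k`
(indexed by `Fin k`, with `j : Fin k` standing for the variable `x_{j+1}`),
landing in polynomials in the variables `x_0, …, x_k` (indexed by `Fin (k+1)`). -/
noncomputable def delta (A : Type*) [CommRing A] (m k : ℕ)
    (f : MvPolynomial (Fin k) A) : MvPolynomial (Fin (k + 1)) A :=
  aeval (fun j : Fin k => (X j.succ : MvPolynomial (Fin (k + 1)) A)) f
    + ∑ i ∈ Finset.Icc 1 m, (-1 : MvPolynomial (Fin (k + 1)) A) ^ i *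
        aeval (fun j : Fin k =>
          if (j : ℕ) + 1 < i then (X j.castSucc : MvPolynomial (Fin (k + 1)) A)
          else if (j : ℕ) + 1 = i then X j.castSucc + X j.succ
          else X j.succ) f
    + (-1 : MvPolynomial (Fin (k + 1)) A) ^ (m + 1) *
        aeval (fun j : Fin k =>
          if (j : ℕ) + 1 ≤ m then (X j.castSucc : MvPolynomial (Fin (k + 1)) A)
          else X j.succ) f

/-- The monomial symmetric polynomial `τ λ` associated to a multi-index
`λ : Fin k → ℕ`: the sum of `x^μ` over the distinct rearrangements `μ` of `λ`. -/
noncomputable def tau (A : Type*) [CommRing A] {k : ℕ} (lam : Fin k → ℕ) :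
    MvPolynomial (Fin k) A :=
  ∑ d ∈ (Finset.univ : Finset (Equiv.Perm (Fin k))).image
      (fun σ => Finsupp.equivFunOnFinite.symm (fun i => lam (σ i))),
    monomial d (1 : A)

/-- The multiset of values of a multi-index `Fin k → ℕ`. -/
def multisetOf {k : ℕ} (lam : Fin k → ℕ) : Multiset ℕ :=
  Multiset.map lam Finset.univ.val

/-- The exponent multiset of an exponent vector `d : Fin k →₀ ℕ`. -/
def exMult {k : ℕ} (d : Fin k →₀ ℕ) : Multiset ℕ :=
  multisetOf (⇑d)

/-- `σ_p(n)`, the sum of the digits of `n` in base `p`. -/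
def sigmaDigits (p n : ℕ) : ℕ := (Nat.digits p n).sum

/-- `α_p(λ)`, the number of carries when summing the entries of `λ` in base `p`;
equivalently the `p`-adic valuation of the multinomial coefficient of `λ`. -/
def alphaCarry (p : ℕ) (s : Multiset ℕ) : ℕ :=
  padicValNat p (Nat.factorial s.sum / (s.map Nat.factorial).prod)

/-- The splitting distance `φ_p(λ) = (Σ_i σ_p(λ_i)) − |λ|`. -/
def phiSplit (p : ℕ) (s : Multiset ℕ) : ℕ :=
  (s.map (sigmaDigits p)).sum - Multiset.card s

/-- A multiset is power-of-`p` when all its entries are powers of `p`. -/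
def IsPowOf (p : ℕ) (s : Multiset ℕ) : Prop := ∀ x ∈ s, ∃ a : ℕ, x = p ^ a

/-- `λ` is `p`-carry-minimal: `α_p(λ) ≤ α_p(μ)` for every multiset `μ` of positive
integers with the same sum and the same number of entries as `λ`. -/
def IsCarryMin (p : ℕ) (s : Multiset ℕ) : Prop :=
  ∀ t : Multiset ℕ, (∀ x ∈ t, 0 < x) → t.sum = s.sum →
    Multiset.card t = Multiset.card s → alphaCarry p s ≤ alphaCarry p t

/-- A single gathering operation: replace two entries `a`, `b` by `a + b`. -/
def Gathers (s t : Multiset ℕ) : Prop :=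
  ∃ a b u, s = a ::ₘ b ::ₘ u ∧ t = (a + b) ::ₘ u

/-- `gatherSet m λ = T^m(λ)`, the set of multisets obtained from `λ` by `m`
successive gathering operations. -/
def gatherSet : ℕ → Multiset ℕ → Set (Multiset ℕ)
  | 0, s => {s}
  | m + 1, s => {t | ∃ u ∈ gatherSet m s, Gathers u t}

/-- One step of the annihilating-set construction: split an entry `x = a + b`
(with `a, b > 0` and no base-`p` carries in `a + b`), and add `b` onto another
entry `y`. -/
def AnnStep (p : ℕ) (μ ν : Multiset ℕ) : Prop :=
  ∃ (x y a b : ℕ) (u : Multiset ℕ), μ = x ::ₘ y ::ₘ u ∧ 0 < a ∧ 0 < b ∧ a + b = x ∧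
    sigmaDigits p a + sigmaDigits p b = sigmaDigits p x ∧ ν = a ::ₘ (b + y) ::ₘ u

/-- `ann_p(λ)`: the smallest set of multisets containing `λ` closed under `AnnStep`. -/
def annSet (p : ℕ) (lam : Multiset ℕ) : Set (Multiset ℕ) :=
  {μ | Relation.ReflTransGen (AnnStep p) lam μ}

/-- The `m`-coboundary map as a linear map. -/
noncomputable def deltaLM (A : Type*) [CommRing A] (m k : ℕ) :
    MvPolynomial (Fin k) A →ₗ[A] MvPolynomial (Fin (k + 1)) A :=
  (aeval (fun j : Fin k => (X j.succ : MvPolynomial (Fin (k + 1)) A))).toLinearMap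
    + ∑ i ∈ Finset.Icc 1 m, ((-1 : A) ^ i) •
        (aeval (fun j : Fin k =>
          if (j : ℕ) + 1 < i then (X j.castSucc : MvPolynomial (Fin (k + 1)) A)
          else if (j : ℕ) + 1 = i then X j.castSucc + X j.succ
          else X j.succ)).toLinearMap
    + ((-1 : A) ^ (m + 1)) •
        (aeval (fun j : Fin k =>
          if (j : ℕ) + 1 ≤ m then (X j.castSucc : MvPolynomial (Fin (k + 1)) A)
          else X j.succ)).toLinearMap


theorem sum_triple {M : Type*} [AddCommMonoid M] (L : ℕ →₀ ℕ) (f : (ℕ →₀ ℕ) → (ℕ →₀ ℕ) → (ℕ →₀ ℕ) → M) :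
    ∑ q ∈ Finset.HasAntidiagonal.antidiagonal L, ∑ r ∈ Finset.HasAntidiagonal.antidiagonal q.1, f r.1 r.2 q.2 =
    ∑ q ∈ Finset.HasAntidiagonal.antidiagonal L, ∑ r ∈ Finset.HasAntidiagonal.antidiagonal q.2, f q.1 r.1 r.2 := by
  rw [Finset.sum_sigma', Finset.sum_sigma']
  refine Finset.sum_bij' (fun x _ => ⟨(x.2.1, x.2.2 + x.1.2), (x.2.2, x.1.2)⟩)
    (fun x _ => ⟨(x.1.1 + x.2.1, x.2.2), (x.1.1, x.2.1)⟩) ?_ ?_ ?_ ?_ ?_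
  · rintro ⟨⟨a, b⟩, ⟨c, d⟩⟩ h
    simp only [Finset.mem_sigma, Finset.HasAntidiagonal.mem_antidiagonal] at h ⊢
    rw [← add_assoc, h.2, h.1]; simp
  · rintro ⟨⟨a, b⟩, ⟨c, d⟩⟩ h
    simp only [Finset.mem_sigma, Finset.HasAntidiagonal.mem_antidiagonal] at h ⊢
    rw [add_assoc, h.2, h.1]; simp
  · rintro ⟨⟨a, b⟩, ⟨c, d⟩⟩ h
    simp only [Finset.mem_sigma, Finset.HasAntidiagonal.mem_antidiagonal] at h ⊢
    rw [h.2]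
  · rintro ⟨⟨a, b⟩, ⟨c, d⟩⟩ h
    simp only [Finset.mem_sigma, Finset.HasAntidiagonal.mem_antidiagonal] at h ⊢
    rw [h.2]
  · intros; rfl

theorem sum_swp {M : Type*} [AddCommMonoid M] (L : ℕ →₀ ℕ) (f : (ℕ →₀ ℕ) × (ℕ →₀ ℕ) → M) :
    ∑ q ∈ Finset.HasAntidiagonal.antidiagonal L, f q =
    ∑ q ∈ Finset.HasAntidiagonal.antidiagonal L, f q.swap :=
  Finset.sum_bij' (fun q _ => q.swap) (fun q _ => q.swap)
    (by simp [add_comm]) (by simp [add_comm]) (by simp) (by simp) (by simp)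

/-- weight -/
noncomputable def wt (p : ℕ) : (ℕ →₀ ℕ) →+ ℕ := Finsupp.weight (fun a => p ^ a)

theorem wt_single (p a e : ℕ) : wt p (Finsupp.single a e) = e * p ^ a := by
  simp [wt, Finsupp.weight_single]

/-- coefficient -/
noncomputable def cf (p : ℕ) (c : ℕ →₀ ℕ) : ZMod p := c.prod fun _ e => ((e.factorial : ℕ) : ZMod p)⁻¹

theorem cf_zero (p : ℕ) : cf p 0 = 1 := by simp [cf]

theorem cf_ne_zero (p : ℕ) [Fact p.Prime] (c : ℕ →₀ ℕ) : cf p c ≠ 0 ↔ ∀ a, c a < p := by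
  have hp : p.Prime := Fact.out
  rw [cf, Finsupp.prod, Finset.prod_ne_zero_iff]
  simp only [ne_eq, inv_eq_zero, ZMod.natCast_eq_zero_iff, hp.dvd_factorial, not_le, Finsupp.mem_support_iff]
  refine forall_congr' fun a => ⟨fun h => ?_, fun h _ => h⟩
  by_cases h0 : c a = 0
  · rw [h0]; exact hp.pos
  · exact h h0

theorem cf_step (p : ℕ) [Fact p.Prime] (c : ℕ →₀ ℕ) (a : ℕ) (h : c a + 1 < p) :
    ((c a + 1 : ℕ) : ZMod p) * cf p (c + Finsupp.single a 1) = cf p c := by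
  have hz : ((c a + 1 : ℕ) : ZMod p) ≠ 0 := by
    rw [Ne, ZMod.natCast_eq_zero_iff]
    exact Nat.not_dvd_of_pos_of_lt (Nat.succ_pos _) h
  unfold cf
  rw [← Finsupp.mul_prod_erase' (c + Finsupp.single a 1) a _ (by simp),
    ← Finsupp.mul_prod_erase' c a _ (by simp)]
  have : (c + Finsupp.single a 1).erase a = c.erase a := by
    ext b; by_cases hb : b = a
    · subst hb; simp
    · simp [Finsupp.erase_ne hb]
  rw [this, ← mul_assoc]
  congr 1
  simp only [Finsupp.coe_add, Pi.add_apply, Finsupp.single_eq_same, Nat.factorial_succ]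
  push_cast at hz ⊢
  rw [mul_inv, ← mul_assoc, mul_inv_cancel₀ hz, one_mul]

section
variable (p : ℕ) {R : Type*} [CommRing R] [Algebra (ZMod p) R]

/-- divided power -/
noncomputable def EE (c : ℕ →₀ ℕ) (x : R) : R := algebraMap (ZMod p) R (cf p c) * x ^ (wt p c)

/-- reduced divided power -/
noncomputable def E0 (c : ℕ →₀ ℕ) (x : R) : R := if c = 0 then 0 else EE p c x

theorem EE_zero (x : R) : EE p 0 x = 1 := by simp [EE, cf_zero]

theorem EE_eq (c : ℕ →₀ ℕ) (x : R) : EE p c x = (if c = 0 then 1 else 0) + E0 p c x := by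
  unfold E0; split_ifs with h
  · simp [h, EE_zero]
  · simp

theorem EE_step [Fact p.Prime] (c : ℕ →₀ ℕ) (a : ℕ) (h : c a + 1 < p) (x : R) :
    ((c a + 1 : ℕ) : R) * EE p (c + Finsupp.single a 1) x = x ^ (p ^ a) * EE p c x := by
  unfold EE
  have := congrArg (algebraMap (ZMod p) R) (cf_step p c a h)
  rw [map_mul, map_natCast] at this
  rw [← this, map_add, wt_single, pow_add, one_mul]; ring

/-- one-sided Leibniz -/
theorem leib [Fact p.Prime] (c : ℕ →₀ ℕ) (a : ℕ) (h : c a + 1 < p) (x y : R) :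
    ∑ q ∈ Finset.HasAntidiagonal.antidiagonal (c + Finsupp.single a 1), ((q.1 : ℕ →₀ ℕ) a : R) * (EE p q.1 x * EE p q.2 y) =
    x ^ (p ^ a) * ∑ q ∈ Finset.HasAntidiagonal.antidiagonal c, EE p q.1 x * EE p q.2 y := by
  rw [Finset.mul_sum]
  symm
  have hinj : Function.Injective (fun q : (ℕ →₀ ℕ) × (ℕ →₀ ℕ) => (q.1 + Finsupp.single a 1, q.2)) := by
    rintro ⟨u, v⟩ ⟨u', v'⟩ h
    simp only [Prod.mk.injEq, add_left_inj] at h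
    simp [h]
  calc _ = ∑ q ∈ (Finset.HasAntidiagonal.antidiagonal c).map ⟨_, hinj⟩, ((q.1 : ℕ →₀ ℕ) a : R) * (EE p q.1 x * EE p q.2 y) := by
        rw [Finset.sum_map]
        refine Finset.sum_congr rfl fun q hq => ?_
        rw [Finset.HasAntidiagonal.mem_antidiagonal] at hq
        have hq' : q.1 a ≤ c a := by rw [← hq]; simp
        simp only [Function.Embedding.coeFn_mk, Finsupp.coe_add, Pi.add_apply, Finsupp.single_eq_same]
        rw [← mul_assoc, ← mul_assoc, EE_step p q.1 a (by omega)]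
    _ = _ := by
        refine Finset.sum_subset ?_ ?_
        · intro q hq
          simp only [Finset.mem_map, Finset.HasAntidiagonal.mem_antidiagonal, Function.Embedding.coeFn_mk] at hq ⊢
          obtain ⟨r, hr, rfl⟩ := hq
          simp only
          rw [← hr]; abel
        · rintro ⟨u, v⟩ hq hn
          rw [Finset.HasAntidiagonal.mem_antidiagonal] at hq
          have : u a = 0 := by
            by_contra hu
            apply hn
            have hle : Finsupp.single a 1 ≤ u := by
              rw [Finsupp.single_le_iff]; omega
            rw [Finset.mem_map]
            refine ⟨(u - Finsupp.single a 1, v), ?_, ?_⟩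
            · rw [Finset.HasAntidiagonal.mem_antidiagonal]
              simp only at hq ⊢
              rw [← add_left_inj (Finsupp.single a 1), ← hq, add_right_comm, tsub_add_cancel_of_le hle]
            · simp [tsub_add_cancel_of_le hle]
          simp [this]

theorem leib2 [Fact p.Prime] (c : ℕ →₀ ℕ) (a : ℕ) (h : c a + 1 < p) (x y : R) :
    ∑ q ∈ Finset.HasAntidiagonal.antidiagonal (c + Finsupp.single a 1), ((q.2 : ℕ →₀ ℕ) a : R) * (EE p q.1 x * EE p q.2 y) =
    y ^ (p ^ a) * ∑ q ∈ Finset.HasAntidiagonal.antidiagonal c, EE p q.1 x * EE p q.2 y := by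
  rw [sum_swp, sum_swp c]
  have := leib p c a h y x
  simpa [mul_comm] using this

theorem EE_add [Fact p.Prime] [CharP R p] (x y : R) (n : ℕ) : ∀ (c : ℕ →₀ ℕ), c.degree = n → (∀ a, c a < p) →
    EE p c (x + y) = ∑ q ∈ Finset.HasAntidiagonal.antidiagonal c, EE p q.1 x * EE p q.2 y := by
  induction n with
  | zero =>
    intro c hc _
    rw [Finsupp.degree_eq_zero_iff] at hc
    subst hc
    simp [EE_zero]
  | succ n ih =>
    intro c hc hlt
    have hc0 : c ≠ 0 := by rintro rfl; simp at hc
    obtain ⟨a, ha⟩ := Finsupp.ne_iff.1 hc0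
    simp only [Finsupp.coe_zero, Pi.zero_apply] at ha
    obtain ⟨d, rfl⟩ : ∃ d, c = d + Finsupp.single a 1 := ⟨c - Finsupp.single a 1, by
      rw [tsub_add_cancel_of_le]; rw [Finsupp.single_le_iff]; omega⟩
    rw [map_add, Finsupp.degree_single] at hc
    have hd := ih d (by omega) (fun b => lt_of_le_of_lt (by simp) (hlt b))
    have h : d a + 1 < p := by simpa using hlt a
    have hz : ((d a + 1 : ℕ) : ZMod p) ≠ 0 := by
      rw [Ne, ZMod.natCast_eq_zero_iff]
      exact Nat.not_dvd_of_pos_of_lt (Nat.succ_pos _) h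
    have hu : IsUnit ((d a + 1 : ℕ) : R) := by
      rw [← map_natCast (algebraMap (ZMod p) R)]
      exact hz.isUnit.map _
    apply hu.mul_left_cancel
    rw [EE_step p d a h, hd, add_pow_char_pow, add_mul, ← leib p d a h, ← leib2 p d a h, ← Finset.sum_add_distrib, Finset.mul_sum]
    refine Finset.sum_congr rfl fun q hq => ?_
    rw [Finset.HasAntidiagonal.mem_antidiagonal] at hq
    have := DFunLike.congr_fun hq a
    simp only [Finsupp.coe_add, Pi.add_apply, Finsupp.single_eq_same] at this
    rw [← add_mul, ← Nat.cast_add, this]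

theorem E0_add [Fact p.Prime] [CharP R p] (x y : R) (c : ℕ →₀ ℕ) (hlt : ∀ a, c a < p) :
    E0 p c (x + y) = E0 p c x + E0 p c y + ∑ q ∈ Finset.HasAntidiagonal.antidiagonal c, E0 p q.1 x * E0 p q.2 y := by
  by_cases hc : c = 0
  · subst hc; simp [E0]
  have h := EE_add p x y _ c rfl hlt
  have e1 : EE p c (x + y) = E0 p c (x + y) := by simp [E0, hc]
  rw [← e1, h]
  simp only [EE_eq, add_mul, mul_add, Finset.sum_add_distrib]
  have h1 : ∑ q ∈ Finset.HasAntidiagonal.antidiagonal c, (if q.1 = 0 then (1:R) else 0) * (if q.2 = 0 then (1:R) else 0) = 0 := by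
    refine Finset.sum_eq_zero fun q hq => ?_
    rw [Finset.HasAntidiagonal.mem_antidiagonal] at hq
    by_cases h1 : q.1 = 0
    · have : q.2 ≠ 0 := by intro h2; apply hc; rw [← hq, h1, h2, add_zero]
      simp [this]
    · simp [h1]
  have h2 : ∑ q ∈ Finset.HasAntidiagonal.antidiagonal c, (if q.1 = 0 then (1:R) else 0) * E0 p q.2 y = E0 p c y := by
    rw [Finset.sum_eq_single (0, c)]
    · simp
    · rintro ⟨u, v⟩ hq hne
      rw [Finset.HasAntidiagonal.mem_antidiagonal] at hq
      by_cases h1 : u = 0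
      · subst h1; simp at hq; subst hq; exact absurd rfl hne
      · simp [h1]
    · simp
  have h3 : ∑ q ∈ Finset.HasAntidiagonal.antidiagonal c, E0 p q.1 x * (if q.2 = 0 then (1:R) else 0) = E0 p c x := by
    rw [Finset.sum_eq_single (c, 0)]
    · simp
    · rintro ⟨u, v⟩ hq hne
      rw [Finset.HasAntidiagonal.mem_antidiagonal] at hq
      by_cases h1 : v = 0
      · subst h1; simp at hq; subst hq; exact absurd rfl hne
      · simp [h1]
    · simp
  rw [h1, h2, h3]; ring

/-- the cocycle function -/
noncomputable def FF (j : ℕ) (L : ℕ →₀ ℕ) (x : Fin j → R) : R :=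
  ∑ c ∈ Finset.finAntidiagonal j L, ∏ i, E0 p (c i) (x i)

theorem FF_succ (j : ℕ) (L : ℕ →₀ ℕ) (x : Fin (j + 1) → R) :
    FF p (j + 1) L x = ∑ q ∈ Finset.HasAntidiagonal.antidiagonal L, E0 p q.1 (x 0) * FF p j q.2 (fun i => x i.succ) := by
  unfold FF
  simp_rw [Finset.mul_sum]
  rw [Finset.sum_sigma']
  refine Finset.sum_bij' (fun c _ => ⟨(c 0, ∑ i, c (Fin.succ i)), fun i => c i.succ⟩)
    (fun x _ => Fin.cons x.1.1 x.2) ?_ ?_ ?_ ?_ ?_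
  · intro c hc
    simp only [Finset.mem_finAntidiagonal, Fin.sum_univ_succ] at hc
    simp [hc]
  · rintro ⟨⟨a, b⟩, c⟩ h
    simp only [Finset.mem_sigma, Finset.HasAntidiagonal.mem_antidiagonal, Finset.mem_finAntidiagonal] at h
    simp [Fin.sum_univ_succ, h.2, h.1]
  · intro c hc
    exact Fin.cons_self_tail c
  · rintro ⟨⟨a, b⟩, c⟩ h
    simp only [Finset.mem_sigma, Finset.HasAntidiagonal.mem_antidiagonal, Finset.mem_finAntidiagonal] at h
    simp [h.2]
  · intro c hc
    rw [Fin.prod_univ_succ]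

theorem FF_eq_zero (j : ℕ) (L : ℕ →₀ ℕ) (x : Fin j → R) (h : L.degree < j) : FF p j L x = 0 := by
  unfold FF
  refine Finset.sum_eq_zero fun c hc => ?_
  rw [Finset.mem_finAntidiagonal] at hc
  obtain ⟨i, hi⟩ : ∃ i, c i = 0 := by
    by_contra! hne
    have : ∑ i : Fin j, 1 ≤ ∑ i, (c i).degree := Finset.sum_le_sum fun i _ => by
      have := (Finsupp.degree_eq_zero_iff (c i)).not.2 (hne i)
      omega
    rw [← map_sum, hc] at this
    simp at this
    omega
  exact Finset.prod_eq_zero (Finset.mem_univ i) (by simp [E0, hi])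

/-- smallness -/
def SmallC (j : ℕ) (L : ℕ →₀ ℕ) : Prop := ∀ c d : ℕ →₀ ℕ, c + d = L → j ≤ d.degree → ∀ a, c a < p

theorem FF_merge [Fact p.Prime] [CharP R p] (j : ℕ) (L : ℕ →₀ ℕ) (hs : SmallC p j L) (x y : R) (r : Fin j → R) :
    FF p (j + 1) L (Fin.cons (x + y) r) = FF p (j + 1) L (Fin.cons x r) + FF p (j + 1) L (Fin.cons y r)
      + FF p (j + 2) L (Fin.cons x (Fin.cons y r)) := by
  rw [FF_succ p (j+1)]
  simp only [FF_succ p j, Fin.cons_zero, Fin.cons_succ, Finset.mul_sum]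
  rw [← sum_triple L (fun a b c => E0 p a x * (E0 p b y * FF p j c r)), ← Finset.sum_add_distrib, ← Finset.sum_add_distrib]
  refine Finset.sum_congr rfl fun q hq => ?_
  rw [Finset.HasAntidiagonal.mem_antidiagonal] at hq
  by_cases hd : j ≤ q.2.degree
  · rw [E0_add p x y q.1 (hs _ _ hq hd), add_mul, add_mul, Finset.sum_mul]
    simp [mul_assoc]
  · simp [FF_eq_zero p j q.2 r (by omega)]

theorem FF_merge2 [Fact p.Prime] [CharP R p] (j : ℕ) (L : ℕ →₀ ℕ) (hs : SmallC p (j + 1) L) (z x y : R) (r : Fin j → R) :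
    FF p (j + 2) L (Fin.cons z (Fin.cons (x + y) r)) = FF p (j + 2) L (Fin.cons z (Fin.cons x r))
      + FF p (j + 2) L (Fin.cons z (Fin.cons y r))
      + FF p (j + 3) L (Fin.cons z (Fin.cons x (Fin.cons y r))) := by
  rw [FF_succ p (j+1), FF_succ p (j+1), FF_succ p (j+1), FF_succ p (j+2)]
  simp only [Fin.cons_zero, Fin.cons_succ]
  rw [← Finset.sum_add_distrib, ← Finset.sum_add_distrib]
  refine Finset.sum_congr rfl fun q hq => ?_
  rw [Finset.HasAntidiagonal.mem_antidiagonal] at hq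
  by_cases hd : q.1 = 0
  · simp [E0, hd]
  rw [FF_merge p j q.2, mul_add, mul_add]
  intro c d hcd hj
  refine hs c (q.1 + d) (by rw [← hq, ← hcd]; abel) ?_
  have := (Finsupp.degree_eq_zero_iff q.1).not.2 hd
  rw [map_add]; omega

theorem FF_cocycle [Fact p.Prime] [CharP R p] (j : ℕ) (L : ℕ →₀ ℕ) (hs : SmallC p (j + 1) L) (z x y : R) (r : Fin j → R) :
    FF p (j + 2) L (Fin.cons x (Fin.cons y r)) - FF p (j + 2) L (Fin.cons (z + x) (Fin.cons y r))
    + FF p (j + 2) L (Fin.cons z (Fin.cons (x + y) r)) - FF p (j + 2) L (Fin.cons z (Fin.cons x r)) = 0 := by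
  rw [FF_merge2 p j L hs, FF_merge p (j + 1) L hs]
  ring

theorem FF_perm (j : ℕ) (L : ℕ →₀ ℕ) (x : Fin j → R) (e : Equiv.Perm (Fin j)) :
    FF p j L (fun i => x (e i)) = FF p j L x := by
  unfold FF
  refine Finset.sum_bij' (fun c _ => fun i => c (e.symm i)) (fun c _ => fun i => c (e i)) ?_ ?_ ?_ ?_ ?_
  · intro c hc
    rw [Finset.mem_finAntidiagonal] at hc ⊢
    rw [← hc]; exact Equiv.sum_comp e.symm c
  · intro c hc
    rw [Finset.mem_finAntidiagonal] at hc ⊢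
    rw [← hc]; exact Equiv.sum_comp e c
  · intro c _; simp
  · intro c _; simp
  · intro c _
    rw [← Equiv.prod_comp e (fun i => E0 p (c (e.symm i)) (x i))]
    simp

theorem FF_map {S : Type*} [CommRing S] [Algebra (ZMod p) S] (φ : R →ₐ[ZMod p] S) (j : ℕ) (L : ℕ →₀ ℕ) (x : Fin j → R) :
    φ (FF p j L x) = FF p j L (fun i => φ (x i)) := by
  unfold FF
  rw [map_sum]
  refine Finset.sum_congr rfl fun c _ => ?_
  rw [map_prod]
  refine Finset.prod_congr rfl fun i _ => ?_
  unfold E0 EE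
  split_ifs <;> simp

end

theorem digs_inj (p : ℕ) : ∀ (N : ℕ) (c d : ℕ → ℕ), (∀ a, c a < p) → (∀ a, d a < p) →
    ∑ a ∈ Finset.range N, c a * p ^ a = ∑ a ∈ Finset.range N, d a * p ^ a → ∀ a < N, c a = d a := by
  intro N
  induction N with
  | zero => intro c d _ _ _ a ha; omega
  | succ N ih =>
    intro c d hc hd h
    rw [Finset.sum_range_succ', Finset.sum_range_succ'] at h
    have key : ∀ e : ℕ → ℕ, ∑ a ∈ Finset.range N, e (a + 1) * p ^ (a + 1) + e 0 * p ^ 0 =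
        e 0 + p * ∑ a ∈ Finset.range N, e (a + 1) * p ^ a := by
      intro e
      rw [Finset.mul_sum, pow_zero, mul_one, add_comm]
      congr 1
      exact Finset.sum_congr rfl fun a _ => by ring
    rw [key c, key d] at h
    have h0 : c 0 = d 0 := by
      have := congrArg (· % p) h
      simpa [Nat.add_mul_mod_self_left, Nat.mod_eq_of_lt (hc 0), Nat.mod_eq_of_lt (hd 0)] using this
    have hp : 0 < p := lt_of_le_of_lt (Nat.zero_le _) (hc 0)
    rw [h0, Nat.add_left_cancel_iff] at h
    have h1 := ih (fun a => c (a + 1)) (fun a => d (a + 1)) (fun a => hc _) (fun a => hd _)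
      (Nat.eq_of_mul_eq_mul_left hp h)
    intro a ha
    cases a with
    | zero => exact h0
    | succ a => exact h1 a (by omega)

theorem wt_inj (p : ℕ) (c d : ℕ →₀ ℕ) (hc : ∀ a, c a < p) (hd : ∀ a, d a < p) (h : wt p c = wt p d) : c = d := by
  obtain ⟨N, hN⟩ := (c.support ∪ d.support).exists_nat_subset_range
  have key : ∀ e : ℕ →₀ ℕ, e.support ⊆ Finset.range N → wt p e = ∑ a ∈ Finset.range N, e a * p ^ a := by
    intro e he
    unfold wt
    rw [Finsupp.weight_apply, Finsupp.sum_of_support_subset e he _ (by simp)]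
    simp
  rw [key c (Finset.subset_union_left.trans hN), key d (Finset.subset_union_right.trans hN)] at h
  have h2 := digs_inj p N c d hc hd h
  ext a
  by_cases ha : a < N
  · exact h2 a ha
  · have hn : a ∉ c.support ∪ d.support := fun h' => ha (Finset.mem_range.1 (hN h'))
    simp only [Finset.mem_union, Finsupp.mem_support_iff, not_or, not_not] at hn
    rw [hn.1, hn.2]

theorem sig_rec (p : ℕ) (hp : 2 ≤ p) (x : ℕ) : sigmaDigits p x = x % p + sigmaDigits p (x / p) := by
  unfold sigmaDigits
  rcases Nat.eq_zero_or_pos x with rfl | hx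
  · simp
  · rw [Nat.digits_def' (by omega) hx]; simp

theorem sig_succ (p : ℕ) (hp : 2 ≤ p) (x : ℕ) : sigmaDigits p (x + 1) ≤ sigmaDigits p x + 1 := by
  induction x using Nat.strong_induction_on with
  | _ x ih =>
    rw [sig_rec p hp (x + 1), sig_rec p hp x]
    have hl := Nat.mod_lt x (show 0 < p by omega)
    have hx := Nat.div_add_mod x p
    by_cases h : x % p + 1 < p
    · have h1 : (x + 1) / p = x / p := by
        rw [Nat.div_eq_iff (by omega), mul_comm (x / p) p]; constructor <;> omega
      have h2 : (x + 1) % p = x % p + 1 := by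
        rw [Nat.add_mod, Nat.mod_eq_of_lt (show 1 < p by omega), Nat.mod_eq_of_lt h]
      rw [h1, h2]; omega
    · have h3 : x % p = p - 1 := by omega
      have h4 : x + 1 = p * (x / p + 1) := by
        rw [mul_add]; omega
      have h1 : (x + 1) / p = x / p + 1 := by
        rw [h4, Nat.mul_div_cancel_left _ (by omega)]
      have h2 : (x + 1) % p = 0 := by rw [h4]; simp
      have hpos : 0 < x := by
        rcases Nat.eq_zero_or_pos x with rfl | h
        · simp at h3; omega
        · exact h
      have := ih (x / p) (Nat.div_lt_self hpos (by omega))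
      rw [h1, h2]; omega

theorem sig_pow (p : ℕ) (hp : 2 ≤ p) (a : ℕ) : ∀ x, sigmaDigits p (x + p ^ a) ≤ sigmaDigits p x + 1 := by
  induction a with
  | zero => intro x; simpa using sig_succ p hp x
  | succ a ih =>
    intro x
    rw [sig_rec p hp (x + p ^ (a + 1)), sig_rec p hp x, pow_succ', Nat.add_mul_mod_self_left,
      Nat.add_mul_div_left _ _ (by omega)]
    have := ih (x / p)
    omega

theorem exists_sub_single (c : ℕ →₀ ℕ) (hc : c ≠ 0) : ∃ a d, c = d + Finsupp.single a 1 := by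
  obtain ⟨a, ha⟩ := Finsupp.ne_iff.1 hc
  simp only [Finsupp.coe_zero, Pi.zero_apply] at ha
  exact ⟨a, c - Finsupp.single a 1, by
      rw [tsub_add_cancel_of_le]; rw [Finsupp.single_le_iff]; omega⟩

theorem sig_le (p : ℕ) (hp : 2 ≤ p) (n : ℕ) : ∀ L : ℕ →₀ ℕ, L.degree = n → sigmaDigits p (wt p L) ≤ n := by
  induction n with
  | zero => intro L h; rw [Finsupp.degree_eq_zero_iff] at h; subst h; simp [sigmaDigits]
  | succ n ih =>
    intro L h
    obtain ⟨a, d, rfl⟩ := exists_sub_single L (by rintro rfl; simp at h)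
    rw [map_add, Finsupp.degree_single] at h
    rw [map_add, wt_single, one_mul]
    exact (sig_pow p hp a _).trans (by have := ih d (by omega); omega)

theorem lt_of_sig (p : ℕ) (hp : 2 ≤ p) (L : ℕ →₀ ℕ) (h : L.degree = sigmaDigits p (wt p L)) (a : ℕ) : L a < p := by
  by_contra hlt
  have hle : Finsupp.single a p ≤ L := by rw [Finsupp.single_le_iff]; omega
  obtain ⟨d, rfl⟩ : ∃ d, L = d + Finsupp.single a p := ⟨L - Finsupp.single a p, by
    rw [tsub_add_cancel_of_le hle]⟩
  have := sig_le p hp _ (d + Finsupp.single (a + 1) 1) rfl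
  rw [map_add, map_add, Finsupp.degree_single, wt_single] at this h
  rw [one_mul, pow_succ'] at this
  omega

theorem card_le_deg (S : Multiset (ℕ →₀ ℕ)) : 0 ∉ S → Multiset.card S ≤ S.sum.degree := by
  induction S using Multiset.induction_on with
  | empty => simp
  | cons c S ih =>
    intro h
    rw [Multiset.mem_cons, not_or] at h
    have := (Finsupp.degree_eq_zero_iff c).not.2 (Ne.symm h.1)
    have := ih h.2
    rw [Multiset.card_cons, Multiset.sum_cons, map_add]; omega

theorem map_of_card_eq (p : ℕ) (S : Multiset (ℕ →₀ ℕ)) : 0 ∉ S → Multiset.card S = S.sum.degree →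
    S.map (wt p) = S.sum.toMultiset.map (fun a => p ^ a) := by
  induction S using Multiset.induction_on with
  | empty => simp
  | cons c S ih =>
    intro h hc
    rw [Multiset.mem_cons, not_or] at h
    have h1 := (Finsupp.degree_eq_zero_iff c).not.2 (Ne.symm h.1)
    have h2 := card_le_deg S h.2
    rw [Multiset.card_cons, Multiset.sum_cons, map_add] at hc
    obtain ⟨a, d, rfl⟩ := exists_sub_single c (Ne.symm h.1)
    rw [map_add, Finsupp.degree_single] at hc
    have hd : d.degree = 0 := by omega
    rw [Finsupp.degree_eq_zero_iff] at hd
    subst hd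
    rw [Multiset.map_cons, ih h.2 (by omega), Multiset.sum_cons, zero_add, map_add, wt_single, Finsupp.toMultiset_single]
    simp

theorem gather_eq (p : ℕ) (L : ℕ →₀ ℕ) (m : ℕ) : m + 1 ≤ L.degree →
    gatherSet m (L.toMultiset.map (fun a => p ^ a)) =
    {μ | ∃ S : Multiset (ℕ →₀ ℕ), 0 ∉ S ∧ Multiset.card S + m = L.degree ∧ S.sum = L ∧ S.map (wt p) = μ} := by
  induction m with
  | zero =>
    intro hL
    ext μ
    simp only [gatherSet, Set.mem_singleton_iff, Set.mem_ofPred_eq, add_zero]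
    constructor
    · rintro rfl
      refine ⟨L.toMultiset.map (fun a => Finsupp.single a 1), ?_, ?_, ?_, ?_⟩
      · simp
      · rw [Multiset.card_map, Finsupp.card_toMultiset, Finsupp.degree_apply]; rfl
      · have := Finsupp.toMultiset_toFinsupp L
        conv_rhs => rw [← this]
        generalize L.toMultiset = M
        induction M using Multiset.induction_on with
        | empty => simp
        | cons a M ih => 
          rw [Multiset.map_cons, Multiset.sum_cons, ih, ← Multiset.singleton_add a M, map_add, Multiset.toFinsupp_singleton]
      · rw [Multiset.map_map]
        simp [wt_single]
    · rintro ⟨S, h0, hc, hs, rfl⟩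
      rw [← hs] at hc ⊢
      exact map_of_card_eq p S h0 hc
  | succ m ih =>
    intro hL
    ext μ
    simp only [gatherSet, ih (by omega), Set.mem_ofPred_eq]
    constructor
    · rintro ⟨u, ⟨S, h0, hc, hs, rfl⟩, a, b, v, hv, rfl⟩
      rw [← Multiset.map_eq_cons] at hv
      obtain ⟨c1, hc1, rfl, hv⟩ := hv
      rw [← Multiset.map_eq_cons] at hv
      obtain ⟨c2, hc2, rfl, rfl⟩ := hv
      obtain ⟨S1, rfl⟩ := Multiset.exists_cons_of_mem hc1
      rw [Multiset.erase_cons_head] at hc2 ⊢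
      obtain ⟨S2, rfl⟩ := Multiset.exists_cons_of_mem hc2
      rw [Multiset.erase_cons_head]
      simp only [Multiset.mem_cons, not_or] at h0
      refine ⟨(c1 + c2) ::ₘ S2, ?_, ?_, ?_, ?_⟩
      · rw [Multiset.mem_cons, not_or]
        refine ⟨fun h => h0.1 ?_, h0.2.2⟩
        rw [eq_comm, add_eq_zero] at h
        exact h.1.symm
      · simp only [Multiset.card_cons] at hc ⊢; omega
      · rw [← hs]; simp [add_assoc]
      · simp
    · rintro ⟨S, h0, hc, hs, rfl⟩
      obtain ⟨c, hcS, hdeg⟩ : ∃ c ∈ S, 2 ≤ c.degree := by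
        by_contra! hlt
        have : S.sum.degree ≤ Multiset.card S := by
          clear hc hs h0
          induction S using Multiset.induction_on with
          | empty => simp
          | cons c S ih' =>
            have h1 := hlt c (Multiset.mem_cons_self c S)
            have h2 := ih' (fun d hd => hlt d (Multiset.mem_cons_of_mem hd))
            rw [Multiset.card_cons, Multiset.sum_cons, map_add]; omega
        rw [hs] at this
        omega
      obtain ⟨S, rfl⟩ := Multiset.exists_cons_of_mem hcS
      obtain ⟨a, d, rfl⟩ := exists_sub_single c (by rintro rfl; simp at hdeg)
      rw [map_add, Finsupp.degree_single] at hdeg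
      have hd : d ≠ 0 := by rintro rfl; simp at hdeg
      refine ⟨_, ⟨d ::ₘ Finsupp.single a 1 ::ₘ S, ?_, ?_, ?_, rfl⟩, wt p d, wt p (Finsupp.single a 1), S.map (wt p), ?_, ?_⟩
      · simp only [Multiset.mem_cons, not_or] at h0 ⊢
        refine ⟨hd.symm, ?_, h0.2⟩
        intro h; have := DFunLike.congr_fun h a; simp at this
      · simp only [Multiset.card_cons] at hc ⊢; omega
      · rw [← hs]; simp [add_assoc]
      · simp
      · simp

theorem E0_prod (p j : ℕ) (c : Fin j → ℕ →₀ ℕ) :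
    ∏ i, E0 p (c i) (X i : MvPolynomial (Fin j) (ZMod p)) =
    monomial (Finsupp.equivFunOnFinite.symm fun i => wt p (c i)) (∏ i, if c i = 0 then 0 else cf p (c i)) := by
  rw [monomial_eq, Finsupp.prod_fintype _ _ (by simp), map_prod, ← Finset.prod_mul_distrib]
  refine Finset.prod_congr rfl fun i _ => ?_
  unfold E0 EE
  split_ifs <;> simp [MvPolynomial.algebraMap_eq]

theorem val_ne (p j : ℕ) [Fact p.Prime] (c : Fin j → ℕ →₀ ℕ) :
    (∏ i, if c i = 0 then 0 else cf p (c i)) ≠ 0 ↔ (∀ i, c i ≠ 0) ∧ ∀ i a, c i a < p := by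
  rw [Finset.prod_ne_zero_iff, ← forall_and]
  refine forall_congr' fun i => ?_
  rw [← cf_ne_zero]
  by_cases h : c i = 0 <;> simp [h]

theorem coeff_FF (p j : ℕ) [Fact p.Prime] (L : ℕ →₀ ℕ) (d : Fin j →₀ ℕ) :
    coeff d (FF p j L (X : Fin j → MvPolynomial (Fin j) (ZMod p))) ≠ 0 ↔
    ∃ c : Fin j → ℕ →₀ ℕ, ∑ i, c i = L ∧ ((∀ i, c i ≠ 0) ∧ ∀ i a, c i a < p) ∧ ∀ i, d i = wt p (c i) := by
  unfold FF
  simp only [E0_prod, coeff_sum, coeff_monomial]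
  constructor
  · intro h
    obtain ⟨c, hc, h⟩ := Finset.exists_ne_zero_of_sum_ne_zero h
    rw [ne_eq, ite_eq_right_iff, Classical.not_imp] at h
    refine ⟨c, Finset.mem_finAntidiagonal.1 hc, (val_ne p j c).1 h.2, fun i => ?_⟩
    rw [← h.1]; rfl
  · rintro ⟨c, hc, hv, hd⟩
    rw [Finset.sum_eq_single c]
    · rw [if_pos]
      · exact (val_ne p j c).2 hv
      · ext i; exact (hd i).symm
    · intro b _ hbc
      rw [ite_eq_right_iff]
      intro hb
      by_contra hne
      have hb' := (val_ne p j b).1 hne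
      apply hbc
      funext i
      apply wt_inj p _ _ (hb'.2 i) (hv.2 i)
      rw [← hd i, ← hb]; rfl
    · intro h; exact absurd (Finset.mem_finAntidiagonal.2 hc) h

theorem FF_homog (p j : ℕ) (L : ℕ →₀ ℕ) :
    (FF p j L (X : Fin j → MvPolynomial (Fin j) (ZMod p))).IsHomogeneous (wt p L) := by
  unfold FF
  refine IsHomogeneous.sum _ _ _ fun c hc => ?_
  rw [E0_prod]
  apply isHomogeneous_monomial
  rw [Finsupp.degree_eq_sum, ← Finset.mem_finAntidiagonal.1 hc, map_sum]
  rfl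

theorem delta_FF (p j : ℕ) [Fact p.Prime] (L : ℕ →₀ ℕ) (hs : SmallC p (j + 1) L) :
    delta (ZMod p) 2 (j + 2) (FF p (j + 2) L X) = 0 := by
  have key := FF_cocycle (R := MvPolynomial (Fin (j + 3)) (ZMod p)) p j L hs (X 0) (X 1) (X 2)
    (fun i => X i.succ.succ.succ)
  unfold delta
  rw [show Finset.Icc 1 2 = {1, 2} from rfl, Finset.sum_pair (by norm_num)]
  simp only [FF_map, aeval_X]
  rw [← key]
  have e1 : (fun i : Fin (j + 2) => (X i.succ : MvPolynomial (Fin (j + 3)) (ZMod p))) =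
      Fin.cons (X 1) (Fin.cons (X 2) fun i => X i.succ.succ.succ) := by
    funext i
    refine Fin.cases ?_ (fun i => ?_) i
    · rfl
    · refine Fin.cases ?_ (fun i => ?_) i <;> rfl
  have e2 : (fun j_1 : Fin (j + 2) =>
          if (j_1 : ℕ) + 1 < 1 then (X j_1.castSucc : MvPolynomial (Fin (j + 3)) (ZMod p))
          else if (j_1 : ℕ) + 1 = 1 then X j_1.castSucc + X j_1.succ
          else X j_1.succ) =
      Fin.cons (X 0 + X 1) (Fin.cons (X 2) fun i => X i.succ.succ.succ) := by
    funext i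
    refine Fin.cases ?_ (fun i => ?_) i
    · rfl
    · refine Fin.cases ?_ (fun i => ?_) i
      · rfl
      · simp
  have e3 : (fun j_1 : Fin (j + 2) =>
          if (j_1 : ℕ) + 1 < 2 then (X j_1.castSucc : MvPolynomial (Fin (j + 3)) (ZMod p))
          else if (j_1 : ℕ) + 1 = 2 then X j_1.castSucc + X j_1.succ
          else X j_1.succ) =
      Fin.cons (X 0) (Fin.cons (X 1 + X 2) fun i => X i.succ.succ.succ) := by
    funext i
    refine Fin.cases ?_ (fun i => ?_) i
    · rfl
    · refine Fin.cases ?_ (fun i => ?_) i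
      · rfl
      · simp
  have e4 : (fun j_1 : Fin (j + 2) =>
          if (j_1 : ℕ) + 1 ≤ 2 then (X j_1.castSucc : MvPolynomial (Fin (j + 3)) (ZMod p))
          else X j_1.succ) =
      Fin.cons (X 0) (Fin.cons (X 1) fun i => X i.succ.succ.succ) := by
    funext i
    refine Fin.cases ?_ (fun i => ?_) i
    · rfl
    · refine Fin.cases ?_ (fun i => ?_) i
      · rfl
      · simp
  rw [e1, e2, e3, e4]
  ring

theorem small_lt (p j : ℕ) (L : ℕ →₀ ℕ) (hs : SmallC p (j + 1) L) (c : Fin (j + 2) → ℕ →₀ ℕ)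
    (h0 : ∀ i, c i ≠ 0) (hc : ∑ i, c i = L) (i : Fin (j + 2)) (a : ℕ) : c i a < p := by
  refine hs (c i) (∑ x ∈ Finset.univ.erase i, c x) ?_ ?_ a
  · rw [Finset.add_sum_erase _ _ (Finset.mem_univ i), hc]
  · rw [map_sum]
    have : ∑ x ∈ Finset.univ.erase i, 1 ≤ ∑ x ∈ Finset.univ.erase i, (c x).degree :=
      Finset.sum_le_sum fun x _ => by
        have := (Finsupp.degree_eq_zero_iff (c x)).not.2 (h0 x)
        omega
    simpa using this

theorem statement9 (p : ℕ) (hp : p.Prime) (n k m : ℕ)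
    (lam : Multiset ℕ) (hpow : IsPowOf p lam) (hcard : Multiset.card lam = k)
    (hsum : lam.sum = n) (hm : m + 2 ≤ k)
    (hcond : m ≤ p - 2 ∨ k = sigmaDigits p n) :
    ∃ f : MvPolynomial (Fin (k - m)) (ZMod p), f ≠ 0 ∧ f.IsSymmetric ∧
      f.IsHomogeneous n ∧ delta (ZMod p) 2 (k - m) f = 0 ∧
      {μ : Multiset ℕ | ∃ d : Fin (k - m) →₀ ℕ,
          MvPolynomial.coeff d f ≠ 0 ∧ exMult d = μ} = gatherSet m lam := by
  have : Fact p.Prime := ⟨hp⟩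
  have hp2 := hp.two_le
  obtain ⟨L, rfl⟩ : ∃ L : ℕ →₀ ℕ, lam = L.toMultiset.map (fun a => p ^ a) := by
    suffices ∃ M : Multiset ℕ, lam = M.map (fun a => p ^ a) by
      obtain ⟨M, rfl⟩ := this
      exact ⟨Multiset.toFinsupp M, by simp⟩
    clear hcard hsum
    induction lam using Multiset.induction_on with
    | empty => exact ⟨0, by simp⟩
    | cons x s ih =>
      obtain ⟨M, hM⟩ := ih (fun y hy => hpow y (Multiset.mem_cons_of_mem hy))
      obtain ⟨a, rfl⟩ := hpow x (Multiset.mem_cons_self x s)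
      exact ⟨a ::ₘ M, by simp [hM]⟩
  have hdeg : L.degree = k := by
    rw [← hcard, Multiset.card_map, Finsupp.card_toMultiset, Finsupp.degree_apply]; rfl
  have hwt : wt p L = n := by
    rw [← hsum]
    clear hpow hcard hsum hdeg hcond
    have := Finsupp.toMultiset_toFinsupp L
    conv_lhs => rw [← this]
    generalize L.toMultiset = M
    induction M using Multiset.induction_on with
    | empty => simp
    | cons a M ih =>
      rw [Multiset.map_cons, Multiset.sum_cons, ← ih, ← Multiset.singleton_add a M, map_add, map_add,
        Multiset.toFinsupp_singleton, wt_single, one_mul]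
  obtain ⟨j, hj⟩ : ∃ j, k - m = j + 2 := ⟨k - m - 2, by omega⟩
  rw [hj]
  have hs : SmallC p (j + 1) L := by
    intro c d hcd hd a
    rcases hcond with h | h
    · have h1 := congrArg Finsupp.degree hcd
      rw [map_add] at h1
      have := Finsupp.le_degree a c
      omega
    · have := lt_of_sig p hp2 L (by rw [hdeg, hwt, h]) a
      rw [← hcd] at this
      exact lt_of_le_of_lt (by simp) this
  have hset : {μ : Multiset ℕ | ∃ d : Fin (j + 2) →₀ ℕ,
      MvPolynomial.coeff d (FF p (j + 2) L (X : _ → MvPolynomial (Fin (j + 2)) (ZMod p))) ≠ 0 ∧ exMult d = μ}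
        = gatherSet m (L.toMultiset.map (fun a => p ^ a)) := by
    rw [gather_eq p L m (by omega)]
    ext μ
    simp only [Set.mem_ofPred_eq, coeff_FF]
    constructor
    · rintro ⟨d, ⟨c, hc, hv, hd⟩, rfl⟩
      refine ⟨Finset.univ.val.map c, ?_, ?_, hc, ?_⟩
      · simp only [Multiset.mem_map, not_exists, not_and]
        intro i _; exact hv.1 i
      · simp; omega
      · rw [Multiset.map_map]
        unfold exMult multisetOf
        exact Multiset.map_congr rfl fun i _ => (hd i).symm
    · rintro ⟨S, h0, hc, hS, rfl⟩
      obtain ⟨c, rfl⟩ : ∃ c : Fin (j + 2) → ℕ →₀ ℕ, Finset.univ.val.map c = S := by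
        have hcS : Multiset.card S = j + 2 := by omega
        rw [← hcS]
        obtain ⟨l, rfl⟩ := Quot.exists_rep S
        exact ⟨l.get, (Fin.univ_val_map l.get).trans (congrArg _ (List.ofFn_get l))⟩
      have hne : ∀ i, c i ≠ 0 := fun i hi => h0 (by
        rw [Multiset.mem_map]; exact ⟨i, Finset.mem_univ i, hi⟩)
      refine ⟨Finsupp.equivFunOnFinite.symm fun i => wt p (c i), ⟨c, hS, ⟨hne, ?_⟩, fun i => rfl⟩, ?_⟩
      · exact small_lt p j L hs c hne hS
      · rw [Multiset.map_map]; rfl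
  refine ⟨FF p (j + 2) L X, ?_, ?_, ?_, delta_FF p j L hs, hset⟩
  · intro h0
    have hne : ∀ m', m' + 1 ≤ L.degree → (gatherSet m' (L.toMultiset.map (fun a => p ^ a))).Nonempty := by
      intro m'
      induction m' with
      | zero => intro _; exact ⟨_, rfl⟩
      | succ m' ih =>
        intro h
        obtain ⟨μ, hμ⟩ := ih (by omega)
        have hμ' := hμ
        rw [gather_eq p L m' (by omega)] at hμ'
        obtain ⟨S, _, hc, _, rfl⟩ := hμ'
        obtain ⟨a, T, hT⟩ := Multiset.card_pos_iff_exists_mem.1 (show 0 < Multiset.card (S.map (wt p)) by rw [Multiset.card_map]; omega) |>.imp (fun a ha => Multiset.exists_cons_of_mem ha)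
        have hcT := congrArg Multiset.card hT
        rw [Multiset.card_map, Multiset.card_cons] at hcT
        obtain ⟨b, U, hU⟩ := Multiset.card_pos_iff_exists_mem.1 (show 0 < Multiset.card T by omega) |>.imp (fun a ha => Multiset.exists_cons_of_mem ha)
        exact ⟨(a + b) ::ₘ U, _, hμ, a, b, U, by rw [hT, hU], rfl⟩
    obtain ⟨μ, hμ⟩ := hne m (by omega)
    rw [← hset, h0] at hμ
    obtain ⟨d, hd, _⟩ := hμ
    exact hd (by simp)
  · intro e
    have : (rename e (FF p (j + 2) L (X : _ → MvPolynomial (Fin (j + 2)) (ZMod p)))) = FF p (j + 2) L (fun i => X (e i)) := by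
      rw [FF_map]; simp
    rw [this]
    exact FF_perm p (j + 2) L X e
  · rw [← hwt]; exact FF_homog p (j + 2) L
end

section
/- Let p be a prime, let λ be a power-of-p multiset of cardinality k with sum n, and let 0 ≤ m ≤ k − 2 satisfy either m ≤ p − 2 or k = σ_p(n). Then every nonzero symmetric polynomial g ∈ Z_p[x_1,…,x_{k−m}], homogeneous of degree n, with δ_2(g) = 0 and with exponent-multiset support contained in T^m(λ), has exponent-multiset support equal to all of T^m(λ). (In particular, the 2-cocycle supported on T^m(λ) is indecomposable: it cannot be written as the sum of two nonzero 2-cocycles with disjoint exponent-multiset supports.) -/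
open MvPolynomial

theorem sd_sub (p : ℕ) [Fact p.Prime] (a b : ℕ) :
    sigmaDigits p (a + b) ≤ sigmaDigits p a + sigmaDigits p b := by
  unfold sigmaDigits
  have h1 := sub_one_mul_padicValNat_factorial (p := p) a
  have h2 := sub_one_mul_padicValNat_factorial (p := p) b
  have h3 := sub_one_mul_padicValNat_factorial (p := p) (a + b)
  have e : padicValNat p (a + b).factorial = padicValNat p ((a+b).choose b) +
      padicValNat p a.factorial + padicValNat p b.factorial := by
    have hc : (a + b).choose b ≠ 0 := (Nat.choose_pos (Nat.le_add_left b a)).ne'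
    rw [← Nat.add_choose_mul_factorial_mul_factorial a b,
      padicValNat.mul (mul_ne_zero hc (Nat.factorial_ne_zero _)) (Nat.factorial_ne_zero _),
      padicValNat.mul hc (Nat.factorial_ne_zero _)]
  rw [e, mul_add, mul_add] at h3
  have l1 := Nat.digit_sum_le p a
  have l2 := Nat.digit_sum_le p b
  have l3 := Nat.digit_sum_le p (a+b)
  omega

theorem sd_choose (p : ℕ) [hp : Fact p.Prime] (a b : ℕ)
    (h : sigmaDigits p a + sigmaDigits p b ≤ sigmaDigits p (a + b)) :
    ((a + b).choose a : ZMod p) ≠ 0 := by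
  have h3 := sub_one_mul_padicValNat_choose_eq_sub_sum_digits' (p := p) (k := a) (n := b)
  unfold sigmaDigits at h
  rw [add_comm b a, Nat.sub_eq_zero_of_le h] at h3
  have h2 := hp.out.two_le
  have : padicValNat p ((a + b).choose a) = 0 := by
    rcases Nat.mul_eq_zero.mp h3 with h | h
    · omega
    · exact h
  rw [Ne, ZMod.natCast_eq_zero_iff]
  intro hd
  have := one_le_padicValNat_of_dvd (Nat.choose_pos (Nat.le_add_right a b)).ne' hd
  omega

theorem sd_card (p : ℕ) [hp : Fact p.Prime] (B : Multiset ℕ) (hB : IsPowOf p B) :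
    sigmaDigits p B.sum ≤ Multiset.card B := by
  induction B using Multiset.induction with
  | empty => simp [sigmaDigits]
  | cons x B ih =>
    have h1 := ih (fun y hy => hB y (Multiset.mem_cons_of_mem hy))
    obtain ⟨a, rfl⟩ := hB x (Multiset.mem_cons_self x B)
    have h2 := sd_sub p (p ^ a) B.sum
    have h3 : sigmaDigits p (p ^ a) = 1 := by
      unfold sigmaDigits
      have := Nat.digits_base_pow_mul (k := a) (m := 1) hp.out.one_lt one_pos
      rw [mul_one] at this
      rw [this, Nat.digits_of_lt p 1 one_ne_zero hp.out.one_lt]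
      simp
    rw [Multiset.sum_cons, Multiset.card_cons]
    omega

theorem sd_small (p : ℕ) [hp : Fact p.Prime] (B : Multiset ℕ) (hB : IsPowOf p B)
    (hc : Multiset.card B ≤ p - 1) : sigmaDigits p B.sum = Multiset.card B := by
  have h1 := sd_card p B hB
  have h2 := hp.out.two_le
  rcases Multiset.empty_or_exists_mem B with rfl | ⟨x, hx⟩
  · simp [sigmaDigits]
  have hpos : 0 < sigmaDigits p B.sum := by
    have hs : B.sum ≠ 0 := by
      intro h
      have := Multiset.sum_eq_zero_iff.mp h x hx
      obtain ⟨a, ha⟩ := hB x hx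
      have := pow_pos hp.out.pos a
      omega
    have hnil : p.digits B.sum ≠ [] := Nat.digits_ne_nil_iff_ne_zero.mpr hs
    exact List.sum_pos_iff_exists_pos_nat.mpr
      ⟨_, List.getLast_mem hnil, Nat.pos_of_ne_zero (Nat.getLast_digit_ne_zero p hs)⟩
  have m1 : B.sum ≡ sigmaDigits p B.sum [MOD (p - 1)] := by
    rcases eq_or_ne p 2 with rfl | hne
    · exact Nat.modEq_one
    · refine Nat.modEq_digits_sum _ _ ?_ _
      conv_lhs => rw [show p = 1 + (p - 1) by omega]
      rw [Nat.add_sub_cancel_left, Nat.add_mod_right]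
      exact Nat.mod_eq_of_lt (by omega)
  have m2 : B.sum ≡ Multiset.card B [MOD (p - 1)] := by
    clear hc h1 hpos m1 hx
    induction B using Multiset.induction with
    | empty => exact Nat.ModEq.rfl
    | cons x B ih =>
      have h1 := ih (fun y hy => hB y (Multiset.mem_cons_of_mem hy))
      obtain ⟨a, rfl⟩ := hB x (Multiset.mem_cons_self x B)
      rw [Multiset.sum_cons, Multiset.card_cons, add_comm]
      refine h1.add ?_
      have : p ≡ 1 [MOD (p - 1)] := by
        conv_lhs => rw [show p = 1 + (p - 1) by omega]
        simp [Nat.ModEq]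
      simpa using this.pow a
  have m3 := m1.symm.trans m2
  have := (Nat.modEq_iff_dvd' h1).mp m3
  have := Nat.eq_zero_of_dvd_of_lt this (by omega)
  omega

/-- A carry-free block. -/
def NCB (p : ℕ) (B : Multiset ℕ) : Prop :=
  ∀ A C : Multiset ℕ, B = A + C → ((A.sum + C.sum).choose A.sum : ZMod p) ≠ 0

theorem ncb_of (p : ℕ) [hp : Fact p.Prime] (B : Multiset ℕ) (hB : IsPowOf p B)
    (h : Multiset.card B ≤ sigmaDigits p B.sum) : NCB p B := by
  rintro A C rfl
  have h1 := sd_card p A (fun y hy => hB y (Multiset.mem_add.mpr (Or.inl hy)))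
  have h2 := sd_card p C (fun y hy => hB y (Multiset.mem_add.mpr (Or.inr hy)))
  rw [Multiset.card_add, Multiset.sum_add] at h
  exact sd_choose p _ _ (by omega)

/-- Valid block decomposition. -/
def Valid (lam : Multiset ℕ) (r : ℕ) (P : Multiset (Multiset ℕ)) : Prop :=
  P.sum = lam ∧ (∀ B ∈ P, B ≠ 0) ∧ Multiset.card P = r + 2

theorem valid_ncb (p : ℕ) [hp : Fact p.Prime] (lam : Multiset ℕ) (hl : IsPowOf p lam) (r m : ℕ)
    (hk : Multiset.card lam = r + 2 + m)
    (hcond : m ≤ p - 2 ∨ Multiset.card lam = sigmaDigits p lam.sum)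
    (B : Multiset ℕ) (Q : Multiset (Multiset ℕ)) (hP : Valid lam r (B ::ₘ Q)) : NCB p B := by
  obtain ⟨h1, h2, h3⟩ := hP
  rw [Multiset.sum_cons] at h1
  subst h1
  have hB : IsPowOf p B := fun y hy => hl y (Multiset.mem_add.mpr (Or.inl hy))
  have hQ : IsPowOf p Q.sum := fun y hy => hl y (Multiset.mem_add.mpr (Or.inr hy))
  have h2p := hp.out.two_le
  apply ncb_of p B hB
  rcases hcond with h | h
  · refine (sd_small p B hB ?_).ge
    have : Multiset.card Q ≤ Multiset.card Q.sum := by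
      have h2' : ∀ C ∈ Q, C ≠ 0 := fun C hC => h2 C (Multiset.mem_cons_of_mem hC)
      clear h3 hQ hl hk h2
      induction Q using Multiset.induction with
      | empty => simp
      | cons C Q ih =>
        have := ih (fun D hD => h2' D (Multiset.mem_cons_of_mem hD))
        have hC := Multiset.card_pos.mpr (h2' C (Multiset.mem_cons_self _ _))
        simp only [Multiset.sum_cons, Multiset.card_add, Multiset.card_cons]
        omega
    simp only [Multiset.card_add, Multiset.card_cons] at hk h3
    omega
  · have a1 := sd_card p B hB
    have a2 := sd_card p _ hQ
    have a3 := sd_sub p B.sum Q.sum.sum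
    rw [Multiset.card_add, Multiset.sum_add] at h
    omega

theorem gather_valid (lam : Multiset ℕ) (h0 : ∀ x ∈ lam, 0 < x) (m : ℕ) :
    ∀ t ∈ gatherSet m lam, ∃ P : Multiset (Multiset ℕ), P.sum = lam ∧ (∀ B ∈ P, B ≠ 0) ∧
      P.map Multiset.sum = t := by
  induction m with
  | zero =>
    rintro t rfl
    refine ⟨t.map (fun x => {x}), ?_, ?_, ?_⟩
    · simp
    · intro B hB
      obtain ⟨x, -, rfl⟩ := Multiset.mem_map.mp hB
      simp
    · simp
  | succ m ih =>
    rintro t ⟨u, hu, a, b, w, rfl, rfl⟩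
    obtain ⟨P, h1, h2, h3⟩ := ih _ hu
    classical
    obtain ⟨A, hA, rfl, h4⟩ := (Multiset.map_eq_cons _ _ _ _).mpr h3
    obtain ⟨B, hB, rfl, h5⟩ := (Multiset.map_eq_cons _ _ _ _).mpr h4
    obtain ⟨P, rfl⟩ := Multiset.exists_cons_of_mem hA
    rw [Multiset.erase_cons_head] at hB h5
    obtain ⟨P, rfl⟩ := Multiset.exists_cons_of_mem hB
    rw [Multiset.erase_cons_head] at h5
    refine ⟨(A + B) ::ₘ P, ?_, ?_, ?_⟩
    · rw [← h1]; simp [add_assoc]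
    · intro C hC
      rcases Multiset.mem_cons.mp hC with rfl | hC
      · have := h2 A (by simp)
        simp [this]
      · exact h2 C (by simp [hC])
    · simp [h5]

section conn
variable (p : ℕ) (lam : Multiset ℕ) (r : ℕ) (S : Multiset ℕ → Prop)

/-- Step property. -/
def StepOK (lam : Multiset ℕ) (r : ℕ) (S : Multiset ℕ → Prop) : Prop :=
  ∀ (A B Y : Multiset ℕ) (Q : Multiset (Multiset ℕ)), A ≠ 0 → B ≠ 0 → Y ≠ 0 →
    Valid lam r ((A + B) ::ₘ Y ::ₘ Q) →
    (S (((A + B) ::ₘ Y ::ₘ Q).map Multiset.sum) ↔ S ((A ::ₘ (B + Y) ::ₘ Q).map Multiset.sum))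

theorem to_star (hS : StepOK lam r S) (Q : Multiset (Multiset ℕ)) : ∀ (A T : Multiset ℕ),
    Valid lam r (A ::ₘ (Q + T.map (fun x => {x}))) →
    ∃ A' T' : Multiset ℕ, Valid lam r (A' ::ₘ (T'.map (fun x => {x}))) ∧
      (S ((A ::ₘ (Q + T.map (fun x => {x}))).map Multiset.sum) ↔
        S ((A' ::ₘ (T'.map (fun x => {x}))).map Multiset.sum)) := by
  induction Q using Multiset.induction with
  | empty =>
    intro A T h
    rw [zero_add] at h
    exact ⟨A, T, h, by rw [zero_add]⟩
  | cons B Q ih =>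
    intro A T h
    have hB : B ≠ 0 := h.2.1 B (by simp)
    have hA : A ≠ 0 := h.2.1 A (by simp)
    obtain ⟨b, hb⟩ := Multiset.exists_mem_of_ne_zero hB
    obtain ⟨B, rfl⟩ := Multiset.exists_cons_of_mem hb
    have key : ∀ A : Multiset ℕ, A ::ₘ ({b} ::ₘ Q + T.map (fun x => {x}))
        = A ::ₘ (Q + (b ::ₘ T).map (fun x => {x})) := by
      intro A
      simp
    by_cases hB0 : B = 0
    · subst hB0
      have e := key A
      rw [show (b ::ₘ (0 : Multiset ℕ)) = {b} from rfl] at h ⊢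
      rw [e] at h ⊢
      exact ih A _ h
    · have e1 : A ::ₘ ((b ::ₘ B) ::ₘ Q + T.map (fun x => {x})) =
        ({b} + B) ::ₘ A ::ₘ (Q + T.map (fun x => {x})) := by
        rw [Multiset.cons_add, Multiset.cons_swap, Multiset.singleton_add]
      have e2 : {b} ::ₘ (B + A) ::ₘ (Q + T.map (fun x => {x})) =
        (B + A) ::ₘ (Q + (b ::ₘ T).map (fun x => {x})) := by
        rw [← key, Multiset.cons_add, Multiset.cons_swap]
      rw [e1] at h ⊢
      rw [hS {b} B A _ (by simp) hB0 hA h, e2]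
      apply ih
      rw [← e2]
      refine ⟨?_, ?_, ?_⟩
      · rw [← h.1]; simp only [Multiset.sum_cons]; abel
      · intro C hC
        rcases Multiset.mem_cons.mp hC with rfl | hC
        · simp
        rcases Multiset.mem_cons.mp hC with rfl | hC
        · simp [hB0]
        · exact h.2.1 C (by simp only [Multiset.mem_cons]; tauto)
      · simpa using h.2.2

theorem star_swap (hS : StepOK lam r S) (x s : ℕ) (A T : Multiset ℕ)
    (h : Valid lam r ((x ::ₘ A) ::ₘ ((s ::ₘ T).map (fun x => {x})))) :
    Valid lam r ((s ::ₘ A) ::ₘ ((x ::ₘ T).map (fun x => {x}))) ∧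
    (S (((x ::ₘ A) ::ₘ ((s ::ₘ T).map (fun x => {x}))).map Multiset.sum) ↔
      S (((s ::ₘ A) ::ₘ ((x ::ₘ T).map (fun x => {x}))).map Multiset.sum)) := by
  have hT : ∀ B ∈ T.map (fun x => ({x} : Multiset ℕ)), B ≠ 0 := by
    intro B hB
    obtain ⟨y, -, rfl⟩ := Multiset.mem_map.mp hB
    simp
  have hv : Valid lam r ((s ::ₘ A) ::ₘ ((x ::ₘ T).map (fun x => {x}))) := by
    refine ⟨?_, ?_, ?_⟩
    · rw [← h.1]; simp only [Multiset.sum_cons, Multiset.map_cons]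
      simp only [← Multiset.singleton_add]; abel
    · intro C hC
      rw [Multiset.map_cons] at hC
      rcases Multiset.mem_cons.mp hC with rfl | hC
      · simp
      rcases Multiset.mem_cons.mp hC with rfl | hC
      · simp
      exact hT C hC
    · simpa using h.2.2
  refine ⟨hv, ?_⟩
  by_cases hA : A = 0
  · subst hA
    simp only [Multiset.map_cons, Multiset.sum_cons, Multiset.sum_zero, add_zero,
      Multiset.sum_singleton]
    rw [Multiset.cons_swap]
  · have e1 : (x ::ₘ A) ::ₘ ((s ::ₘ T).map (fun x => {x})) =
      (A + {x}) ::ₘ {s} ::ₘ T.map (fun x => {x}) := by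
      rw [Multiset.map_cons, add_comm, Multiset.singleton_add]
    have e2 : (s ::ₘ A) ::ₘ ((x ::ₘ T).map (fun x => {x})) =
      (A + {s}) ::ₘ {x} ::ₘ T.map (fun x => {x}) := by
      rw [Multiset.map_cons, add_comm, Multiset.singleton_add]
    rw [e1] at h ⊢
    rw [e2] at hv ⊢
    rw [hS A {x} {s} _ hA (by simp) (by simp) h, hS A {s} {x} _ hA (by simp) (by simp) hv,
      add_comm]

theorem star_conn (hS : StepOK lam r S) (T : Multiset ℕ) : ∀ (T' A A' W : Multiset ℕ),
    Valid lam r (A ::ₘ ((T + W).map (fun x => {x}))) →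
    Valid lam r (A' ::ₘ ((T' + W).map (fun x => {x}))) →
    (S ((A ::ₘ ((T + W).map (fun x => {x}))).map Multiset.sum) ↔
      S ((A' ::ₘ ((T' + W).map (fun x => {x}))).map Multiset.sum)) := by
  induction T using Multiset.induction with
  | empty =>
    intro T' A A' W h h'
    have c1 := h.2.2
    have c2 := h'.2.2
    simp only [Multiset.card_cons, Multiset.card_map, Multiset.card_add, Multiset.card_zero] at c1 c2
    have : T' = 0 := Multiset.card_eq_zero.mp (by omega)
    subst this
    have e := h.1.trans h'.1.symm
    rw [Multiset.sum_cons, Multiset.sum_cons] at e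
    rw [add_right_cancel e]
  | cons s T ih =>
    intro T' A A' W h h'
    have c1 := h.2.2
    have c2 := h'.2.2
    simp only [Multiset.card_cons, Multiset.card_map, Multiset.card_add] at c1 c2
    have e := h.1.trans h'.1.symm
    simp only [Multiset.sum_cons, Multiset.sum_map_singleton] at e
    have m1 : ∀ T : Multiset ℕ, s ::ₘ T + W = T + (s ::ₘ W) := by
      intro T
      rw [Multiset.cons_add, Multiset.add_cons]
    by_cases hs : s ∈ T'
    · obtain ⟨T', rfl⟩ := Multiset.exists_cons_of_mem hs
      rw [m1] at h h' ⊢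
      rw [m1]
      exact ih T' A A' _ h h'
    · have hsA : s ∈ A' := by
        have e' : A + (s ::ₘ T) = A' + T' := by
          apply add_right_cancel (b := W)
          rw [add_assoc, e, add_assoc]
        have : s ∈ A' + T' := by rw [← e']; simp
        rcases Multiset.mem_add.mp this with h | h
        · exact h
        · exact absurd h hs
      obtain ⟨A', rfl⟩ := Multiset.exists_cons_of_mem hsA
      have : T' ≠ 0 := by
        rintro rfl
        simp at c2
        omega
      obtain ⟨x, hx⟩ := Multiset.exists_mem_of_ne_zero this
      obtain ⟨T', rfl⟩ := Multiset.exists_cons_of_mem hx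
      rw [Multiset.cons_add] at h'
      obtain ⟨hv, hi⟩ := star_swap lam r S hS s x A' _ h'
      rw [Multiset.cons_add x T', hi]
      rw [← Multiset.cons_add, m1] at hv ⊢
      rw [m1] at h ⊢
      exact ih T' A _ _ h hv

theorem all_conn (hS : StepOK lam r S) (P P' : Multiset (Multiset ℕ)) (h : Valid lam r P)
    (h' : Valid lam r P') (hP : S (P.map Multiset.sum)) : S (P'.map Multiset.sum) := by
  have main : ∀ P, Valid lam r P → ∃ A' T' : Multiset ℕ,
      Valid lam r (A' ::ₘ (T'.map (fun x => {x}))) ∧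
      (S (P.map Multiset.sum) ↔ S ((A' ::ₘ (T'.map (fun x => {x}))).map Multiset.sum)) := by
    intro P h
    have : P ≠ 0 := by
      rintro rfl
      have := h.2.2
      simp at this
    obtain ⟨A, hA⟩ := Multiset.exists_mem_of_ne_zero this
    obtain ⟨Q, rfl⟩ := Multiset.exists_cons_of_mem hA
    have := to_star lam r S hS Q A 0
    simpa using this (by simpa using h)
  obtain ⟨A, T, v, i⟩ := main P h
  obtain ⟨A', T', v', i'⟩ := main P' h'
  have := star_conn lam r S hS T T' A A' 0
  simp only [add_zero] at this
  exact i'.mpr ((this v v').mp (i.mp hP))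

end conn

theorem perm_of_multisetOf {k : ℕ} (f g : Fin k → ℕ) (h : multisetOf f = multisetOf g) :
    ∃ σ : Equiv.Perm (Fin k), f = g ∘ σ := by
  unfold multisetOf at h
  rw [Fin.univ_val_map, Fin.univ_val_map, Multiset.coe_eq_coe] at h
  have e : f ∘ Tuple.sort f = g ∘ Tuple.sort g := by
    apply List.ofFn_injective
    have hp : (List.ofFn (f ∘ Tuple.sort f)).Perm (List.ofFn (g ∘ Tuple.sort g)) :=
      (((Tuple.sort f).ofFn_comp_perm f).trans h).trans ((Tuple.sort g).ofFn_comp_perm g).symm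
    exact hp.eq_of_pairwise' (Tuple.monotone_sort f).sortedLE_ofFn.pairwise
      (Tuple.monotone_sort g).sortedLE_ofFn.pairwise
  refine ⟨(Tuple.sort f).symm.trans (Tuple.sort g), ?_⟩
  funext i
  have := congrFun e ((Tuple.sort f).symm i)
  simpa using this

theorem coeff_perm {k : ℕ} {R : Type*} [CommRing R] (g : MvPolynomial (Fin k) R)
    (hg : g.IsSymmetric) (d d' : Fin k →₀ ℕ) (h : exMult d = exMult d') :
    coeff d g = coeff d' g := by
  obtain ⟨σ, hσ⟩ := perm_of_multisetOf _ _ h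
  have : d' = d.mapDomain σ := by
    ext i
    rw [← σ.apply_symm_apply i, Finsupp.mapDomain_apply σ.injective, hσ]
    simp
  rw [this, ← coeff_rename_mapDomain σ σ.injective g d, hg σ]

theorem coeff_first (r : ℕ) {R : Type*} [CommRing R] (g : MvPolynomial (Fin (r + 1)) R)
    (a b : ℕ) (u : Fin r → ℕ) (φ : Fin (r + 1) → MvPolynomial (Fin (r + 2)) R)
    (h0 : φ 0 = X 0 + X 1) (hs : ∀ j : Fin r, φ j.succ = X j.succ.succ) :
    coeff (Finsupp.equivFunOnFinite.symm (Fin.cons a (Fin.cons b u) : Fin (r + 2) → ℕ))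
      (aeval φ g) = ((a + b).choose a : R) *
      coeff (Finsupp.equivFunOnFinite.symm (Fin.cons (a + b) u : Fin (r + 1) → ℕ)) g := by
  induction g using MvPolynomial.induction_on' with
  | add p q hp hq => rw [map_add, coeff_add, coeff_add, hp, hq, mul_add]
  | monomial d c =>
    have e : aeval φ (monomial d c) = ∑ i ∈ Finset.HasAntidiagonal.antidiagonal (d 0),
        monomial (Finsupp.equivFunOnFinite.symm
          (Fin.cons i.1 (Fin.cons i.2 (fun j => d j.succ)) : Fin (r + 2) → ℕ))
          (((d 0).choose i.1 : R) * c) := by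
      rw [aeval_monomial, Finsupp.prod_fintype _ _ (fun _ => pow_zero _), Fin.prod_univ_succ, h0,
        Commute.add_pow' (Commute.all _ _), Finset.sum_mul, Finset.mul_sum]
      refine Finset.sum_congr rfl fun i _ => ?_
      rw [monomial_eq, Finsupp.prod_fintype _ _ (fun _ => pow_zero _), Fin.prod_univ_succ,
        Fin.prod_univ_succ]
      simp [hs, nsmul_eq_mul]
      ring
    rw [e, coeff_sum]
    simp only [coeff_monomial]
    by_cases hd : d = Finsupp.equivFunOnFinite.symm (Fin.cons (a + b) u : Fin (r + 1) → ℕ)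
    · have hd0 : d 0 = a + b := by rw [hd]; simp
      have hds : (fun j : Fin r => d j.succ) = u := by rw [hd]; ext j; simp
      rw [if_pos hd, Finset.sum_eq_single (a, b)]
      · rw [hds, if_pos rfl, hd0]
      · rintro ⟨i, j⟩ hij hne
        rw [if_neg]
        intro h
        have h := Finsupp.equivFunOnFinite.symm.injective h
        have h1 := congrFun h 0
        have h2 := congrFun h 1
        rw [← Fin.succ_zero_eq_one] at h2
        simp only [Fin.cons_zero, Fin.cons_succ] at h1 h2
        exact hne (by rw [h1, h2])
      · intro h
        exact absurd (Finset.HasAntidiagonal.mem_antidiagonal.mpr hd0.symm) h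
    · rw [if_neg hd, mul_zero]
      refine Finset.sum_eq_zero fun i hi => ?_
      rw [if_neg]
      intro h
      apply hd
      have h := Finsupp.equivFunOnFinite.symm.injective h
      have h1 := congrFun h 0
      have h2 := congrFun h (Fin.succ 0)
      simp only [Fin.cons_zero, Fin.cons_succ] at h1 h2
      have hi := Finset.HasAntidiagonal.mem_antidiagonal.mp hi
      ext j
      refine Fin.cases ?_ (fun j => ?_) j
      · simp; omega
      · have h3 := congrFun h j.succ.succ
        simpa using h3

theorem coeff_zero_of {k l : ℕ} {R : Type*} [CommRing R] (g : MvPolynomial (Fin k) R)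
    (f : Fin k → Fin l) (i : Fin l) (hi : ∀ j, f j ≠ i) (e : Fin l →₀ ℕ) (he : e i ≠ 0) :
    coeff e (aeval (fun j => (X (f j) : MvPolynomial (Fin l) R)) g) = 0 := by
  have : aeval (fun j => (X (f j) : MvPolynomial (Fin l) R)) g = rename f g := by
    refine DFunLike.congr_fun (F := MvPolynomial (Fin k) R →ₐ[R] MvPolynomial (Fin l) R) ?_ g
    apply algHom_ext
    intro j
    simp
  rw [this]
  apply coeff_rename_eq_zero
  rintro u rfl
  exfalso
  apply he
  apply Finsupp.mapDomain_of_notMem_range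
  rintro ⟨j, hj⟩
  exact hi j hj

theorem cocycle_rel (r : ℕ) {R : Type*} [CommRing R] (g : MvPolynomial (Fin (r + 2)) R)
    (hg : g.IsSymmetric) (hd : delta R 2 (r + 2) g = 0) (a b y : ℕ) (ha : a ≠ 0) (hy : y ≠ 0)
    (u : Fin r → ℕ) :
    ((a + b).choose a : R) *
      coeff (Finsupp.equivFunOnFinite.symm (Fin.cons (a + b) (Fin.cons y u) : Fin (r + 2) → ℕ)) g
    = ((b + y).choose b : R) *
      coeff (Finsupp.equivFunOnFinite.symm (Fin.cons (b + y) (Fin.cons a u) : Fin (r + 2) → ℕ)) g := by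
  set e : Fin (r + 3) →₀ ℕ := Finsupp.equivFunOnFinite.symm
    (Fin.cons a (Fin.cons b (Fin.cons y u)) : Fin (r + 3) → ℕ) with he
  have hc := congrArg (coeff e) hd
  unfold delta at hc
  rw [show Finset.Icc 1 2 = {1, 2} from rfl, Finset.sum_pair (by norm_num)] at hc
  have n1 : (-1 : MvPolynomial (Fin (r + 3)) R) ^ (2 + 1) = -1 := by ring
  have n2 : (-1 : MvPolynomial (Fin (r + 3)) R) ^ 2 = 1 := by ring
  rw [n1, n2, pow_one, one_mul, neg_one_mul, neg_one_mul] at hc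
  simp only [coeff_add, coeff_neg, coeff_zero] at hc
  rw [coeff_zero_of g Fin.succ 0 (fun j => Fin.succ_ne_zero j) e (by simp [he, ha])] at hc
  have t4 : coeff e (aeval (fun j : Fin (r + 2) =>
          if (j : ℕ) + 1 ≤ 2 then (X j.castSucc : MvPolynomial (Fin (r + 3)) R)
          else X j.succ) g) = 0 := by
    have := coeff_zero_of g (fun j : Fin (r + 2) => if (j : ℕ) + 1 ≤ 2 then j.castSucc else j.succ)
      (Fin.succ (Fin.succ 0)) ?_ e
      (by rw [he]; simpa only [Finsupp.coe_equivFunOnFinite_symm, Fin.cons_succ, Fin.cons_zero] using hy)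
    · rw [← this]
      congr 3
      funext j
      split_ifs <;> rfl
    · intro j h
      have := congrArg Fin.val h
      split_ifs at this <;> simp only [Fin.val_succ, Fin.val_zero, Fin.val_castSucc] at this <;> omega
  rw [t4] at hc
  rw [he, coeff_first (r + 1) g a b (Fin.cons y u) _ (by simp) (by intro j; simp)] at hc
  -- the other term
  let ρ : Fin (r + 3) → Fin (r + 3) :=
    Fin.cons (Fin.succ 0) (Fin.cons (Fin.succ (Fin.succ 0)) (Fin.cons 0 (fun j => j.succ.succ.succ)))
  have hρ : Function.Injective ρ := by
    intro i j
    refine Fin.cases ?_ (fun i => Fin.cases ?_ (fun i => Fin.cases ?_ (fun i => ?_) i) i) i <;>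
    refine Fin.cases ?_ (fun j => Fin.cases ?_ (fun j => Fin.cases ?_ (fun j => ?_) j) j) j <;>
    simp only [ρ, Fin.ext_iff, Fin.cons_zero, Fin.cons_succ, Fin.val_succ, Fin.val_zero] <;>
    first | omega | simp
  have hmap : e = Finsupp.mapDomain ρ (Finsupp.equivFunOnFinite.symm
      (Fin.cons b (Fin.cons y (Fin.cons a u)) : Fin (r + 3) → ℕ)) := by
    ext i
    have key : ∀ i, e (ρ i) = (Fin.cons b (Fin.cons y (Fin.cons a u)) : Fin (r + 3) → ℕ) i := by
      intro i
      refine Fin.cases ?_ (fun i => Fin.cases ?_ (fun i => Fin.cases ?_ (fun i => ?_) i) i) i <;>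
      simp [ρ, he, -Fin.succ_zero_eq_one, -Fin.succ_zero_eq_one', -Fin.succ_one_eq_two]
    obtain ⟨j, rfl⟩ := (Finite.injective_iff_surjective.mp hρ) i
    rw [Finsupp.mapDomain_apply hρ, key]
    rfl
  let ψ : Fin (r + 2) → MvPolynomial (Fin (r + 3)) R :=
    Fin.cons (X 0 + X 1) (fun j => X j.succ.succ)
  have t3 : aeval (fun j : Fin (r + 2) =>
          if (j : ℕ) + 1 < 2 then (X j.castSucc : MvPolynomial (Fin (r + 3)) R)
          else if (j : ℕ) + 1 = 2 then X j.castSucc + X j.succ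
          else X j.succ) g = rename ρ (aeval ψ g) := by
    conv_lhs => rw [← hg (Equiv.swap 0 1)]
    rw [aeval_rename, ← AlgHom.comp_apply, comp_aeval]
    congr 2
    funext i
    refine Fin.cases ?_ (fun i => Fin.cases ?_ (fun i => ?_) i) i
    · simp [ψ, ρ]
    · simp [ψ, ρ]
      rfl
    · have : (Equiv.swap (0 : Fin (r + 2)) 1) i.succ.succ = i.succ.succ :=
        Equiv.swap_apply_of_ne_of_ne (by simp [Fin.ext_iff]) (by simp [Fin.ext_iff])
      simp [ψ, ρ, this]
  rw [← he, hmap, t3, coeff_rename_mapDomain ρ hρ,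
    coeff_first (r + 1) g b y (Fin.cons a u) ψ (by simp [ψ]) (by intro j; simp [ψ])] at hc
  linear_combination -hc

theorem supp_step (p : ℕ) [Fact p.Prime] (r : ℕ) (g : MvPolynomial (Fin (r + 2)) (ZMod p))
    (hg : g.IsSymmetric) (hd : delta (ZMod p) 2 (r + 2) g = 0) (a b y : ℕ) (ha : a ≠ 0)
    (hy : y ≠ 0) (u : Multiset ℕ) (hu : Multiset.card u = r)
    (c1 : ((a + b).choose a : ZMod p) ≠ 0) (c2 : ((b + y).choose b : ZMod p) ≠ 0) :
    (∃ d : Fin (r + 2) →₀ ℕ, coeff d g ≠ 0 ∧ exMult d = (a + b) ::ₘ y ::ₘ u) ↔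
    (∃ d : Fin (r + 2) →₀ ℕ, coeff d g ≠ 0 ∧ exMult d = a ::ₘ (b + y) ::ₘ u) := by
  obtain ⟨f, rfl⟩ : ∃ f : Fin r → ℕ, multisetOf f = u := by
    subst hu
    induction u using Quotient.inductionOn with
    | h l =>
      refine ⟨fun i => l.get i, ?_⟩
      unfold multisetOf
      rw [Fin.univ_val_map]
      exact congrArg _ (List.ofFn_get l)
  have hex : ∀ x z : ℕ, exMult (Finsupp.equivFunOnFinite.symm
      (Fin.cons x (Fin.cons z f) : Fin (r + 2) → ℕ)) = x ::ₘ z ::ₘ multisetOf f := by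
    intro x z
    simp only [exMult, multisetOf, Fin.univ_val_map, Finsupp.coe_equivFunOnFinite_symm,
      List.ofFn_succ, Fin.cons_zero, Fin.cons_succ, Multiset.cons_coe]
  have hiff : ∀ x z : ℕ, (∃ d : Fin (r + 2) →₀ ℕ, coeff d g ≠ 0 ∧
      exMult d = x ::ₘ z ::ₘ multisetOf f) ↔ coeff (Finsupp.equivFunOnFinite.symm
      (Fin.cons x (Fin.cons z f) : Fin (r + 2) → ℕ)) g ≠ 0 := by
    intro x z
    constructor
    · rintro ⟨d, h1, h2⟩
      rwa [← coeff_perm g hg d _ (h2.trans (hex x z).symm)]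
    · intro h
      exact ⟨_, h, hex x z⟩
  rw [Multiset.cons_swap a, hiff, hiff]
  have := cocycle_rel r g hg hd a b y ha hy f
  constructor
  · intro h h0
    rw [h0, mul_zero] at this
    exact (mul_ne_zero c1 h) this
  · intro h h0
    rw [h0, mul_zero] at this
    exact (mul_ne_zero c2 h) this.symm

/-- Under the hypotheses of Statement 9, any nonzero symmetric
homogeneous `2`-cocycle over `ℤ/pℤ` with exponent-multiset support contained in
`T^m(λ)` has support equal to all of `T^m(λ)`. -/
theorem statement10 (p : ℕ) (hp : p.Prime) (n k m : ℕ)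
    (lam : Multiset ℕ) (hpow : IsPowOf p lam) (hcard : Multiset.card lam = k)
    (hsum : lam.sum = n) (hm : m + 2 ≤ k)
    (hcond : m ≤ p - 2 ∨ k = sigmaDigits p n)
    (g : MvPolynomial (Fin (k - m)) (ZMod p)) (hg0 : g ≠ 0)
    (hgsym : g.IsSymmetric) (hgh : g.IsHomogeneous n)
    (hgcoc : delta (ZMod p) 2 (k - m) g = 0)
    (hsupp : {μ : Multiset ℕ | ∃ d : Fin (k - m) →₀ ℕ,
        MvPolynomial.coeff d g ≠ 0 ∧ exMult d = μ} ⊆ gatherSet m lam) :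
    {μ : Multiset ℕ | ∃ d : Fin (k - m) →₀ ℕ,
        MvPolynomial.coeff d g ≠ 0 ∧ exMult d = μ} = gatherSet m lam := by
  have : Fact p.Prime := ⟨hp⟩
  obtain ⟨r, hr⟩ : ∃ r, k - m = r + 2 := ⟨k - m - 2, by omega⟩
  have hkr : k = r + 2 + m := by omega
  generalize k - m = K at *
  subst hr
  refine Set.Subset.antisymm hsupp ?_
  have hpos : ∀ x ∈ lam, 0 < x := by
    intro x hx
    obtain ⟨a, rfl⟩ := hpow x hx
    exact pow_pos hp.pos a
  have hcard' : ∀ (j : ℕ) (t : Multiset ℕ), t ∈ gatherSet j lam → Multiset.card t + j = k := by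
    intro j
    induction j with
    | zero =>
      rintro t rfl
      exact hcard
    | succ j ih =>
      rintro t ⟨u, hu, a, b, w, rfl, rfl⟩
      have := ih _ hu
      simp only [Multiset.card_cons] at this ⊢
      omega
  have hval : ∀ t ∈ gatherSet m lam, ∃ P, Valid lam r P ∧ P.map Multiset.sum = t := by
    intro t ht
    obtain ⟨P, h1, h2, h3⟩ := gather_valid lam hpos m t ht
    refine ⟨P, ⟨h1, h2, ?_⟩, h3⟩
    have := hcard' m t ht
    rw [← h3, Multiset.card_map] at this
    omega
  have hncb := valid_ncb p lam hpow r m (by omega) (by rw [hcard, hsum]; exact hcond)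
  obtain ⟨d, hd⟩ := MvPolynomial.ne_zero_iff.mp hg0
  obtain ⟨P, hP, hP'⟩ := hval _ (hsupp ⟨d, hd, rfl⟩)
  intro t ht
  obtain ⟨P', hv, rfl⟩ := hval t ht
  refine all_conn lam r (fun μ => ∃ d : Fin (r + 2) →₀ ℕ,
        MvPolynomial.coeff d g ≠ 0 ∧ exMult d = μ) ?_ P P' hP hv ⟨d, hd, hP'.symm⟩
  intro A B Y Q hA hB hY hV
  have hsum0 : ∀ C : Multiset ℕ, C ≤ lam → C ≠ 0 → C.sum ≠ 0 := by
    intro C hC h0 hs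
    obtain ⟨x, hx⟩ := Multiset.exists_mem_of_ne_zero h0
    have := Multiset.sum_eq_zero_iff.mp hs x hx
    have := hpos x (Multiset.mem_of_le hC hx)
    omega
  have hV' : Valid lam r ((B + Y) ::ₘ A ::ₘ Q) := by
    refine ⟨?_, ?_, ?_⟩
    · rw [← hV.1]; simp only [Multiset.sum_cons]; abel
    · intro C hC
      rcases Multiset.mem_cons.mp hC with rfl | hC
      · simp [hB]
      rcases Multiset.mem_cons.mp hC with rfl | hC
      · exact hA
      · exact hV.2.1 C (by simp only [Multiset.mem_cons]; tauto)
    · simpa using hV.2.2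
  have hle : A + B + (Y + Q.sum) = lam := by
    have := hV.1
    rwa [Multiset.sum_cons, Multiset.sum_cons] at this
  have c := hV.2.2
  simp only [Multiset.card_cons] at c
  simp only [Multiset.map_cons, Multiset.sum_add]
  refine supp_step p r g hgsym hgcoc _ _ _ (hsum0 A ?_ hA) (hsum0 Y ?_ hY) _ (by simp; omega)
    (hncb _ _ hV A B rfl) (hncb _ _ hV' B Y rfl)
  · rw [← hle, add_assoc]; exact Multiset.le_add_right _ _
  · rw [← hle, add_comm, add_assoc]; exact Multiset.le_add_right _ _
end

section
/- Let p be a prime, let λ be a power-of-p multiset of cardinality k with sum n, and let 0 ≤ m ≤ k − 2 satisfy either m ≤ p − 2 or k = σ_p(n). Then for every μ ∈ T^m(λ), the annihilating set of μ equals T^m(λ): ann_p(μ) = T^m(λ). -/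
open MvPolynomial

section helpers

lemma sum_mapmul (p : ℕ) (S : Multiset ℕ) : (S.map (p * ·)).sum = p * S.sum := by
  simpa using Multiset.sum_map_mul_left (s := S) (a := p) (f := fun x => x)

lemma sg_zero (p : ℕ) : sigmaDigits p 0 = 0 := by simp [sigmaDigits]

lemma sg_pow (p : ℕ) (hp : p.Prime) (a : ℕ) : sigmaDigits p (p ^ a) = 1 := by
  have := Nat.digits_base_pow_mul (b := p) (k := a) (m := 1) hp.one_lt one_pos
  rw [mul_one] at this
  simp [sigmaDigits, this, Nat.digits_of_lt p 1 one_ne_zero hp.one_lt]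

lemma sg_pos (p : ℕ) (x : ℕ) (hx : 0 < x) : 0 < sigmaDigits p x := by
  rw [Nat.pos_iff_ne_zero]
  intro h
  unfold sigmaDigits at h
  have h2 := List.sum_eq_zero_iff.mp h
  have h3 := Nat.getLast_digit_ne_zero p hx.ne'
  exact h3 (h2 _ (List.getLast_mem _))

lemma sg_rec (p : ℕ) (hp : p.Prime) (c x : ℕ) (hc : c < p) :
    sigmaDigits p (c + p * x) = c + sigmaDigits p x := by
  by_cases h : c = 0 ∧ x = 0
  · obtain ⟨rfl, rfl⟩ := h
    simp [sigmaDigits]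
  · unfold sigmaDigits
    rw [Nat.digits_add p hp.one_lt c x hc (by omega)]
    simp

lemma sg_add_le (p : ℕ) (hp : p.Prime) (a b : ℕ) :
    sigmaDigits p (a + b) ≤ sigmaDigits p a + sigmaDigits p b := by
  have : Fact p.Prime := ⟨hp⟩
  have h1 := sub_one_mul_padicValNat_factorial (p := p) a
  have h2 := sub_one_mul_padicValNat_factorial (p := p) b
  have h3 := sub_one_mul_padicValNat_factorial (p := p) (a + b)
  have g1 := Nat.digit_sum_le p a
  have g2 := Nat.digit_sum_le p b
  have g3 := Nat.digit_sum_le p (a + b)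
  have h4 : padicValNat p a.factorial + padicValNat p b.factorial
      ≤ padicValNat p (a + b).factorial := by
    rw [← padicValNat.mul (Nat.factorial_ne_zero a) (Nat.factorial_ne_zero b)]
    exact padicValNat_dvd_iff_le (Nat.factorial_ne_zero _) |>.mp
      (pow_padicValNat_dvd.trans (Nat.factorial_mul_factorial_dvd_factorial_add a b))
  have h5 := Nat.mul_le_mul_left (p - 1) h4
  rw [Nat.mul_add, h1, h2, h3] at h5
  unfold sigmaDigits
  omega

lemma sg_sum_le (p : ℕ) (hp : p.Prime) (S : Multiset ℕ) (h : IsPowOf p S) :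
    sigmaDigits p S.sum ≤ Multiset.card S := by
  induction S using Multiset.induction with
  | empty => simp [sg_zero]
  | cons a S ih =>
    obtain ⟨e, rfl⟩ := h a (by simp)
    have := ih (fun x hx => h x (by simp [hx]))
    have h2 := sg_add_le p hp (p ^ e) S.sum
    rw [sg_pow p hp] at h2
    simp only [Multiset.sum_cons, Multiset.card_cons]
    omega

lemma powof_pos (p : ℕ) (hp : p.Prime) (S : Multiset ℕ) (h : IsPowOf p S) (x : ℕ) (hx : x ∈ S) :
    0 < x := by
  obtain ⟨e, rfl⟩ := h x hx
  exact pow_pos hp.pos e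

lemma powof_sum_pos (p : ℕ) (hp : p.Prime) (S : Multiset ℕ) (h : IsPowOf p S) (h0 : S ≠ 0) :
    0 < S.sum := by
  obtain ⟨a, ha⟩ := Multiset.exists_mem_of_ne_zero h0
  exact (powof_pos p hp S h a ha).trans_le (Multiset.le_sum_of_mem ha)

lemma powof_mono (p : ℕ) {S T : Multiset ℕ} (h : IsPowOf p T) (hle : S ≤ T) : IsPowOf p S :=
  fun x hx => h x (Multiset.mem_of_le hle hx)

lemma powof_struct (p : ℕ) (S : Multiset ℕ) (h : IsPowOf p S) :
    ∃ c S', IsPowOf p S' ∧ S = Multiset.replicate c 1 + S'.map (p * ·) := by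
  induction S using Multiset.induction with
  | empty => exact ⟨0, 0, by intro x hx; simp at hx, by simp⟩
  | cons a S ih =>
    obtain ⟨c, S', h1, rfl⟩ := ih (fun x hx => h x (Multiset.mem_cons_of_mem hx))
    obtain ⟨e, rfl⟩ := h a (by simp)
    cases e with
    | zero => exact ⟨c + 1, S', h1, by simp [Multiset.replicate_succ]⟩
    | succ e =>
      refine ⟨c, p ^ e ::ₘ S', ?_, ?_⟩
      · intro x hx
        rcases Multiset.mem_cons.mp hx with rfl | hx
        · exact ⟨e, rfl⟩
        · exact h1 x hx
      · simp [pow_succ, mul_comm]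

lemma struct_props (p : ℕ) (hp : p.Prime) (c : ℕ) (S' : Multiset ℕ) (h : IsPowOf p S')
    (x : ℕ) (hx : (Multiset.replicate c 1 + S'.map (p * ·)).sum = x)
    (hc : Multiset.card (Multiset.replicate c 1 + S'.map (p * ·)) = sigmaDigits p x) :
    c = x % p ∧ S'.sum = x / p ∧ Multiset.card S' = sigmaDigits p S'.sum := by
  simp only [Multiset.sum_add, Multiset.sum_replicate, smul_eq_mul, mul_one,
    sum_mapmul, Multiset.card_add, Multiset.card_replicate,
    Multiset.card_map] at hx hc
  have hcp : c < p := by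
    by_contra hcp
    push Not at hcp
    obtain ⟨d, rfl⟩ := Nat.exists_eq_add_of_le hcp
    have h1 := sg_sum_le p hp (Multiset.replicate d 1 + ((1 ::ₘ S').map (p * ·))) (by
      intro y hy
      rcases Multiset.mem_add.mp hy with hy | hy
      · exact ⟨0, by simpa using Multiset.eq_of_mem_replicate hy⟩
      · obtain ⟨z, hz, rfl⟩ := Multiset.mem_map.mp hy
        rcases Multiset.mem_cons.mp hz with rfl | hz
        · exact ⟨1, by simp⟩
        · obtain ⟨e, rfl⟩ := h z hz
          exact ⟨e + 1, by rw [pow_succ, mul_comm]⟩)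
    have h2 : (Multiset.replicate d 1 + ((1 ::ₘ S').map (p * ·))).sum = x := by
      rw [← hx]
      simp only [Multiset.map_cons, Multiset.sum_add, Multiset.sum_replicate, smul_eq_mul, mul_one,
        Multiset.sum_cons, sum_mapmul]
      ring
    rw [h2, ← hc] at h1
    simp at h1
    have := hp.two_le
    omega
  have h1 := sg_rec p hp c S'.sum hcp
  rw [hx] at h1
  refine ⟨?_, ?_, by omega⟩
  · rw [← hx, Nat.add_mul_mod_self_left, Nat.mod_eq_of_lt hcp]
  · rw [← hx, Nat.add_mul_div_left _ _ hp.pos, Nat.div_eq_of_lt hcp, zero_add]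

lemma powof_unique (p : ℕ) (hp : p.Prime) (x : ℕ) : ∀ (S T : Multiset ℕ), IsPowOf p S →
    IsPowOf p T → S.sum = x → T.sum = x → Multiset.card S = sigmaDigits p x →
    Multiset.card T = sigmaDigits p x → S = T := by
  induction x using Nat.strong_induction_on with
  | _ x ih =>
    intro S T hS hT hs ht cs ct
    by_cases hx : x = 0
    · subst hx
      rw [sg_zero, Multiset.card_eq_zero] at cs ct
      rw [cs, ct]
    · obtain ⟨c, S', hS', rfl⟩ := powof_struct p S hS
      obtain ⟨d, T', hT', rfl⟩ := powof_struct p T hT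
      obtain ⟨a1, a2, a3⟩ := struct_props p hp c S' hS' x hs cs
      obtain ⟨b1, b2, b3⟩ := struct_props p hp d T' hT' x ht ct
      rw [ih (x / p) (Nat.div_lt_self (Nat.pos_of_ne_zero hx) hp.one_lt) S' T' hS' hT' a2 b2
        (by rw [a3, a2]) (by rw [b3, b2]), a1, b1]

lemma powof_exists (p : ℕ) (hp : p.Prime) (x : ℕ) : ∃ S : Multiset ℕ, IsPowOf p S ∧
    S.sum = x ∧ Multiset.card S = sigmaDigits p x := by
  induction x using Nat.strong_induction_on with
  | _ x ih =>
    by_cases hx : x = 0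
    · subst hx
      exact ⟨0, by intro x hx; simp at hx, by simp, by simp [sg_zero]⟩
    · obtain ⟨S, h1, h2, h3⟩ := ih (x / p) (Nat.div_lt_self (Nat.pos_of_ne_zero hx) hp.one_lt)
      have hm : x % p + p * (x / p) = x := Nat.mod_add_div x p
      refine ⟨Multiset.replicate (x % p) 1 + S.map (p * ·), ?_, ?_, ?_⟩
      · intro y hy
        rcases Multiset.mem_add.mp hy with hy | hy
        · exact ⟨0, by simpa using Multiset.eq_of_mem_replicate hy⟩
        · obtain ⟨z, hz, rfl⟩ := Multiset.mem_map.mp hy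
          obtain ⟨e, rfl⟩ := h1 z hz
          exact ⟨e + 1, by rw [pow_succ, mul_comm]⟩
      · simp only [Multiset.sum_add, Multiset.sum_replicate, smul_eq_mul, mul_one,
          sum_mapmul, h2]
        exact hm
      · have := sg_rec p hp (x % p) (x / p) (Nat.mod_lt _ hp.pos)
        rw [hm] at this
        simp [h3, this]

lemma powof_split (p : ℕ) (hp : p.Prime) (X : Multiset ℕ) (hX : IsPowOf p X)
    (hc : sigmaDigits p X.sum = Multiset.card X) (a b : ℕ) (hab : a + b = X.sum)
    (hs : sigmaDigits p a + sigmaDigits p b = sigmaDigits p X.sum) :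
    ∃ A B : Multiset ℕ, X = A + B ∧ A.sum = a ∧ B.sum = b := by
  obtain ⟨A, h1, h2, h3⟩ := powof_exists p hp a
  obtain ⟨B, g1, g2, g3⟩ := powof_exists p hp b
  refine ⟨A, B, ?_, h2, g2⟩
  refine powof_unique p hp X.sum _ _ hX ?_ rfl ?_ hc.symm ?_
  · intro x hx
    rcases Multiset.mem_add.mp hx with hx | hx
    · exact h1 x hx
    · exact g1 x hx
  · simp [h2, g2, hab]
  · simp [h3, g3, hs]

lemma good_of_cond (p : ℕ) (hp : p.Prime) (m : ℕ) (lam : Multiset ℕ) (hpow : IsPowOf p lam)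
    (hcond : m ≤ p - 2 ∨ Multiset.card lam = sigmaDigits p lam.sum)
    (X : Multiset ℕ) (hX : X ≤ lam) (h0 : X ≠ 0) (hc : Multiset.card X ≤ m + 1) :
    sigmaDigits p X.sum = Multiset.card X := by
  have hXp := powof_mono p hpow hX
  have hle := sg_sum_le p hp X hXp
  rcases hcond with h | h
  · have hpos := sg_pos p _ (powof_sum_pos p hp X hXp h0)
    have h2 := hp.two_le
    by_cases hp2 : p = 2
    · subst hp2; omega
    · have hmod : p % (p - 1) = 1 := by
        obtain ⟨q, rfl⟩ := Nat.exists_eq_add_of_le h2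
        rw [show 2 + q - 1 = q + 1 by omega, show 2 + q = 1 + (q + 1) by ring, Nat.add_mod_right]
        exact Nat.mod_eq_of_lt (by omega)
      have e1 : X.sum ≡ sigmaDigits p X.sum [MOD (p - 1)] := Nat.modEq_digits_sum (p - 1) p hmod _
      have e2 : X.sum ≡ Multiset.card X [MOD (p - 1)] := by
        clear hle hpos e1 hc h0 hX
        induction X using Multiset.induction with
        | empty => exact rfl
        | cons a S ih =>
          obtain ⟨e, rfl⟩ := hXp a (by simp)
          rw [Multiset.sum_cons, Multiset.card_cons, add_comm]
          refine Nat.ModEq.add (ih (fun x hx => hXp x (Multiset.mem_cons_of_mem hx))) ?_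
          have : p ≡ 1 [MOD (p - 1)] := by
            unfold Nat.ModEq
            rw [hmod, Nat.mod_eq_of_lt (by omega)]
          simpa using this.pow e
      have e3 := e1.symm.trans e2
      have e4 := (Nat.modEq_iff_dvd' hle).mp e3
      have := Nat.eq_zero_of_dvd_of_lt e4 (by omega)
      omega
  · obtain ⟨Y, rfl⟩ := Multiset.le_iff_exists_add.mp hX
    have h1 := sg_sum_le p hp Y (powof_mono p hpow (Multiset.le_add_left _ _))
    have h2 := sg_add_le p hp X.sum Y.sum
    rw [Multiset.card_add, Multiset.sum_add] at h
    omega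

/-- Valid block decompositions. -/
def VP (lam : Multiset ℕ) (m : ℕ) (P : Multiset (Multiset ℕ)) : Prop :=
  P.sum = lam ∧ (∀ A ∈ P, A ≠ 0) ∧ Multiset.card P + m = Multiset.card lam

lemma card_le_sum_card (P : Multiset (Multiset ℕ)) (h : ∀ A ∈ P, A ≠ 0) :
    Multiset.card P ≤ Multiset.card P.sum := by
  induction P using Multiset.induction with
  | empty => simp
  | cons A P ih =>
    have h1 := ih (fun B hB => h B (Multiset.mem_cons_of_mem hB))
    have h2 := Multiset.card_pos.mpr (h A (by simp))
    simp only [Multiset.card_cons, Multiset.sum_cons, Multiset.card_add]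
    omega

lemma vp_gather (lam : Multiset ℕ) (m : ℕ) : ∀ P, VP lam m P →
    P.map Multiset.sum ∈ gatherSet m lam := by
  induction m with
  | zero =>
    rintro P ⟨rfl, h2, h3⟩
    show _ = _
    induction P using Multiset.induction with
    | empty => simp
    | cons A P ih =>
      have h4 := fun B hB => h2 B (Multiset.mem_cons_of_mem hB)
      have h1 := card_le_sum_card P h4
      have h5 := Multiset.card_pos.mpr (h2 A (by simp))
      simp only [Multiset.card_cons, Multiset.sum_cons, Multiset.card_add] at h3
      obtain ⟨a, rfl⟩ := Multiset.card_eq_one.mp (show Multiset.card A = 1 by omega)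
      rw [Multiset.map_cons, Multiset.sum_cons, ih h4 (by omega)]
      simp
  | succ m ih =>
    rintro P ⟨h1, h2, h3⟩
    have : ∃ A ∈ P, 2 ≤ Multiset.card A := by
      by_contra hcon
      push Not at hcon
      have : Multiset.card P.sum ≤ Multiset.card P := by
        clear h1 h2 h3
        induction P using Multiset.induction with
        | empty => simp
        | cons A P ih =>
          have h1 := ih (fun B hB => hcon B (Multiset.mem_cons_of_mem hB))
          have h2 := hcon A (by simp)
          simp only [Multiset.card_cons, Multiset.sum_cons, Multiset.card_add]
          omega
      rw [h1] at this
      omega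
    obtain ⟨A, hA, hA2⟩ := this
    obtain ⟨U, rfl⟩ := Multiset.exists_cons_of_mem hA
    obtain ⟨a, ha⟩ := Multiset.exists_mem_of_ne_zero (h2 A hA)
    obtain ⟨A', rfl⟩ := Multiset.exists_cons_of_mem ha
    refine ⟨_, ih ({a} ::ₘ A' ::ₘ U) ⟨?_, ?_, ?_⟩, a, A'.sum, U.map Multiset.sum, ?_, ?_⟩
    · rw [← h1]; simp [← add_assoc]
    · intro B hB
      simp only [Multiset.mem_cons] at hB
      rcases hB with rfl | rfl | hB
      · simp
      · rintro rfl; simp at hA2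
      · exact h2 B (Multiset.mem_cons_of_mem hB)
    · simp at h3 ⊢; omega
    · simp
    · simp

lemma map_eq_cons' {α β : Type*} {f : α → β} {P : Multiset α} {b : β} {t : Multiset β}
    (h : P.map f = b ::ₘ t) : ∃ a U, P = a ::ₘ U ∧ f a = b ∧ U.map f = t := by
  obtain ⟨a, ha, rfl⟩ := Multiset.mem_map.mp (show b ∈ P.map f by rw [h]; simp)
  obtain ⟨U, rfl⟩ := Multiset.exists_cons_of_mem ha
  rw [Multiset.map_cons, Multiset.cons_inj_right] at h
  exact ⟨a, U, rfl, rfl, h⟩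

lemma gather_vp (lam : Multiset ℕ) (m : ℕ) : ∀ μ ∈ gatherSet m lam,
    ∃ P, VP lam m P ∧ P.map Multiset.sum = μ := by
  induction m with
  | zero =>
    rintro μ rfl
    refine ⟨μ.map (fun x => {x}), ⟨?_, ?_, ?_⟩, ?_⟩
    · exact Multiset.sum_map_singleton μ
    · intro A hA
      obtain ⟨x, -, rfl⟩ := Multiset.mem_map.mp hA
      simp
    · simp
    · simp [Multiset.map_map]
  | succ m ih =>
    rintro μ ⟨u, hu, a, b, v, rfl, rfl⟩
    obtain ⟨P, ⟨h1, h2, h3⟩, h4⟩ := ih _ hu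
    obtain ⟨A, P, rfl, rfl, h5⟩ := map_eq_cons' h4
    obtain ⟨B, P, rfl, rfl, rfl⟩ := map_eq_cons' h5
    refine ⟨(A + B) ::ₘ P, ⟨?_, ?_, ?_⟩, by simp⟩
    · rw [← h1]; simp [add_assoc]
    · intro C hC
      rcases Multiset.mem_cons.mp hC with rfl | hC
      · have := h2 A (by simp)
        simp [this]
      · exact h2 C (by simp [hC])
    · simp at h3 ⊢; omega

/-- Moves of blocks. -/
def BStep (P Q : Multiset (Multiset ℕ)) : Prop :=
  ∃ A B Y U, A ≠ 0 ∧ B ≠ 0 ∧ Y ≠ 0 ∧ P = (A + B) ::ₘ Y ::ₘ U ∧ Q = A ::ₘ (B + Y) ::ₘ U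

lemma bstep_symm {P Q} (h : BStep P Q) : BStep Q P := by
  obtain ⟨A, B, Y, U, hA, hB, hY, rfl, rfl⟩ := h
  refine ⟨Y, B, A, U, hY, hB, hA, ?_, ?_⟩
  · rw [Multiset.cons_swap, add_comm]
  · rw [Multiset.cons_swap, add_comm]

abbrev BR := Relation.ReflTransGen BStep

lemma br_symm {P Q} (h : BR P Q) : BR Q P := by
  induction h with
  | refl => exact .refl
  | tail _ h ih => exact Relation.ReflTransGen.head (bstep_symm h) ih

lemma br_cons (C : Multiset ℕ) {P Q} (h : BR P Q) : BR (C ::ₘ P) (C ::ₘ Q) := by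
  induction h with
  | refl => exact .refl
  | tail _ h ih =>
    refine ih.tail ?_
    obtain ⟨A, B, Y, U, hA, hB, hY, rfl, rfl⟩ := h
    refine ⟨A, B, Y, C ::ₘ U, hA, hB, hY, ?_, ?_⟩
    · rw [Multiset.cons_swap, Multiset.cons_swap C Y]
    · rw [Multiset.cons_swap, Multiset.cons_swap C (B + Y)]

/-- Normal form. -/
def NF (B S : Multiset ℕ) : Multiset (Multiset ℕ) := B ::ₘ S.map (fun x => {x})

lemma to_nf (T : Multiset (Multiset ℕ)) (hT : ∀ A ∈ T, A ≠ 0) (B : Multiset ℕ) (hB : B ≠ 0) :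
    ∃ B' S, B' ≠ 0 ∧ B' + S = B + T.sum ∧ Multiset.card S = Multiset.card T ∧
      BR (B ::ₘ T) (NF B' S) := by
  induction T using Multiset.induction with
  | empty => exact ⟨B, 0, hB, by simp, by simp, .refl⟩
  | cons C T ih =>
    obtain ⟨B', S, h1, h2, h3, h4⟩ := ih (fun A hA => hT A (Multiset.mem_cons_of_mem hA))
    have h5 := br_cons C h4
    rw [Multiset.cons_swap] at h5
    obtain ⟨c, hc⟩ := Multiset.exists_mem_of_ne_zero (hT C (by simp))
    obtain ⟨C', rfl⟩ := Multiset.exists_cons_of_mem hc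
    refine ⟨C' + B', c ::ₘ S, by simp [h1], ?_, by simp [h3], ?_⟩
    · rw [Multiset.sum_cons, ← Multiset.singleton_add, ← Multiset.singleton_add c C']
      calc C' + B' + ({c} + S) = {c} + C' + (B' + S) := by abel
        _ = _ := by rw [h2]; abel
    · by_cases h0 : C' = 0
      · subst h0
        rw [zero_add]
        unfold NF at h5 ⊢
        rw [Multiset.map_cons, Multiset.cons_swap B']
        exact h5
      · refine h5.tail ⟨{c}, C', B', S.map (fun x => {x}), by simp, h0, h1, ?_, ?_⟩
        · rw [NF, Multiset.singleton_add]
        · rw [NF, Multiset.map_cons, Multiset.cons_swap]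

lemma nf_swap (b t : ℕ) (B S : Multiset ℕ) (hB : B ≠ 0) :
    BR (NF (b ::ₘ B) (t ::ₘ S)) (NF (t ::ₘ B) (b ::ₘ S)) := by
  refine Relation.ReflTransGen.tail (b := B ::ₘ ({b} + {t}) ::ₘ S.map (fun x => {x}))
    (Relation.ReflTransGen.single ?_) ?_
  · refine ⟨B, {b}, {t}, S.map (fun x => {x}), hB, by simp, by simp, ?_, rfl⟩
    rw [NF, Multiset.map_cons, add_comm, Multiset.singleton_add]
  · refine ⟨{b}, {t}, B, S.map (fun x => {x}), by simp, by simp, hB, ?_, ?_⟩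
    · rw [Multiset.cons_swap]
    · rw [NF, Multiset.map_cons, Multiset.cons_swap, Multiset.singleton_add]

lemma nf_conn (S : Multiset ℕ) : ∀ (B B' S' : Multiset ℕ), B ≠ 0 → B' ≠ 0 → B + S = B' + S' →
    Multiset.card S = Multiset.card S' → BR (NF B S) (NF B' S') := by
  induction S using Multiset.induction with
  | empty =>
    intro B B' S' h1 h2 h3 h4
    have : S' = 0 := Multiset.card_eq_zero.mp (by simpa using h4.symm)
    subst this
    simp only [add_zero] at h3
    subst h3
    exact .refl
  | cons s S ih =>
    have key : ∀ (B B' S' : Multiset ℕ), B ≠ 0 → B' ≠ 0 → B + s ::ₘ S = B' + s ::ₘ S' →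
        Multiset.card S = Multiset.card S' → BR (NF B (s ::ₘ S)) (NF B' (s ::ₘ S')) := by
      intro B B' S' h1 h2 h3 h4
      rw [Multiset.add_cons, Multiset.add_cons, Multiset.cons_inj_right] at h3
      have := br_cons {s} (ih B B' S' h1 h2 h3 h4)
      unfold NF at this ⊢
      rw [Multiset.map_cons, Multiset.map_cons, Multiset.cons_swap, Multiset.cons_swap B']
      exact this
    intro B B' S' h1 h2 h3 h4
    by_cases hs : s ∈ S'
    · obtain ⟨S', rfl⟩ := Multiset.exists_cons_of_mem hs
      exact key B B' S' h1 h2 h3 (by simpa using h4)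
    · have hs' : s ∈ B' := by
        have : s ∈ B' + S' := by rw [← h3]; simp
        rcases Multiset.mem_add.mp this with h | h
        · exact h
        · exact absurd h hs
      obtain ⟨B1, rfl⟩ := Multiset.exists_cons_of_mem hs'
      have hc := congrArg Multiset.card h3
      by_cases h0 : B1 = 0
      · subst h0
        simp at hc h4
        obtain ⟨b, rfl⟩ := Multiset.card_eq_one.mp (show Multiset.card B = 1 by omega)
        have : NF {b} (s ::ₘ S) = NF (s ::ₘ 0) S' := by
          have := congrArg (Multiset.map (fun x => ({x} : Multiset ℕ))) h3
          simp only [Multiset.singleton_add, Multiset.cons_add, zero_add, Multiset.map_cons] at this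
          simpa only [NF, Multiset.map_cons, Multiset.cons_zero] using this
        rw [this]
      · obtain ⟨t, ht⟩ := Multiset.card_pos_iff_exists_mem.mp
          (show 0 < Multiset.card S' by rw [← h4]; simp)
        obtain ⟨S', rfl⟩ := Multiset.exists_cons_of_mem ht
        refine (key B (t ::ₘ B1) S' h1 (by simp) ?_ (by simpa using h4)).trans
          (nf_swap t s B1 S' h0)
        rw [h3]
        simp only [← Multiset.singleton_add]
        abel

lemma vp_conn (lam : Multiset ℕ) (m : ℕ) (hm : m + 2 ≤ Multiset.card lam)
    (P Q : Multiset (Multiset ℕ)) (hP : VP lam m P) (hQ : VP lam m Q) : BR P Q := by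
  have main : ∀ P, VP lam m P → ∃ B S, B ≠ 0 ∧ B + S = lam ∧
      Multiset.card S + 1 + m = Multiset.card lam ∧ BR P (NF B S) := by
    rintro P ⟨h1, h2, h3⟩
    obtain ⟨A, hA⟩ := Multiset.card_pos_iff_exists_mem.mp (show 0 < Multiset.card P by omega)
    obtain ⟨U, rfl⟩ := Multiset.exists_cons_of_mem hA
    obtain ⟨B, S, g1, g2, g3, g4⟩ := to_nf U (fun C hC => h2 C (Multiset.mem_cons_of_mem hC)) A
      (h2 A hA)
    refine ⟨B, S, g1, ?_, ?_, g4⟩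
    · rw [g2, ← h1, Multiset.sum_cons]
    · rw [g3, ← h3, Multiset.card_cons]
  obtain ⟨B, S, h1, h2, h3, h4⟩ := main P hP
  obtain ⟨B', S', g1, g2, g3, g4⟩ := main Q hQ
  exact (h4.trans (nf_conn S B B' S' h1 g1 (h2.trans g2.symm) (by omega))).trans (br_symm g4)

lemma vp_bstep {lam : Multiset ℕ} {m : ℕ} {P Q} (hP : VP lam m P) (h : BStep P Q) :
    VP lam m Q := by
  obtain ⟨A, B, Y, U, hA, hB, hY, rfl, rfl⟩ := h
  obtain ⟨h1, h2, h3⟩ := hP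
  refine ⟨?_, ?_, ?_⟩
  · rw [← h1]; simp [add_assoc]
  · intro C hC
    simp only [Multiset.mem_cons] at hC
    rcases hC with rfl | rfl | hC
    · exact hA
    · simp [hB]
    · exact h2 C (by simp [hC])
  · simpa using h3

lemma vp_block {lam : Multiset ℕ} {m : ℕ} {X U} (hP : VP lam m (X ::ₘ U)) :
    X ≤ lam ∧ X ≠ 0 ∧ Multiset.card X ≤ m + 1 := by
  obtain ⟨h1, h2, h3⟩ := hP
  have h4 := card_le_sum_card U (fun C hC => h2 C (Multiset.mem_cons_of_mem hC))
  refine ⟨?_, h2 X (by simp), ?_⟩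
  · rw [← h1, Multiset.sum_cons]; exact Multiset.le_add_right _ _
  · rw [← h1] at h3
    simp at h3
    omega

end helpers

/-- Under the hypotheses of Statement 9, for every `μ ∈ T^m(λ)`
the annihilating set of `μ` equals `T^m(λ)`. -/
theorem statement11 (p : ℕ) (hp : p.Prime) (n k m : ℕ)
    (lam : Multiset ℕ) (hpow : IsPowOf p lam) (hcard : Multiset.card lam = k)
    (hsum : lam.sum = n) (hm : m + 2 ≤ k)
    (hcond : m ≤ p - 2 ∨ k = sigmaDigits p n)
    (μ : Multiset ℕ) (hμ : μ ∈ gatherSet m lam) :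
    annSet p μ = gatherSet m lam := by
  subst hcard hsum
  have good := good_of_cond p hp m lam hpow hcond
  obtain ⟨P, hP, rfl⟩ := gather_vp lam m μ hμ
  apply Set.Subset.antisymm
  · intro ν hν
    have hν' : Relation.ReflTransGen (AnnStep p) (P.map Multiset.sum) ν := hν
    clear hν
    have : ∃ Q, VP lam m Q ∧ Q.map Multiset.sum = ν := by
      induction hν' with
      | refl => exact ⟨P, hP, rfl⟩
      | tail _ h ih =>
        obtain ⟨Q, hQ, rfl⟩ := ih
        obtain ⟨x, y, a, b, u, e1, ha, hb, hab, hs, rfl⟩ := h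
        obtain ⟨X, Q, rfl, rfl, h5⟩ := map_eq_cons' e1
        obtain ⟨Y, Q, rfl, rfl, rfl⟩ := map_eq_cons' h5
        obtain ⟨b1, b2, b3⟩ := vp_block hQ
        obtain ⟨A, B, rfl, rfl, rfl⟩ := powof_split p hp X (powof_mono p hpow b1)
          (good X b1 b2 b3) a b hab hs
        refine ⟨A ::ₘ (B + Y) ::ₘ Q, vp_bstep hQ ⟨A, B, Y, Q, ?_, ?_, ?_, rfl, rfl⟩, by simp⟩
        · rintro rfl; simp at ha
        · rintro rfl; simp at hb
        · exact hQ.2.1 Y (by simp)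
    obtain ⟨Q, hQ, rfl⟩ := this
    exact vp_gather lam m Q hQ
  · intro ν hν
    obtain ⟨Q, hQ, rfl⟩ := gather_vp lam m ν hν
    have hc := vp_conn lam m hm P Q hP hQ
    show Relation.ReflTransGen (AnnStep p) _ _
    clear hQ hν hμ
    have : VP lam m Q ∧
        Relation.ReflTransGen (AnnStep p) (P.map Multiset.sum) (Q.map Multiset.sum) := by
      induction hc with
      | refl => exact ⟨hP, .refl⟩
      | tail _ h ih =>
        obtain ⟨hV, hr⟩ := ih
        refine ⟨vp_bstep hV h, hr.tail ?_⟩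
        obtain ⟨A, B, Y, U, hA, hB, hY, rfl, rfl⟩ := h
        obtain ⟨b1, b2, b3⟩ := vp_block hV
        have hpA := powof_mono p hpow ((Multiset.le_add_right A B).trans b1)
        have hpB := powof_mono p hpow ((Multiset.le_add_left B A).trans b1)
        refine ⟨A.sum + B.sum, Y.sum, A.sum, B.sum, U.map Multiset.sum, by simp,
          powof_sum_pos p hp A hpA hA, powof_sum_pos p hp B hpB hB, rfl, ?_, by simp⟩
        have e := good _ b1 b2 b3
        rw [Multiset.card_add] at b3 e
        rw [Multiset.sum_add] at e
        rw [e, good A ((Multiset.le_add_right A B).trans b1) hA (by omega),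
          good B ((Multiset.le_add_left B A).trans b1) hB (by omega)]
    exact this.2
end

section
/- Let p be a prime and let λ be a multiset of positive integers of cardinality k that is not p-carry-minimal. Then for every symmetric polynomial f ∈ Z_p[x_1,…,x_k] with δ_2(f) = 0, the coefficient in f of the monomials with exponent multiset λ is zero; that is, τλ cannot participate in any symmetric 2-cocycle over Z_p. -/
open MvPolynomial

def dg (p r x : ℕ) : ℕ := x / p ^ r % p

lemma dg_zero (p x : ℕ) : dg p 0 x = x % p := by simp [dg]

lemma dg_succ (p r x : ℕ) : dg p (r+1) x = dg p r (x / p) := by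
  simp [dg, pow_succ', Nat.div_div_eq_div_mul]

lemma dg_add {p : ℕ} (hp : 2 ≤ p) (s : ℕ) : ∀ (r x : ℕ), dg p s x + 1 < p →
    dg p r (x + p ^ s) = dg p r x + if r = s then 1 else 0 := by
  induction s with
  | zero =>
    intro r x h
    rw [dg_zero] at h
    have h1 : (x + 1) % p = x % p + 1 := by
      rw [Nat.add_mod, Nat.mod_eq_of_lt (show 1 < p by omega), Nat.mod_eq_of_lt h]
    have h2 : (x + 1) / p = x / p := by
      have e1 := Nat.div_add_mod (x+1) p
      have e2 := Nat.div_add_mod x p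
      have : p * ((x+1)/p) = p * (x/p) := by omega
      exact Nat.eq_of_mul_eq_mul_left (by omega) this
    cases r with
    | zero => simp [dg_zero, h1]
    | succ r => simp [dg_succ, h2]
  | succ s ih =>
    intro r x h
    cases r with
    | zero => simp [dg_zero, pow_succ]
    | succ r =>
      rw [dg_succ, dg_succ] at *
      rw [pow_succ, Nat.add_mul_div_right _ _ (by omega), ih r (x/p) h]
      simp

lemma dg_lt {p : ℕ} (hp : 2 ≤ p) (r x : ℕ) : dg p r x < p := Nat.mod_lt _ (by omega)

lemma dg_pow {p : ℕ} (hp : 2 ≤ p) (r s : ℕ) : dg p r (p^s) = if r = s then 1 else 0 := by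
  have h0 : ∀ t, dg p t 0 = 0 := by intro t; simp [dg]
  have := dg_add hp s r 0 (by rw [h0]; omega)
  simpa [h0] using this

lemma pow_le_of_dg {p r x : ℕ} (h : 1 ≤ dg p r x) : p ^ r ≤ x := by
  by_contra hc
  simp [dg, Nat.div_eq_of_lt (not_le.mp hc)] at h

lemma dg_sub_lt {p : ℕ} (hp : 2 ≤ p) (s y : ℕ) (h : 1 ≤ dg p s (y + p^s)) :
    dg p s y + 1 < p := by
  by_contra hc
  have h1 := dg_lt hp s y
  have h2 : dg p s y + 1 = p := by omega
  unfold dg at h h2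
  rw [Nat.add_div_right _ (by positivity), Nat.add_mod,
    Nat.mod_eq_of_lt (show 1 < p by omega), h2] at h
  simp at h

def sg (p N x : ℕ) : ℕ := ∑ r ∈ Finset.range N, dg p r x

lemma sg_eq {p : ℕ} (hp : 2 ≤ p) (N : ℕ) : ∀ x, x < p ^ N → sigmaDigits p x = sg p N x := by
  induction N with
  | zero => intro x hx; simp at hx; simp [hx, sigmaDigits, sg]
  | succ N ih =>
    intro x hx
    rcases Nat.eq_zero_or_pos x with rfl | hx0
    · simp [sigmaDigits, sg, dg]
    have := ih (x/p) (by rw [Nat.div_lt_iff_lt_mul (by omega)]; simpa [pow_succ] using hx)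
    unfold sigmaDigits sg at *
    rw [Nat.digits_def' (by omega) hx0, List.sum_cons, this, Finset.sum_range_succ', dg_zero]
    simp only [dg_succ]
    omega

lemma sg_add {p : ℕ} (hp : 2 ≤ p) (N s x : ℕ) (hs : s < N) (h : dg p s x + 1 < p) :
    sg p N (x + p^s) = sg p N x + 1 := by
  unfold sg
  rw [Finset.sum_congr rfl (fun r _ => dg_add hp s r x h), Finset.sum_add_distrib]
  simp [hs]

lemma sg_pow_s15 {p : ℕ} (hp : 2 ≤ p) (N s : ℕ) (hs : s < N) : sg p N (p^s) = 1 := by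
  unfold sg
  rw [Finset.sum_congr rfl (fun r _ => dg_pow hp r s)]
  simp [hs]

lemma choose_dg {p : ℕ} (hp : p.Prime) (s : ℕ) : ∀ x, ((x.choose (p^s) : ℕ) : ZMod p) = (dg p s x : ZMod p) := by
  have := Fact.mk hp
  induction s with
  | zero => intro x; simp [dg]
  | succ s ih =>
    intro x
    have h := Choose.choose_modEq_choose_mod_mul_choose_div_nat (p := p) (n := x) (k := p^(s+1))
    rw [← ZMod.natCast_eq_natCast_iff] at h
    rw [h, dg_succ, ← ih]
    simp [pow_succ, Nat.mul_div_cancel _ hp.pos]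

lemma dg_sum {p : ℕ} (hp : 2 ≤ p) {ι : Type*} (A : Finset ι) (r : ℕ) : ∀ (d : ι → ℕ),
    (∀ r, ∑ i ∈ A, dg p r (d i) < p) → dg p r (∑ i ∈ A, d i) = ∑ i ∈ A, dg p r (d i) := by
  induction r with
  | zero =>
    intro d h
    have := h 0
    simp only [dg_zero] at *
    rw [Finset.sum_nat_mod, Nat.mod_eq_of_lt this]
  | succ r ih =>
    intro d h
    have h0 := h 0
    simp only [dg_zero] at h0
    have e : (∑ i ∈ A, d i) / p = ∑ i ∈ A, d i / p := by
      have : ∑ i ∈ A, d i = ∑ i ∈ A, d i % p + p * ∑ i ∈ A, d i / p := by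
        rw [Finset.mul_sum, ← Finset.sum_add_distrib]
        exact Finset.sum_congr rfl (fun i _ => (Nat.mod_add_div _ _).symm)
      rw [this, Nat.add_mul_div_left _ _ (by omega), Nat.div_eq_of_lt h0, zero_add]
    rw [dg_succ, e, ih]
    · simp [dg_succ]
    · intro r; simpa [dg_succ] using h (r+1)

lemma fact_dvd (s : Multiset ℕ) : (s.map Nat.factorial).prod ∣ s.sum.factorial := by
  induction s using Multiset.induction with
  | empty => simp
  | cons a s ih =>
    simp only [Multiset.map_cons, Multiset.prod_cons, Multiset.sum_cons]
    exact (mul_dvd_mul_left _ ih).trans (Nat.factorial_mul_factorial_dvd_factorial_add a s.sum)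

lemma fact_ne (s : Multiset ℕ) : (s.map Nat.factorial).prod ≠ 0 := by
  simp [Multiset.prod_eq_zero_iff, Nat.factorial_ne_zero]

lemma val_fact {p : ℕ} (hp : p.Prime) (n : ℕ) :
    (p-1) * padicValNat p n.factorial + sigmaDigits p n = n := by
  have := Fact.mk hp
  rw [sub_one_mul_padicValNat_factorial, sigmaDigits]
  have := Nat.digit_sum_le p n
  omega

lemma val_prod {p : ℕ} (hp : p.Prime) (s : Multiset ℕ) :
    (p-1) * padicValNat p (s.map Nat.factorial).prod + (s.map (sigmaDigits p)).sum = s.sum := by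
  have := Fact.mk hp
  induction s using Multiset.induction with
  | empty => simp
  | cons a s ih =>
    simp only [Multiset.map_cons, Multiset.prod_cons, Multiset.sum_cons]
    rw [padicValNat.mul (Nat.factorial_ne_zero _) (fact_ne s), mul_add]
    have := val_fact hp a
    omega

lemma alpha_eq {p : ℕ} (hp : p.Prime) (s : Multiset ℕ) :
    (p-1) * alphaCarry p s + sigmaDigits p s.sum = (s.map (sigmaDigits p)).sum := by
  have := Fact.mk hp
  have h1 := val_fact hp s.sum
  have h2 := val_prod hp s
  obtain ⟨c, hc⟩ := fact_dvd s
  have hc0 : c ≠ 0 := by rintro rfl; simp [Nat.factorial_ne_zero] at hc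
  have : alphaCarry p s = padicValNat p c := by
    unfold alphaCarry
    rw [hc, Nat.mul_div_cancel_left _ (Nat.pos_of_ne_zero (fact_ne s))]
  rw [this]
  rw [hc, padicValNat.mul (fact_ne s) hc0, mul_add] at h1
  omega

structure TokInv (p k N s : ℕ) (g : (Fin k → ℕ) → ZMod p) (d : Fin k → ℕ) : Prop where
  ne : g d ≠ 0
  pos : ∀ i, 0 < d i
  sum : ∑ i, d i < p ^ N
  sg : k + p - 1 ≤ ∑ i, sg p N (d i)
  dg : p ≤ ∑ i, dg p s (d i)

lemma sum_two {k : ℕ} {i j : Fin k} (h : i ≠ j) (F : Fin k → ℕ) :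
    ∑ l, F l = F i + F j + ∑ l ∈ (Finset.univ.erase i).erase j, F l := by
  rw [← Finset.add_sum_erase _ F (Finset.mem_univ i),
    ← Finset.add_sum_erase _ F (show j ∈ Finset.univ.erase i by simp [h.symm]), add_assoc]

lemma move {p k N s : ℕ} (hp : p.Prime) {g : (Fin k → ℕ) → ZMod p}
    (H : ∀ d i j, i ≠ j → ∀ b, 0 < d j → b < d i → ((d i).choose b : ZMod p) * g d =
      ((d j + b).choose b : ZMod p) *
        g (Function.update (Function.update d i (d i - b)) j (d j + b)))
    {d : Fin k → ℕ} (I : TokInv p k N s g d) {i j : Fin k} (hij : i ≠ j) {r : ℕ}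
    (h1 : 1 ≤ dg p r (d i)) (h2 : p ^ r < d i) :
    ∃ d', TokInv p k N s g d' ∧ (∀ l, l ≠ i → l ≠ j → d' l = d l) ∧ d' j = d j + p ^ r ∧
      (∀ r', dg p r' (d' i) + (if r' = r then 1 else 0) = dg p r' (d i)) ∧
      (∀ r', dg p r' (d' j) = dg p r' (d j) + (if r' = r then 1 else 0)) := by
  have hp2 := hp.two_le
  have := Fact.mk hp
  have hH := H d i j hij (p^r) (I.pos j) h2
  set d' := Function.update (Function.update d i (d i - p^r)) j (d j + p^r) with hd'
  have dj : d' j = d j + p^r := by simp [hd']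
  have di : d' i = d i - p^r := by simp [hd', hij]
  have dl : ∀ l, l ≠ i → l ≠ j → d' l = d l := by
    intro l a b; simp [hd', a, b]
  have di' : d i = d' i + p^r := by omega
  have hsub : dg p r (d' i) + 1 < p := dg_sub_lt hp2 r _ (by rw [← di']; exact h1)
  have hne : ((d i).choose (p^r) : ZMod p) * g d ≠ 0 := by
    refine mul_ne_zero ?_ I.ne
    rw [choose_dg hp, Ne, ZMod.natCast_eq_zero_iff]
    intro hdvd
    have := Nat.le_of_dvd h1 hdvd
    have := dg_lt hp2 r (d i)
    omega
  rw [hH] at hne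
  have hg' : g d' ≠ 0 := right_ne_zero_of_mul hne
  have hcj := left_ne_zero_of_mul hne
  have haddj : dg p r (d j) + 1 < p := by
    apply dg_sub_lt hp2
    rw [choose_dg hp] at hcj
    rcases Nat.eq_zero_or_pos (dg p r (d j + p^r)) with h | h
    · rw [h] at hcj; simp at hcj
    · exact h
  have A : ∀ r', dg p r' (d' i) + (if r' = r then 1 else 0) = dg p r' (d i) := by
    intro r'; rw [di', dg_add hp2 r r' _ hsub]
  have B : ∀ r', dg p r' (d' j) = dg p r' (d j) + (if r' = r then 1 else 0) := by
    intro r'; rw [dj, dg_add hp2 r r' _ haddj]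
  have hE : ∀ F : ℕ → ℕ, ∑ l ∈ (Finset.univ.erase i).erase j, F (d' l) =
      ∑ l ∈ (Finset.univ.erase i).erase j, F (d l) := by
    intro F
    refine Finset.sum_congr rfl (fun l hl => ?_)
    simp at hl
    rw [dl l hl.2 hl.1]
  have hsum : ∑ l, d' l = ∑ l, d l := by
    rw [sum_two hij d', sum_two hij d, hE (fun x => x)]; omega
  have hrN : r < N := by
    have : d i ≤ ∑ l, d l := Finset.single_le_sum (fun _ _ => Nat.zero_le _) (Finset.mem_univ i)
    have h3 : p^r < p^N := by have := I.sum; omega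
    exact (Nat.pow_lt_pow_iff_right (by omega)).1 h3
  refine ⟨d', ⟨hg', ?_, ?_, ?_, ?_⟩, dl, dj, A, B⟩
  · intro l
    by_cases a : l = i
    · subst a; omega
    by_cases b : l = j
    · subst b; have := I.pos l; omega
    rw [dl l a b]; exact I.pos l
  · rw [hsum]; exact I.sum
  · have := I.sg
    have e1 := sg_add hp2 N r _ hrN hsub
    have e2 := sg_add hp2 N r _ hrN haddj
    rw [← di'] at e1
    rw [← dj] at e2
    rw [sum_two hij (fun l => sg p N (d l))] at this
    rw [sum_two hij (fun l => sg p N (d' l)), hE (sg p N)]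
    omega
  · have := I.dg
    have e1 := A s
    have e2 := B s
    rw [sum_two hij (fun l => dg p s (d l))] at this
    rw [sum_two hij (fun l => dg p s (d' l)), hE (dg p s)]
    omega

lemma core {p k N s : ℕ} (hp : p.Prime) {g : (Fin k → ℕ) → ZMod p}
    (H : ∀ d i j, i ≠ j → ∀ b, 0 < d j → b < d i → ((d i).choose b : ZMod p) * g d =
      ((d j + b).choose b : ZMod p) *
        g (Function.update (Function.update d i (d i - b)) j (d j + b)))
    (i0 : Fin k) (t : ℕ) : ∀ d : Fin k → ℕ, TokInv p k N s g d → 1 ≤ dg p s (d i0) →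
      dg p s (d i0) + t = p → False := by
  have hp2 := hp.two_le
  induction t with
  | zero => intro d I h1 h2; have := dg_lt hp2 s (d i0); omega
  | succ t ih =>
    intro d I h1 h2
    -- finishing move
    have fin : ∀ d : Fin k → ℕ, TokInv p k N s g d → 1 ≤ dg p s (d i0) →
      dg p s (d i0) + (t + 1) = p → ∀ j, j ≠ i0 → 1 ≤ dg p s (d j) → p ^ s < d j → False := by
      intro d I h1 h2 j hj hj1 hj2
      obtain ⟨d', I', -, -, -, B⟩ := move hp H I hj hj1 hj2
      have := B s
      simp at this
      exact ih d' I' (by omega) (by omega)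
    obtain ⟨j, hj, hj1⟩ : ∃ j, j ≠ i0 ∧ 1 ≤ dg p s (d j) := by
      by_contra hc
      push Not at hc
      have h := I.dg
      rw [← Finset.add_sum_erase _ _ (Finset.mem_univ i0), Finset.sum_eq_zero] at h
      · omega
      · intro l hl
        have := hc l (by simpa using hl)
        omega
    by_cases hj2 : p ^ s < d j
    · exact fin d I h1 h2 j hj hj1 hj2
    have hjle := pow_le_of_dg hj1
    have hjeq : d j = p ^ s := by omega
    have hlt : ∀ l r, 1 ≤ dg p r (d l) → r < N := by
      intro l r h
      have h0 := pow_le_of_dg h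
      have : d l ≤ ∑ l, d l := Finset.single_le_sum (fun _ _ => Nat.zero_le _) (Finset.mem_univ l)
      have h3 : p^r < p^N := by have := I.sum; omega
      exact (Nat.pow_lt_pow_iff_right (by omega)).1 h3
    obtain ⟨l, r, hlj, hl1, hl2, hl3⟩ : ∃ l r, l ≠ j ∧ 1 ≤ dg p r (d l) ∧ p ^ r < d l ∧
        (l = i0 → r ≠ s) := by
      by_contra hc
      push Not at hc
      have key : ∀ l, sg p N (d l) ≤ if l = i0 then p - 1 else 1 := by
        intro l
        by_cases hl : l = i0
        · subst hl
          rw [if_pos rfl]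
          have h0 : ∀ r, r ≠ s → dg p r (d l) = 0 := by
            intro r hr
            by_contra h0
            have h0' : 1 ≤ dg p r (d l) := by omega
            have hle := pow_le_of_dg h0'
            have hlt : p ^ r < d l := by
              rcases hle.lt_or_eq with h | h
              · exact h
              · rw [← h, dg_pow hp2, if_neg (Ne.symm hr)] at h1
                omega
            exact hr (hc l r hj.symm h0' hlt).2
          have : sg p N (d l) = dg p s (d l) := by
            unfold sg
            rw [Finset.sum_eq_single s]
            · intro b _ hb; exact h0 b hb
            · intro hs
              exact absurd (Finset.mem_range.2 (hlt l s h1)) hs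
          omega
        · rw [if_neg hl]
          by_cases hlj : l = j
          · rw [hlj, hjeq, sg_pow_s15 hp2 N s (hlt j s hj1)]
          · by_contra hgt
            obtain ⟨r, hr, hr1⟩ : ∃ r ∈ Finset.range N, dg p r (d l) ≠ 0 := by
              apply Finset.exists_ne_zero_of_sum_ne_zero
              have : sg p N (d l) ≠ 0 := by omega
              exact this
            have hr1' : 1 ≤ dg p r (d l) := by omega
            rcases (pow_le_of_dg hr1').lt_or_eq with h | h
            · exact hl (hc l r hlj hr1' h).1
            · rw [← h, sg_pow_s15 hp2 N r (Finset.mem_range.1 hr)] at hgt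
              omega
      have h := I.sg.trans (Finset.sum_le_sum (fun l _ => key l))
      rw [← Finset.add_sum_erase _ _ (Finset.mem_univ i0)] at h
      rw [Finset.sum_congr rfl (g := fun _ => 1)
        (fun l hl => if_neg (by simpa using hl))] at h
      simp at h
      have := i0.pos
      omega
    obtain ⟨d', I', C, hdj, A, B⟩ := move hp H I hlj hl1 hl2
    have hi0 : dg p s (d' i0) = dg p s (d i0) := by
      by_cases hl : l = i0
      · have := A s
        rw [if_neg (hl3 hl).symm, hl] at this
        omega
      · rw [C i0 (Ne.symm hl) hj.symm]
    have hB := B s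
    refine fin d' I' (by omega) (by omega) j hj (by omega) ?_
    have : 0 < p ^ r := by positivity
    omega

lemma aeval_X_comp {R : Type*} [CommRing R] {ι κ : Type*} (τ : ι → κ) (f : MvPolynomial ι R) :
    aeval (fun j => (X (τ j) : MvPolynomial κ R)) f = rename τ f := by
  have : aeval (fun j => (X (τ j) : MvPolynomial κ R)) = rename τ := by
    ext j; simp
  rw [this]

lemma coeff_split {R : Type*} [CommRing R] {ι κ : Type*} [Fintype ι] [DecidableEq ι]
    [DecidableEq κ] (q : ι) (τ : ι → κ) (hτ : Function.Injective τ) (b : κ)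
    (hb : ∀ i, τ i ≠ b) (hs : ∀ x, x = b ∨ ∃ i, τ i = x) (f : MvPolynomial ι R) (e : κ →₀ ℕ)
    (φ : ι → MvPolynomial κ R) (hφq : φ q = X (τ q) + X b) (hφ : ∀ j, j ≠ q → φ j = X (τ j)) :
    coeff e (aeval φ f) = ((e (τ q) + e b).choose (e b) : R) *
      coeff (Finsupp.equivFunOnFinite.symm (fun i => if i = q then e (τ q) + e b else e (τ i))) f := by
  induction f using MvPolynomial.induction_on' with
  | add f g hf hg => simp only [map_add, coeff_add, hf, hg, mul_add]
  | monomial d c =>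
    have hprod : aeval φ (monomial d c) = ∑ m ∈ Finset.range (d q + 1),
        monomial (Finsupp.mapDomain τ (d.update q m) + Finsupp.single b (d q - m))
          (c * ((d q).choose m : R)) := by
      rw [aeval_monomial, Finsupp.prod_fintype _ _ (by simp),
        ← Finset.mul_prod_erase _ _ (Finset.mem_univ q), hφq, add_pow, Finset.sum_mul,
        Finset.mul_sum]
      refine Finset.sum_congr rfl (fun m _ => ?_)
      have h1 : ∏ x ∈ Finset.univ.erase q, φ x ^ d x
          = ∏ x ∈ Finset.univ.erase q, (X (τ x) : MvPolynomial κ R) ^ (d.update q m) x := by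
        refine Finset.prod_congr rfl (fun x hx => ?_)
        have : x ≠ q := by simpa using hx
        rw [hφ x this]; simp [Finsupp.update, Function.update, this]
      have h2 : rename τ (monomial (d.update q m) (1:R)) = X (τ q) ^ m *
          ∏ x ∈ Finset.univ.erase q, (X (τ x) : MvPolynomial κ R) ^ (d.update q m) x := by
        rw [← aeval_X_comp, aeval_monomial, Finsupp.prod_fintype _ _ (by simp),
          ← Finset.mul_prod_erase _ _ (Finset.mem_univ q)]
        simp
      rw [h1]
      have h3 : (monomial (Finsupp.mapDomain τ (d.update q m) + Finsupp.single b (d q - m))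
          (c * ((d q).choose m : R))) = C c * ((d q).choose m : MvPolynomial κ R) *
            (rename τ (monomial (d.update q m) (1:R)) * X b ^ (d q - m)) := by
        rw [rename_monomial, X_pow_eq_monomial, monomial_mul, ← C_eq_coe_nat, ← C_mul,
          C_mul_monomial]
        simp
      rw [h3, h2, algebraMap_eq]
      ring
    rw [hprod, coeff_sum]
    simp only [coeff_monomial]
    have key : ∀ m, (Finsupp.mapDomain τ (d.update q m) + Finsupp.single b (d q - m) = e) ↔
        (m = e (τ q) ∧ d q - m = e b ∧ ∀ i, i ≠ q → d i = e (τ i)) := by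
      intro m
      have nb : Finsupp.mapDomain τ (d.update q m) b = 0 :=
        Finsupp.mapDomain_of_notMem_range _ _ (by rintro ⟨i, hi⟩; exact hb i hi)
      constructor
      · rintro rfl
        refine ⟨?_, ?_, ?_⟩
        · simp [Finsupp.mapDomain_apply hτ, (hb q).symm]
        · simp [nb]
        · intro i hi
          simp [Finsupp.mapDomain_apply hτ, (hb i).symm, Finsupp.update, hi]
      · rintro ⟨h1, h2, h3⟩
        ext x
        rcases hs x with rfl | ⟨i, rfl⟩
        · simp [nb, h2]
        · by_cases hi : i = q
          · subst hi; simp [Finsupp.mapDomain_apply hτ, (hb _).symm, h1]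
          · simp [Finsupp.mapDomain_apply hτ, (hb _).symm, Finsupp.update, hi, h3 i hi]
    simp only [key]
    by_cases hcond : d = Finsupp.equivFunOnFinite.symm
        (fun i => if i = q then e (τ q) + e b else e (τ i))
    · have hq : d q = e (τ q) + e b := by rw [hcond]; simp
      have hi : ∀ i, i ≠ q → d i = e (τ i) := by intro i hi; rw [hcond]; simp [hi]
      rw [Finset.sum_eq_single (e (τ q)), if_pos ⟨rfl, by omega, hi⟩, if_pos hcond, hq,
        Nat.choose_symm_add, mul_comm]
      · intro m _ hm; rw [if_neg]; tauto
      · intro h; simp at h; omega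
    · rw [if_neg hcond, mul_zero]
      apply Finset.sum_eq_zero
      intro m hm
      rw [if_neg]
      rintro ⟨h1, h2, h3⟩
      apply hcond
      ext i
      simp at hm
      by_cases hi : i = q
      · subst hi; simp; omega
      · simp [hi, h3 i hi]

lemma H0 {p n : ℕ} (f : MvPolynomial (Fin (n+2)) (ZMod p)) (hcoc : delta (ZMod p) 2 (n+2) f = 0)
    (d : Fin (n+2) → ℕ) (b : ℕ) (h1 : 0 < d 1) (hb : b < d 0) :
    ((d 0).choose b : ZMod p) * coeff (Finsupp.equivFunOnFinite.symm d) f =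
      ((d 1 + b).choose b : ZMod p) * coeff (Finsupp.equivFunOnFinite.symm
        (Function.update (Function.update d 0 (d 0 - b)) 1 (d 1 + b))) f := by
  have s1 : ∀ (m : Fin (n+3)) (x : Fin (n+3)), x = m ∨ ∃ i : Fin (n+2), m.succAbove i = x := by
    intro m x
    by_cases h : x = m
    · exact Or.inl h
    · exact Or.inr (Fin.exists_succAbove_eq h)
  set e : Fin (n+3) →₀ ℕ := Finsupp.equivFunOnFinite.symm
    (Fin.insertNth (1 : Fin (n+3)) b (Function.update d 0 (d 0 - b))) with he
  have e1 : ∀ i, e ((1 : Fin (n+3)).succAbove i) = Function.update d 0 (d 0 - b) i := by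
    intro i; rw [he, Finsupp.equivFunOnFinite_symm_apply_apply, Fin.insertNth_apply_succAbove]
  have e1' : e 1 = b := by rw [he, Finsupp.equivFunOnFinite_symm_apply_apply, Fin.insertNth_apply_same]
  have sa10 : (1 : Fin (n+3)).succAbove 0 = 0 := rfl
  have sa11 : (1 : Fin (n+3)).succAbove 1 = 2 := rfl
  have sa20 : (2 : Fin (n+3)).succAbove 0 = 0 := rfl
  have sa21 : (2 : Fin (n+3)).succAbove 1 = 1 := rfl
  have sa1 : ∀ j : Fin (n+2), j ≠ 0 → (1 : Fin (n+3)).succAbove j = j.succ := by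
    intro j hj
    apply Fin.succAbove_of_le_castSucc
    have : (j : ℕ) ≠ 0 := fun h => hj (Fin.ext h)
    rw [Fin.le_def]; simp; omega
  have sa2 : ∀ j : Fin (n+2), ¬ ((j:ℕ) + 1 ≤ 2) → (2 : Fin (n+3)).succAbove j = j.succ := by
    intro j hj
    apply Fin.succAbove_of_le_castSucc
    rw [Fin.le_def]; simp [Nat.mod_eq_of_lt (show 2 < n + 3 by omega)]; omega
  have sa2' : ∀ j : Fin (n+2), ((j:ℕ) + 1 ≤ 2) → (2 : Fin (n+3)).succAbove j = j.castSucc := by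
    intro j hj
    apply Fin.succAbove_of_castSucc_lt
    rw [Fin.lt_def]; simp [Nat.mod_eq_of_lt (show 2 < n + 3 by omega)]; omega
  have e0 : e 0 = d 0 - b := by rw [← sa10, e1]; simp
  have e2 : e 2 = d 1 := by rw [← sa11, e1]; simp
  have hc := congrArg (coeff e) hcoc
  unfold delta at hc
  have hI : Finset.Icc 1 2 = ({1, 2} : Finset ℕ) := rfl
  rw [hI, Finset.sum_pair (by norm_num)] at hc
  have T0 : coeff e (aeval (fun j : Fin (n+2) => (X j.succ : MvPolynomial (Fin (n+2+1)) (ZMod p))) f) = 0 := by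
    rw [aeval_X_comp Fin.succ f]
    apply coeff_rename_eq_zero
    intro u hu
    have : e 0 = 0 := by
      rw [← hu]
      exact Finsupp.mapDomain_of_notMem_range _ _ (by rintro ⟨i, hi⟩; exact Fin.succ_ne_zero i hi)
    omega
  have T3 : coeff e (aeval (fun j : Fin (n+2) =>
          if (j : ℕ) + 1 ≤ 2 then (X j.castSucc : MvPolynomial (Fin (n+2 + 1)) (ZMod p))
          else X j.succ) f) = 0 := by
    have : (fun j : Fin (n+2) =>
          if (j : ℕ) + 1 ≤ 2 then (X j.castSucc : MvPolynomial (Fin (n+2 + 1)) (ZMod p))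
          else X j.succ) = fun j => X ((2 : Fin (n+3)).succAbove j) := by
      funext j
      split_ifs with h
      · rw [sa2' j h]
      · rw [sa2 j h]
    rw [this]
    rw [aeval_X_comp (2 : Fin (n+3)).succAbove f]
    apply coeff_rename_eq_zero
    intro u hu
    have : e 2 = 0 := by
      rw [← hu]
      exact Finsupp.mapDomain_of_notMem_range _ _ (by rintro ⟨i, hi⟩; exact Fin.succAbove_ne _ i hi)
    omega
  have T1 := coeff_split (R := ZMod p) (0 : Fin (n+2)) ((1 : Fin (n+3)).succAbove)
    Fin.succAbove_right_injective 1 (Fin.succAbove_ne _) (s1 1) f e (fun j : Fin (n+2) =>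
          if (j : ℕ) + 1 < 1 then (X j.castSucc : MvPolynomial (Fin (n+2 + 1)) (ZMod p))
          else if (j : ℕ) + 1 = 1 then X j.castSucc + X j.succ
          else X j.succ) (by simp [sa10]) (by
            intro j hj
            rw [sa1 j hj]
            have : (j : ℕ) ≠ 0 := fun h => hj (Fin.ext h)
            simp; intro h; exact absurd h hj)
  have T2 := coeff_split (R := ZMod p) (1 : Fin (n+2)) ((2 : Fin (n+3)).succAbove)
    Fin.succAbove_right_injective 2 (Fin.succAbove_ne _) (s1 2) f e (fun j : Fin (n+2) =>
          if (j : ℕ) + 1 < 2 then (X j.castSucc : MvPolynomial (Fin (n+2 + 1)) (ZMod p))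
          else if (j : ℕ) + 1 = 2 then X j.castSucc + X j.succ
          else X j.succ) (by
            rw [sa21]
            have : ((1 : Fin (n+2)) : ℕ) = 1 := rfl
            simp only [this]
            rfl) (by
            intro j hj
            have : (j : ℕ) ≠ 1 := fun h => hj (Fin.ext h)
            split_ifs with h h'
            · rw [sa2' j (by omega)]
            · omega
            · rw [sa2 j (by omega)])
  have F1 : (fun i => if i = 0 then e ((1 : Fin (n+3)).succAbove 0) + e 1
      else e ((1 : Fin (n+3)).succAbove i)) = d := by
    funext i
    split_ifs with h
    · rw [sa10, e0, e1', h]; omega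
    · rw [e1]; simp [h]
  have F2 : (fun i => if i = 1 then e ((2 : Fin (n+3)).succAbove 1) + e 2
      else e ((2 : Fin (n+3)).succAbove i)) =
      Function.update (Function.update d 0 (d 0 - b)) 1 (d 1 + b) := by
    funext i
    split_ifs with h
    · rw [sa21, e1', e2, h]; simp; omega
    · rw [Function.update_of_ne h, ← e1]
      congr 1
      by_cases h0 : i = 0
      · rw [h0]; rfl
      · rw [sa1 i h0, sa2 i]
        have a : (i : ℕ) ≠ 0 := fun h => h0 (Fin.ext h)
        have b : (i : ℕ) ≠ 1 := fun hh => h (Fin.ext hh)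
        omega
  rw [F1, sa10, e0, e1', Nat.sub_add_cancel hb.le] at T1
  rw [F2, sa21, e1', e2, add_comm b, Nat.choose_symm_add] at T2
  rw [← T1, ← T2]
  have i1 : ((-1 : MvPolynomial (Fin (n+2+1)) (ZMod p)) ^ 1) = -1 := by ring
  have i2 : ((-1 : MvPolynomial (Fin (n+2+1)) (ZMod p)) ^ 2) = 1 := by ring
  have i3 : ((-1 : MvPolynomial (Fin (n+2+1)) (ZMod p)) ^ (2+1)) = -1 := by ring
  rw [i1, i2, i3, neg_one_mul, neg_one_mul, one_mul, coeff_add, coeff_add, coeff_add, coeff_neg,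
    coeff_neg, T0, T3, coeff_zero] at hc
  linear_combination -hc

lemma coeff_symm {R : Type*} [CommRing R] {k : ℕ} (f : MvPolynomial (Fin k) R)
    (hsym : f.IsSymmetric) (σ : Equiv.Perm (Fin k)) (d : Fin k → ℕ) :
    coeff (Finsupp.equivFunOnFinite.symm (d ∘ σ)) f =
      coeff (Finsupp.equivFunOnFinite.symm d) f := by
  have h := coeff_rename_mapDomain σ σ.injective f (Finsupp.equivFunOnFinite.symm (d ∘ σ))
  rw [hsym σ] at h
  rw [← h]
  congr 1
  ext i
  obtain ⟨j, rfl⟩ := σ.surjective i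
  rw [Finsupp.mapDomain_apply σ.injective]
  simp

lemma H1 {p n : ℕ} (f : MvPolynomial (Fin (n+2)) (ZMod p)) (hsym : f.IsSymmetric)
    (hcoc : delta (ZMod p) 2 (n+2) f = 0)
    (d : Fin (n+2) → ℕ) (i j : Fin (n+2)) (hij : i ≠ j) (b : ℕ) (h1 : 0 < d j) (hb : b < d i) :
    ((d i).choose b : ZMod p) * coeff (Finsupp.equivFunOnFinite.symm d) f =
      ((d j + b).choose b : ZMod p) * coeff (Finsupp.equivFunOnFinite.symm
        (Function.update (Function.update d i (d i - b)) j (d j + b))) f := by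
  obtain ⟨σ, h0, h1'⟩ : ∃ σ : Equiv.Perm (Fin (n+2)), σ 0 = i ∧ σ 1 = j := by
    refine ⟨(Equiv.swap 0 i).trans (Equiv.swap (Equiv.swap 0 i 1) j), ?_, ?_⟩
    · simp only [Equiv.trans_apply, Equiv.swap_apply_left]
      refine Equiv.swap_apply_of_ne_of_ne ?_ hij
      intro h
      have : Equiv.swap 0 i 0 = Equiv.swap 0 i 1 := by rw [← h]; simp
      exact absurd ((Equiv.swap 0 i).injective this) (by simp)
    · simp
  have h := H0 f hcoc (d ∘ σ) b (by simpa [h1'] using h1) (by simpa [h0] using hb)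
  rw [coeff_symm f hsym σ d] at h
  simp only [Function.comp_apply, h0, h1'] at h
  rw [h, ← coeff_symm f hsym σ (Function.update (Function.update d i (d i - b)) j (d j + b))]
  congr 3
  rw [← h0, ← h1']
  simp only [Function.update_comp_equiv, Equiv.symm_apply_apply]

/-- If `λ` is not `p`-carry-minimal, then `τλ` cannot
participate in any symmetric `2`-cocycle over `ℤ/pℤ`: every symmetric `f` with
`δ_2(f) = 0` has zero coefficient on all monomials with exponent multiset `λ`. -/
theorem statement15 (p : ℕ) (hp : p.Prime) (k : ℕ) (hk : 2 ≤ k)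
    (lam : Multiset ℕ) (hpos : ∀ x ∈ lam, 0 < x) (hcard : Multiset.card lam = k)
    (hmin : ¬ IsCarryMin p lam)
    (f : MvPolynomial (Fin k) (ZMod p)) (hsym : f.IsSymmetric)
    (hcoc : delta (ZMod p) 2 k f = 0)
    (d : Fin k →₀ ℕ) (hd : exMult d = lam) :
    MvPolynomial.coeff d f = 0 := by
  by_contra hne
  have hp2 := hp.two_le
  obtain ⟨n, rfl⟩ : ∃ n, k = n + 2 := ⟨k - 2, by omega⟩
  unfold IsCarryMin at hmin
  push Not at hmin
  obtain ⟨μ, μpos, μsum, μcard, hlt⟩ := hmin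
  have aL := alpha_eq hp lam
  have aM := alpha_eq hp μ
  rw [μsum] at aM
  have hmul : (p-1) * (alphaCarry p μ + 1) ≤ (p-1) * alphaCarry p lam := Nat.mul_le_mul_left _ hlt
  rw [mul_add, mul_one] at hmul
  have hk' : n + 2 ≤ (μ.map (sigmaDigits p)).sum := by
    rw [← hcard, ← μcard]
    have : Multiset.card (μ.map (sigmaDigits p)) • 1 ≤ (μ.map (sigmaDigits p)).sum := by
      apply Multiset.card_nsmul_le_sum
      intro x hx
      obtain ⟨y, hy, rfl⟩ := Multiset.mem_map.1 hx
      have hy0 := μpos y hy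
      by_contra h
      have h0 : (Nat.digits p y).sum = 0 := by unfold sigmaDigits at h; omega
      have h2 := List.sum_eq_zero_iff.1 h0
      have hne' : Nat.digits p y ≠ [] := Nat.digits_ne_nil_iff_ne_zero.2 hy0.ne'
      exact Nat.getLast_digit_ne_zero p hy0.ne' (h2 _ (List.getLast_mem hne'))
    simpa using this
  have lsum : lam.sum = ∑ i, d i := by rw [← hd]; rfl
  have lmap : (lam.map (sigmaDigits p)).sum = ∑ i, sigmaDigits p (d i) := by
    rw [← hd, exMult, multisetOf, Multiset.map_map]; rfl
  set N := ∑ i, d i with hN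
  have hNlt : N < p ^ N := Nat.lt_pow_self (by omega)
  have hdN : ∀ i, d i < p ^ N := by
    intro i
    have : d i ≤ ∑ l, d l := Finset.single_le_sum (fun _ _ => Nat.zero_le _) (Finset.mem_univ i)
    omega
  have lmap' : (lam.map (sigmaDigits p)).sum = ∑ i, sg p N (d i) := by
    rw [lmap]; exact Finset.sum_congr rfl (fun i _ => sg_eq hp2 N _ (hdN i))
  obtain ⟨s, hs⟩ : ∃ s, p ≤ ∑ i, dg p s (d i) := by
    by_contra hc
    push Not at hc
    have : sg p N N = ∑ i, sg p N (d i) := by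
      conv_lhs => rw [sg]
      unfold sg
      rw [Finset.sum_comm]
      refine Finset.sum_congr rfl (fun r _ => ?_)
      rw [hN]
      exact dg_sum hp2 _ r _ hc
    rw [← lmap', ← sg_eq hp2 N N hNlt, ← lsum] at this
    omega
  have I : TokInv p (n+2) N s (fun d => coeff (Finsupp.equivFunOnFinite.symm d) f) d :=
    ⟨by simpa using hne, fun i => hpos _ (by
        rw [← hd]; exact Multiset.mem_map.2 ⟨i, Finset.mem_univ_val i, rfl⟩), hNlt,
      by rw [← lmap']; omega, hs⟩
  obtain ⟨i0, -, hi0⟩ : ∃ i ∈ Finset.univ, dg p s (d i) ≠ 0 :=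
    Finset.exists_ne_zero_of_sum_ne_zero (by omega)
  have := dg_lt hp2 s (d i0)
  exact core hp (H1 f hsym hcoc) i0 (p - dg p s (d i0)) d I (by omega) (by omega)
end

section
/- Let p be a prime and let n, k ≥ 2 be such that there exists a power-of-p multiset of cardinality k with sum n. Then the Z_p-vector space of symmetric polynomials f ∈ Z_p[x_1,…,x_k], homogeneous of degree n, satisfying δ_2(f) = 0 is exactly the Z_p-linear span of the set {τλ : λ a power-of-p multi-index of length k and weight n}. -/
open MvPolynomial

theorem sig_add (p : ℕ) (hp : p.Prime) (a b : ℕ) :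
    (p-1) * padicValNat p ((a+b).choose a) + (Nat.digits p (a+b)).sum =
      (Nat.digits p a).sum + (Nat.digits p b).sum := by
  have := Fact.mk hp
  have h1 := sub_one_mul_padicValNat_factorial (p := p) (a+b)
  have h2 := sub_one_mul_padicValNat_factorial (p := p) a
  have h3 := sub_one_mul_padicValNat_factorial (p := p) b
  have l1 := Nat.digit_sum_le p (a+b)
  have l2 := Nat.digit_sum_le p a
  have l3 := Nat.digit_sum_le p b
  have h4 := Nat.add_choose_mul_factorial_mul_factorial a b
  rw [← Nat.choose_symm_add] at h4
  have c0 : (a+b).choose a ≠ 0 := (Nat.choose_pos (by omega)).ne'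
  have := congrArg (padicValNat p) h4
  rw [padicValNat.mul (mul_ne_zero c0 (Nat.factorial_ne_zero _)) (Nat.factorial_ne_zero _),
    padicValNat.mul c0 (Nat.factorial_ne_zero _)] at this
  have h5 := congrArg (fun x => (p-1)*x) this
  simp only [mul_add] at h5
  omega

theorem sig_le_s16 (p : ℕ) (hp : p.Prime) (a b : ℕ) :
    (Nat.digits p (a+b)).sum ≤ (Nat.digits p a).sum + (Nat.digits p b).sum := by
  have := sig_add p hp a b; omega

theorem sig_iff (p : ℕ) (hp : p.Prime) (a b : ℕ) :
    ¬ p ∣ (a+b).choose a ↔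
    (Nat.digits p (a+b)).sum = (Nat.digits p a).sum + (Nat.digits p b).sum := by
  have := Fact.mk hp
  have := sig_add p hp a b
  have c0 : (a+b).choose a ≠ 0 := (Nat.choose_pos (by omega)).ne'
  have h2 := hp.two_le
  rw [dvd_iff_padicValNat_ne_zero c0, not_not]
  constructor
  · intro h; rw [h] at this; omega
  · intro h
    have : (p-1) * padicValNat p ((a+b).choose a) = 0 := by omega
    rcases mul_eq_zero.1 this with h | h
    · omega
    · exact h

theorem sig_digit (p : ℕ) (hp : p.Prime) (c v : ℕ) (hc : c < p) :
    (Nat.digits p (c + p * v)).sum = c + (Nat.digits p v).sum := by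
  by_cases h : c = 0 ∧ v = 0
  · obtain ⟨rfl, rfl⟩ := h; simp
  · rw [Nat.digits_add p hp.one_lt c v hc (by tauto)]
    simp

theorem sig_pow_s16 (p : ℕ) (hp : p.Prime) (i : ℕ) : (Nat.digits p (p^i)).sum = 1 := by
  induction i with
  | zero => simpa using sig_digit p hp 1 0 hp.one_lt
  | succ i ih =>
    have := sig_digit p hp 0 (p^i) hp.pos
    rw [pow_succ, mul_comm]; simpa [ih] using this

def tval (p : ℕ) (t : Multiset ℕ) : ℕ := (t.map (p ^ ·)).sum

theorem tval_add (p : ℕ) (s t : Multiset ℕ) : tval p (s + t) = tval p s + tval p t := by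
  simp [tval]

theorem tval_cons (p i : ℕ) (t : Multiset ℕ) : tval p (i ::ₘ t) = p ^ i + tval p t := by
  simp [tval]

theorem tval_map_succ (p : ℕ) (t : Multiset ℕ) : tval p (t.map Nat.succ) = p * tval p t := by
  induction t using Multiset.induction with
  | empty => simp [tval]
  | cons a t ih => rw [Multiset.map_cons, tval_cons, tval_cons, ih, Nat.succ_eq_add_one]; ring

theorem tval_zero_rep (p c : ℕ) : tval p (Multiset.replicate c 0) = c := by
  simp [tval]

def TV (p : ℕ) (t : Multiset ℕ) : Prop := (Nat.digits p (tval p t)).sum = Multiset.card t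

theorem sig_tval_le (p : ℕ) (hp : p.Prime) (t : Multiset ℕ) :
    (Nat.digits p (tval p t)).sum ≤ Multiset.card t := by
  induction t using Multiset.induction with
  | empty => simp [tval]
  | cons a t ih =>
    rw [tval_cons, Multiset.card_cons]
    have := sig_le_s16 p hp (p^a) (tval p t)
    rw [sig_pow_s16 p hp] at this; omega

theorem tval_pos (p : ℕ) (hp : p.Prime) (t : Multiset ℕ) (ht : t ≠ 0) : 0 < tval p t := by
  obtain ⟨a, ha⟩ := Multiset.exists_mem_of_ne_zero ht
  obtain ⟨u, rfl⟩ := Multiset.exists_cons_of_mem ha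
  rw [tval_cons]; have := pow_pos hp.pos a; omega

theorem tval_exists (p : ℕ) (hp : p.Prime) (z : ℕ) : ∃ t, tval p t = z ∧ TV p t := by
  induction z using Nat.strong_induction_on with
  | _ z ih =>
  by_cases hz : z = 0
  · exact ⟨0, by simp [tval, hz], by simp [TV, tval]⟩
  obtain ⟨t, h1, h2⟩ := ih (z / p) (Nat.div_lt_self (Nat.pos_of_ne_zero hz) hp.one_lt)
  have hv : tval p (Multiset.replicate (z % p) 0 + t.map Nat.succ) = z := by
    rw [tval_add, tval_zero_rep, tval_map_succ, h1]; exact Nat.mod_add_div z p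
  refine ⟨Multiset.replicate (z % p) 0 + t.map Nat.succ, hv, ?_⟩
  unfold TV at h2 ⊢
  rw [tval_add, tval_zero_rep, tval_map_succ, sig_digit p hp _ _ (Nat.mod_lt _ hp.pos), h2]
  simp

theorem TV_sub (p : ℕ) (hp : p.Prime) (s t : Multiset ℕ) (h : TV p (s + t)) :
    TV p s ∧ TV p t ∧ ¬ p ∣ (tval p s + tval p t).choose (tval p s) := by
  unfold TV at *
  rw [tval_add, Multiset.card_add] at h
  have h1 := sig_le_s16 p hp (tval p s) (tval p t)
  have h2 := sig_tval_le p hp s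
  have h3 := sig_tval_le p hp t
  refine ⟨by omega, by omega, ?_⟩
  rw [sig_iff p hp]; omega

theorem TV_add (p : ℕ) (hp : p.Prime) (s t : Multiset ℕ) (hs : TV p s) (ht : TV p t)
    (h : ¬ p ∣ (tval p s + tval p t).choose (tval p s)) : TV p (s + t) := by
  rw [sig_iff p hp] at h
  unfold TV at *
  rw [tval_add, Multiset.card_add, h, hs, ht]

theorem TV_count (p : ℕ) (hp : p.Prime) (t : Multiset ℕ) (h : TV p t) (i : ℕ) :
    t.count i < p := by
  by_contra hc
  push Not at hc
  rw [Multiset.le_count_iff_replicate_le] at hc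
  obtain ⟨u, rfl⟩ := Multiset.le_iff_exists_add.1 hc
  have h1 := (TV_sub p hp _ _ h).1
  unfold TV at h1
  have : tval p (Multiset.replicate p i) = p ^ (i+1) := by
    simp [tval, pow_succ, mul_comm]
  rw [this, sig_pow_s16 p hp] at h1
  have := hp.two_le
  simp at h1; omega

theorem TV_of_count (p : ℕ) (hp : p.Prime) (N : ℕ) : ∀ (t : Multiset ℕ), (∀ i ∈ t, i < N) →
    (∀ i, t.count i < p) → TV p t := by
  induction N with
  | zero =>
    intro t h _
    have : t = 0 := Multiset.eq_zero_of_forall_notMem (fun i hi => by simpa using h i hi)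
    subst this; simp [TV, tval]
  | succ N ih =>
    intro t h hc
    have key : ∃ t' : Multiset ℕ, t = Multiset.replicate (t.count 0) 0 + t'.map Nat.succ := by
      refine ⟨(t.filter (fun x => ¬ (x = 0))).map Nat.pred, ?_⟩
      rw [Multiset.map_map]
      conv_lhs => rw [← Multiset.filter_add_not (fun x => x = 0) t]
      rw [Multiset.filter_eq']
      congr 1
      conv_lhs => rw [← Multiset.map_id (Multiset.filter (fun x => ¬ (x = 0)) t)]
      apply Multiset.map_congr rfl
      intro x hx
      have := (Multiset.mem_filter.1 hx).2
      simp; omega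
    obtain ⟨t', ht'⟩ := key
    have hT : TV p t' := by
      apply ih
      · intro i hi
        have : i + 1 ∈ t := by
          rw [ht']; simp [hi]
        have := h _ this; omega
      · intro i
        have h1 := hc (i+1)
        rw [ht', Multiset.count_add] at h1
        have := Multiset.count_map_eq_count' Nat.succ t' Nat.succ_injective i
        simp only [Nat.succ_eq_add_one] at this h1
        omega
    unfold TV at *
    have h0 := hc 0
    generalize t.count 0 = c at *
    subst ht'
    rw [tval_add, tval_zero_rep, tval_map_succ, sig_digit p hp _ _ h0, hT]
    simp

theorem phase2 (p : ℕ) (hp : p.Prime) (P : Multiset ℕ → Prop)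
    (step : ∀ a b y u, 0 < a → 0 < b → 0 < y → P ((a+b) ::ₘ y ::ₘ u) → ¬ p ∣ (a+b).choose a →
      ¬ p ∣ (b+y).choose b ∧ P (a ::ₘ (b+y) ::ₘ u)) (i N : ℕ) : ∀ (t v : Multiset ℕ), v.count i = N → TV p t → p ≤ Multiset.card t →
    P (tval p t ::ₘ v.map (p ^ ·)) → t.count i + N < p := by
  induction N with
  | zero => intro t v _ ht _ _; simpa using TV_count p hp t ht i
  | succ N ih =>
    intro t v hv ht hc hP
    have h2 := hp.two_le
    have hi : i ∈ v := by rw [← Multiset.count_pos]; omega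
    obtain ⟨v', rfl⟩ := Multiset.exists_cons_of_mem hi
    have hj : ∃ j ∈ t, j ≠ i := by
      by_contra hcon
      push Not at hcon
      have h1 := TV_count p hp t ht i
      rw [Multiset.count_eq_card.2 (fun x hx => (hcon x hx).symm)] at h1
      omega
    obtain ⟨j, hjt, hji⟩ := hj
    obtain ⟨t', rfl⟩ := Multiset.exists_cons_of_mem hjt
    rw [Multiset.card_cons] at hc
    have ht'0 : t' ≠ 0 := by rintro rfl; simp at hc; omega
    have pos' := tval_pos p hp t' ht'0
    have pi := pow_pos hp.pos i
    have pj := pow_pos hp.pos j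
    have e1 : j ::ₘ t' = t' + {j} := by rw [add_comm, Multiset.singleton_add]
    have hs := TV_sub p hp t' {j} (by rw [← e1]; exact ht)
    have vj : ∀ j, tval p {j} = p ^ j := by intro j; simp [tval]
    rw [vj] at hs
    have st1 := step (tval p t') (p^j) (p^i) (v'.map (p ^ ·)) pos' pj pi
      (by rw [tval_cons, Multiset.map_cons, add_comm] at hP; exact hP) hs.2.2
    have st2 := step (p^j) (p^i) (tval p t') (v'.map (p ^ ·)) pj pi pos'
      (by rw [Multiset.cons_swap]; exact st1.2)
      (by simpa using st1.1)
    have hTi : TV p ({i} : Multiset ℕ) := by unfold TV; rw [vj, sig_pow_s16 p hp]; simp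
    have hT2 := TV_add p hp {i} t' hTi hs.1 (by rw [vj]; exact st2.1)
    rw [Multiset.singleton_add] at hT2
    have := ih (i ::ₘ t') (j ::ₘ v') (by
      rw [Multiset.count_cons_self] at hv
      rw [Multiset.count_cons_of_ne hji.symm]; omega) hT2 (by rw [Multiset.card_cons]; omega)
      (by rw [tval_cons, Multiset.map_cons, Multiset.cons_swap]; exact st2.2)
    rw [Multiset.count_cons_self] at this
    rw [Multiset.count_cons_of_ne hji.symm]; omega

theorem phase1 (p : ℕ) (hp : p.Prime) (P : Multiset ℕ → Prop)
    (step : ∀ a b y u, 0 < a → 0 < b → 0 < y → P ((a+b) ::ₘ y ::ₘ u) → ¬ p ∣ (a+b).choose a →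
      ¬ p ∣ (b+y).choose b ∧ P (a ::ₘ (b+y) ::ₘ u)) (u : Multiset ℕ) : ∀ (t v : Multiset ℕ), (∀ x ∈ u, 0 < x) → TV p t → t ≠ 0 →
    P (tval p t ::ₘ (u + v.map (p ^ ·))) → ∃ t' v', TV p t' ∧ P (tval p t' ::ₘ v'.map (p ^ ·)) ∧
      Multiset.card v' = Multiset.card u + Multiset.card v ∧
      Multiset.card t ≤ Multiset.card t' ∧
      tval p t' + tval p v' = tval p t + u.sum + tval p v := by
  induction u using Multiset.induction with
  | empty => intro t v _ ht _ hP; exact ⟨t, v, ht, by simpa using hP, by simp, le_rfl, by simp⟩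
  | cons y u ih =>
    intro t v hpos ht ht0 hP
    obtain ⟨w, rfl, hw⟩ := tval_exists p hp y
    have hy := hpos _ (Multiset.mem_cons_self _ _)
    have hw0 : w ≠ 0 := by rintro rfl; simp [tval] at hy
    obtain ⟨i, hi⟩ := Multiset.exists_mem_of_ne_zero hw0
    obtain ⟨w', rfl⟩ := Multiset.exists_cons_of_mem hi
    have vj : ∀ j, tval p {j} = p ^ j := by intro j; simp [tval]
    have hpos' : ∀ x ∈ u, 0 < x := fun x hx => hpos x (Multiset.mem_cons_of_mem hx)
    have main : TV p (w' + t) ∧ P (tval p (w' + t) ::ₘ (u + (i ::ₘ v).map (p ^ ·))) := by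
      by_cases hw'0 : w' = 0
      · subst hw'0
        refine ⟨by simpa using ht, ?_⟩
        simpa [tval_cons, tval] using hP
      · rw [← Multiset.singleton_add] at hw
        have hs := TV_sub p hp _ _ hw
        rw [vj] at hs
        have st := step (p^i) (tval p w') (tval p t) (u + v.map (p ^ ·)) (pow_pos hp.pos i)
          (tval_pos p hp _ hw'0) (tval_pos p hp _ ht0)
          (by rw [tval_cons, Multiset.cons_add, Multiset.cons_swap] at hP; exact hP) hs.2.2
        refine ⟨TV_add p hp _ _ hs.2.1 ht st.1, ?_⟩
        rw [tval_add, Multiset.map_cons, Multiset.add_cons, Multiset.cons_swap]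
        exact st.2
    obtain ⟨t', v', h1, h2, h3, h4, h5⟩ := ih (w' + t) (i ::ₘ v) hpos' main.1
      (by intro h; exact ht0 (by simpa using (add_eq_zero.1 h).2)) main.2
    refine ⟨t', v', h1, h2, ?_, ?_, ?_⟩
    · rw [h3]; simp; ring
    · rw [Multiset.card_add] at h4; omega
    · rw [h5, tval_add, tval_cons, tval_cons, Multiset.sum_cons]; ring

theorem tval_mod (p : ℕ) (hp : p.Prime) (t : Multiset ℕ) : tval p t ≡ Multiset.card t [MOD (p-1)] := by
  induction t using Multiset.induction with
  | empty => simp [tval]; rfl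
  | cons a t ih =>
    rw [tval_cons, Multiset.card_cons, add_comm]
    apply Nat.ModEq.add ih
    have : p ≡ 1 [MOD (p-1)] := by
      rw [Nat.ModEq.comm, Nat.modEq_iff_dvd' hp.one_lt.le]
    simpa using this.pow a

theorem comb (p : ℕ) (hp : p.Prime) (P : Multiset ℕ → Prop)
    (step : ∀ a b y u, 0 < a → 0 < b → 0 < y → P ((a+b) ::ₘ y ::ₘ u) → ¬ p ∣ (a+b).choose a →
      ¬ p ∣ (b+y).choose b ∧ P (a ::ₘ (b+y) ::ₘ u)) (e s : Multiset ℕ) (hs : P s) (hpos : ∀ x ∈ s, 0 < x)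
    (hcard : Multiset.card s = Multiset.card e) (hsum : s.sum = tval p e) :
    ∀ x ∈ s, ∃ a, x = p ^ a := by
  intro x hx
  obtain ⟨u, rfl⟩ := Multiset.exists_cons_of_mem hx
  obtain ⟨t, rfl, ht⟩ := tval_exists p hp x
  have ht0 : t ≠ 0 := by
    rintro rfl
    have := hpos _ hx
    simp [tval] at this
  by_cases h1 : Multiset.card t = 1
  · obtain ⟨a, rfl⟩ := Multiset.card_eq_one.1 h1
    exact ⟨a, by simp [tval]⟩
  exfalso
  have h2 : 2 ≤ Multiset.card t := by
    have := Multiset.card_pos.2 ht0; omega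
  obtain ⟨t', v', k1, k2, k3, k4, k5⟩ := phase1 p hp P step u t 0
    (fun x hx => hpos x (Multiset.mem_cons_of_mem hx)) ht ht0 (by simpa using hs)
  have hv : tval p (t' + v') = tval p e := by
    rw [tval_add, k5, ← hsum]; simp [tval]
  have hm : Multiset.card (t' + v') ≡ Multiset.card e [MOD (p-1)] := by
    have a1 := tval_mod p hp (t' + v')
    have a2 := tval_mod p hp e
    rw [hv] at a1
    exact a1.symm.trans a2
  rw [Multiset.card_cons] at hcard
  simp only [Multiset.card_zero, add_zero] at k3
  rw [Multiset.card_add] at hm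
  have hdvd := (Nat.modEq_iff_dvd' (by omega)).1 hm.symm
  have := Nat.le_of_dvd (by omega) hdvd
  have hcp : p ≤ Multiset.card t' := by omega
  have hcount : ∀ i, (t' + v').count i < p := by
    intro i
    rw [Multiset.count_add]
    exact phase2 p hp P step i _ t' v' rfl k1 hcp k2
  have hT : TV p (t' + v') := TV_of_count p hp ((t' + v').sum + 1) _
    (fun i hi => Nat.lt_succ_of_le (Multiset.le_sum_of_mem hi)) hcount
  unfold TV at hT
  rw [hv, Multiset.card_add] at hT
  have := sig_tval_le p hp e
  omega


theorem monomial_cons' {A : Type*} [CommRing A] {m : ℕ} (e : ℕ) (r : Fin m →₀ ℕ) (c : A) :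
    (monomial (Finsupp.cons e r) c : MvPolynomial (Fin (m+1)) A) =
      X 0 ^ e * rename Fin.succ (monomial r c) := by
  rw [rename_monomial, X_pow_eq_monomial, monomial_mul, one_mul]
  have : Finsupp.cons e r = Finsupp.single 0 e + Finsupp.mapDomain Fin.succ r := by
    ext i
    refine Fin.cases ?_ (fun i => ?_) i
    · rw [Finsupp.add_apply, Finsupp.cons_zero, Finsupp.mapDomain_of_notMem_range _ _ (by simp)]
      simp
    · rw [Finsupp.add_apply, Finsupp.cons_succ, Finsupp.mapDomain_apply (Fin.succ_injective _)]
      simp [Finsupp.single_apply, (Fin.succ_ne_zero i).symm]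
  rw [this]

theorem aeval_mono {A : Type*} [CommRing A] {m : ℕ} 
    (φ : Fin (m+2) → MvPolynomial (Fin (m+3)) A)
    (hφ : ∀ j : Fin m, φ j.succ.succ = X j.succ.succ.succ) (a b : ℕ) (r : Fin m →₀ ℕ) (c : A) :
    aeval φ (monomial (Finsupp.cons a (Finsupp.cons b r)) c) =
      φ 0 ^ a * (φ 1 ^ b * rename (Fin.succ ∘ Fin.succ ∘ Fin.succ) (monomial r c)) := by
  rw [monomial_cons', monomial_cons', map_mul, map_mul, map_mul, map_pow, aeval_X, map_pow,
    map_pow, rename_X, aeval_X, aeval_rename, aeval_rename]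
  have : ((φ ∘ Fin.succ) ∘ Fin.succ) = (X ∘ (Fin.succ ∘ Fin.succ ∘ Fin.succ)) := by
    funext j
    simp [hφ]
  rw [this, ← rename_eq_aeval]
  rfl

theorem mono3 {A : Type*} [CommRing A] {m : ℕ} (a b y : ℕ) (r : Fin m →₀ ℕ) (c : A) :
    (monomial (Finsupp.cons a (Finsupp.cons b (Finsupp.cons y r))) c : MvPolynomial (Fin (m+3)) A) =
      X 0 ^ a * (X 1 ^ b * (X 2 ^ y * 
        rename (Fin.succ ∘ Fin.succ ∘ Fin.succ) (monomial r c))) := by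
  rw [monomial_cons', monomial_cons', monomial_cons', map_mul, map_mul, map_mul, map_pow,
    map_pow, map_pow, rename_X, rename_X, rename_X, rename_rename, rename_rename]
  rfl

theorem cons1_eq {m : ℕ} (a a' : ℕ) (r r' : Fin m →₀ ℕ) :
    Finsupp.cons a r = Finsupp.cons a' r' ↔ a = a' ∧ r = r' := by
  rw [Finsupp.cons_injective2.eq_iff]

theorem exists_cons2 {m : ℕ} (u : Fin (m+2) →₀ ℕ) : 
    ∃ a b r, u = Finsupp.cons a (Finsupp.cons b r) :=
  ⟨u 0, u.tail 0, u.tail.tail, by rw [Finsupp.cons_tail, Finsupp.cons_tail]⟩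

section coeffs
variable {A : Type*} [CommRing A] {m : ℕ} (a b y : ℕ) (r : Fin m →₀ ℕ)
    (φ : Fin (m+2) → MvPolynomial (Fin (m+3)) A)
    (hφ : ∀ j : Fin m, φ j.succ.succ = X j.succ.succ.succ)

theorem coeffT0 (hφ : ∀ j : Fin m, φ j.succ.succ = X j.succ.succ.succ)
    (h0 : φ 0 = X 1) (h1 : φ 1 = X 2) (f : MvPolynomial (Fin (m+2)) A) :
    coeff (Finsupp.cons a (Finsupp.cons b (Finsupp.cons y r))) (aeval φ f) =
      if a = 0 then coeff (Finsupp.cons b (Finsupp.cons y r)) f else 0 := by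
  induction f using MvPolynomial.induction_on' with
  | add p q hp hq => rw [map_add, coeff_add, hp, hq]; split_ifs <;> simp
  | monomial u c =>
    obtain ⟨e0, e1, s, rfl⟩ := exists_cons2 u
    have := mono3 0 e0 e1 s c
    rw [pow_zero, one_mul] at this
    rw [aeval_mono φ hφ, h0, h1, ← this, coeff_monomial, coeff_monomial]
    simp only [cons1_eq]
    split_ifs <;> first | rfl | (exfalso; omega) | (exfalso; tauto)

theorem coeffT3 (hφ : ∀ j : Fin m, φ j.succ.succ = X j.succ.succ.succ)
    (h0 : φ 0 = X 0) (h1 : φ 1 = X 1) (f : MvPolynomial (Fin (m+2)) A) :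
    coeff (Finsupp.cons a (Finsupp.cons b (Finsupp.cons y r))) (aeval φ f) =
      if y = 0 then coeff (Finsupp.cons a (Finsupp.cons b r)) f else 0 := by
  induction f using MvPolynomial.induction_on' with
  | add p q hp hq => rw [map_add, coeff_add, hp, hq]; split_ifs <;> simp
  | monomial u c =>
    obtain ⟨e0, e1, s, rfl⟩ := exists_cons2 u
    have := mono3 e0 e1 0 s c
    rw [pow_zero, one_mul] at this
    rw [aeval_mono φ hφ, h0, h1, ← this, coeff_monomial, coeff_monomial]
    simp only [cons1_eq]
    split_ifs <;> first | rfl | (exfalso; omega) | (exfalso; tauto)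

theorem coeffT1 (hφ : ∀ j : Fin m, φ j.succ.succ = X j.succ.succ.succ)
    (h0 : φ 0 = X 0 + X 1) (h1 : φ 1 = X 2) (f : MvPolynomial (Fin (m+2)) A) :
    coeff (Finsupp.cons a (Finsupp.cons b (Finsupp.cons y r))) (aeval φ f) =
      ((a+b).choose a : A) * coeff (Finsupp.cons (a+b) (Finsupp.cons y r)) f := by
  induction f using MvPolynomial.induction_on' with
  | add p q hp hq => rw [map_add, coeff_add, hp, hq]; simp [mul_add]
  | monomial u c =>
    obtain ⟨e0, e1, s, rfl⟩ := exists_cons2 u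
    have key : aeval φ (monomial (Finsupp.cons e0 (Finsupp.cons e1 s)) c) = 
        ∑ i ∈ Finset.range (e0+1), C ((e0.choose i : ℕ) : A) *
          monomial (Finsupp.cons i (Finsupp.cons (e0-i) (Finsupp.cons e1 s))) c := by
      rw [aeval_mono φ hφ, h0, h1, add_pow, Finset.sum_mul]
      refine Finset.sum_congr rfl fun i _ => ?_
      rw [mono3, map_natCast]; ring
    rw [key, coeff_sum, coeff_monomial]
    simp only [coeff_C_mul, coeff_monomial, cons1_eq]
    split_ifs with h
    · obtain ⟨rfl, rfl, rfl⟩ := h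
      rw [Finset.sum_eq_single a]
      · simp
      · intro i _ hi; simp [hi]
      · intro h; simp at h
    · rw [mul_zero]
      apply Finset.sum_eq_zero
      intro i hi
      rw [if_neg, mul_zero]
      rintro ⟨rfl, h2, rfl, rfl⟩
      apply h
      simp at hi
      refine ⟨by omega, rfl, rfl⟩

theorem coeffT2 (hφ : ∀ j : Fin m, φ j.succ.succ = X j.succ.succ.succ)
    (h0 : φ 0 = X 0) (h1 : φ 1 = X 1 + X 2) (f : MvPolynomial (Fin (m+2)) A) :
    coeff (Finsupp.cons a (Finsupp.cons b (Finsupp.cons y r))) (aeval φ f) =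
      ((b+y).choose b : A) * coeff (Finsupp.cons a (Finsupp.cons (b+y) r)) f := by
  induction f using MvPolynomial.induction_on' with
  | add p q hp hq => rw [map_add, coeff_add, hp, hq]; simp [mul_add]
  | monomial u c =>
    obtain ⟨e0, e1, s, rfl⟩ := exists_cons2 u
    have key : aeval φ (monomial (Finsupp.cons e0 (Finsupp.cons e1 s)) c) = 
        ∑ i ∈ Finset.range (e1+1), C ((e1.choose i : ℕ) : A) *
          monomial (Finsupp.cons e0 (Finsupp.cons i (Finsupp.cons (e1-i) s))) c := by
      rw [aeval_mono φ hφ, h0, h1, add_pow, Finset.sum_mul, Finset.mul_sum]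
      refine Finset.sum_congr rfl fun i _ => ?_
      rw [mono3, map_natCast]; ring
    rw [key, coeff_sum, coeff_monomial]
    simp only [coeff_C_mul, coeff_monomial, cons1_eq]
    split_ifs with h
    · obtain ⟨rfl, rfl, rfl⟩ := h
      rw [Finset.sum_eq_single b]
      · simp
      · intro i _ hi; simp [hi]
      · intro h; simp at h
    · rw [mul_zero]
      apply Finset.sum_eq_zero
      intro i hi
      rw [if_neg, mul_zero]
      rintro ⟨rfl, rfl, h2, rfl⟩
      apply h
      simp at hi
      refine ⟨rfl, by omega, rfl⟩

end coeffs

theorem delta_eq {A : Type*} [CommRing A] {m : ℕ} : ∃ φ0 φ1 φ2 φ3 : Fin (m+2) → MvPolynomial (Fin (m+3)) A,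
    (∀ f, delta A 2 (m+2) f = aeval φ0 f - aeval φ1 f + aeval φ2 f - aeval φ3 f) ∧
    (∀ j : Fin m, φ0 j.succ.succ = X j.succ.succ.succ) ∧ 
    (∀ j : Fin m, φ1 j.succ.succ = X j.succ.succ.succ) ∧ 
    (∀ j : Fin m, φ2 j.succ.succ = X j.succ.succ.succ) ∧ 
    (∀ j : Fin m, φ3 j.succ.succ = X j.succ.succ.succ) ∧
    φ0 0 = X 1 ∧ φ0 1 = X 2 ∧ φ1 0 = X 0 + X 1 ∧ φ1 1 = X 2 ∧ 
    φ2 0 = X 0 ∧ φ2 1 = X 1 + X 2 ∧ φ3 0 = X 0 ∧ φ3 1 = X 1 := by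
  refine ⟨fun j : Fin (m+2) => (X j.succ : MvPolynomial (Fin (m + 2 + 1)) A),
    fun j : Fin (m+2) => 
          if (j : ℕ) + 1 < 1 then (X j.castSucc : MvPolynomial (Fin (m + 2 + 1)) A)
          else if (j : ℕ) + 1 = 1 then X j.castSucc + X j.succ
          else X j.succ, 
    fun j : Fin (m+2) => 
          if (j : ℕ) + 1 < 2 then (X j.castSucc : MvPolynomial (Fin (m + 2 + 1)) A)
          else if (j : ℕ) + 1 = 2 then X j.castSucc + X j.succ
          else X j.succ, 
    fun j : Fin (m+2) => 
          if (j : ℕ) + 1 ≤ 2 then (X j.castSucc : MvPolynomial (Fin (m + 2 + 1)) A)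
          else X j.succ, fun f => ?_, ?_⟩
  · unfold delta
    have : Finset.Icc 1 2 = {1, 2} := rfl
    rw [this, Finset.sum_pair (by decide)]
    ring
  · refine ⟨fun j => rfl, fun j => ?_, fun j => ?_, fun j => ?_, ?_, ?_, ?_, ?_, ?_, ?_, ?_, ?_⟩ <;> simp <;> rfl

theorem delta_coeff {A : Type*} [CommRing A] {m : ℕ} (f : MvPolynomial (Fin (m+2)) A)
    (h : delta A 2 (m+2) f = 0) (a b y : ℕ) (r : Fin m →₀ ℕ) :
    (if a = 0 then coeff (Finsupp.cons b (Finsupp.cons y r)) f else 0) - 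
    ((a+b).choose a : A) * coeff (Finsupp.cons (a+b) (Finsupp.cons y r)) f +
    ((b+y).choose b : A) * coeff (Finsupp.cons a (Finsupp.cons (b+y) r)) f -
    (if y = 0 then coeff (Finsupp.cons a (Finsupp.cons b r)) f else 0) = 0 := by
  obtain ⟨φ0, φ1, φ2, φ3, hd, g0, g1, g2, g3, a0, b0, a1, b1, a2, b2, a3, b3⟩ := 
    delta_eq (A := A) (m := m)
  have := congrArg (coeff (Finsupp.cons a (Finsupp.cons b (Finsupp.cons y r)))) (hd f)
  rw [h, coeff_sub, coeff_add, coeff_sub, coeffT0 a b y r φ0 g0 a0 b0, coeffT1 a b y r φ1 g1 a1 b1,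
    coeffT2 a b y r φ2 g2 a2 b2, coeffT3 a b y r φ3 g3 a3 b3] at this
  rw [← this]; simp

theorem delta_pow (p : ℕ) (hp : p.Prime) {m : ℕ} (u : Fin (m+2) →₀ ℕ) 
    (hu : ∀ i, ∃ a, u i = p ^ a) : delta (ZMod p) 2 (m+2) (monomial u 1) = 0 := by
  have := Fact.mk hp
  obtain ⟨φ0, φ1, φ2, φ3, hd, g0, g1, g2, g3, a0, b0, a1, b1, a2, b2, a3, b3⟩ := 
    delta_eq (A := ZMod p) (m := m)
  obtain ⟨e0, e1, r, rfl⟩ := exists_cons2 u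
  obtain ⟨a, ha⟩ := hu 0
  obtain ⟨b, hb⟩ := hu 1
  have hb' : e1 = p ^ b := by
    rw [← hb]; rfl
  rw [Finsupp.cons_zero] at ha
  subst ha hb'
  rw [hd, aeval_mono φ0 g0, aeval_mono φ1 g1, aeval_mono φ2 g2, aeval_mono φ3 g3, a0, b0, a1, b1, 
    a2, b2, a3, b3, add_pow_char_pow, add_pow_char_pow]
  ring

theorem exMult_cons {m : ℕ} (a : ℕ) (r : Fin m →₀ ℕ) :
    exMult (Finsupp.cons a r) = a ::ₘ exMult r := by
  simp only [exMult, multisetOf, Fin.univ_succ, Finset.cons_val, Finset.map_val, Multiset.map_cons,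
    Multiset.map_map, Finsupp.cons_zero]
  congr 1

theorem exMult_exists {m : ℕ} : ∀ (u : Multiset ℕ), Multiset.card u = m →
    ∃ r : Fin m →₀ ℕ, exMult r = u := by
  induction m with
  | zero => 
    intro u hu
    rw [Multiset.card_eq_zero] at hu
    subst hu
    exact ⟨0, by simp [exMult, multisetOf]⟩
  | succ m ih =>
    intro u hu
    obtain ⟨a, ha⟩ := Multiset.card_pos_iff_exists_mem.1 (by omega : 0 < Multiset.card u)
    obtain ⟨v, rfl⟩ := Multiset.exists_cons_of_mem ha
    obtain ⟨r, rfl⟩ := ih v (by simpa using hu)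
    exact ⟨Finsupp.cons a r, exMult_cons a r⟩

theorem perm_of_mult {k : ℕ} (d e : Fin k → ℕ) (h : multisetOf d = multisetOf e) :
    ∃ σ : Equiv.Perm (Fin k), ∀ i, e (σ i) = d i := by
  have hc : ∀ x, Nonempty ({i // d i = x} ≃ {i // e i = x}) := by
    intro x
    rw [← Fintype.card_eq, Fintype.card_subtype, Fintype.card_subtype]
    have := congrArg (Multiset.count x) h
    simp only [multisetOf, Multiset.count_map] at this
    simp only [Finset.card_def, Finset.filter_val]
    simpa only [eq_comm] using this
  have g := fun x => (hc x).some
  refine ⟨((Equiv.sigmaFiberEquiv d).symm.trans (Equiv.sigmaCongrRight g)).trans 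
    (Equiv.sigmaFiberEquiv e), fun i => ?_⟩
  exact (g (d i) ⟨i, rfl⟩).2

theorem exMult_mapDomain {k : ℕ} (σ : Equiv.Perm (Fin k)) (e : Fin k →₀ ℕ) :
    exMult (Finsupp.mapDomain σ e) = exMult e := by
  simp only [exMult, multisetOf]
  have : (⇑(Finsupp.mapDomain σ e)) = e ∘ σ.symm := by
    funext i
    exact Finsupp.mapDomain_equiv_apply e i
  rw [this, ← Multiset.map_map, Multiset.map_univ_val_equiv]

theorem symm_coeff {A : Type*} [CommRing A] {k : ℕ} (f : MvPolynomial (Fin k) A)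
    (hf : f.IsSymmetric) (d e : Fin k →₀ ℕ) (h : exMult d = exMult e) : coeff d f = coeff e f := by
  obtain ⟨σ, hσ⟩ := perm_of_mult d e h
  have : Finsupp.mapDomain σ d = e := by
    ext i
    rw [Finsupp.mapDomain_equiv_apply, ← hσ]; simp
  rw [← this]
  conv_rhs => rw [← hf σ]
  rw [coeff_rename_mapDomain _ σ.injective]

theorem mem_tau {k : ℕ} (lam : Fin k → ℕ) (d : Fin k →₀ ℕ) :
    d ∈ (Finset.univ : Finset (Equiv.Perm (Fin k))).image
      (fun σ => Finsupp.equivFunOnFinite.symm (fun i => lam (σ i))) ↔ 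
      exMult d = multisetOf lam := by
  simp only [Finset.mem_image, Finset.mem_univ, true_and]
  constructor
  · rintro ⟨σ, rfl⟩
    simp only [exMult, multisetOf]
    have : (⇑(Finsupp.equivFunOnFinite.symm (fun i => lam (σ i)))) = lam ∘ σ := rfl
    rw [this, ← Multiset.map_map, Multiset.map_univ_val_equiv]
  · intro h
    obtain ⟨σ, hσ⟩ := perm_of_mult d lam h
    exact ⟨σ, by ext i; simp [hσ]⟩

theorem coeff_tau {A : Type*} [CommRing A] {k : ℕ} (lam : Fin k → ℕ) (d : Fin k →₀ ℕ) :
    coeff d (tau A lam) = if exMult d = multisetOf lam then 1 else 0 := by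
  unfold tau
  simp only [coeff_sum, coeff_monomial, Finset.sum_ite_eq', mem_tau]

theorem tau_symm {A : Type*} [CommRing A] {k : ℕ} (lam : Fin k → ℕ) :
    (tau A lam).IsSymmetric := by
  intro σ
  ext d
  have : d = Finsupp.mapDomain σ (Finsupp.mapDomain σ.symm d) := by
    rw [← Finsupp.mapDomain_comp]; simp
  rw [coeff_tau]
  conv_lhs => rw [this]
  rw [coeff_rename_mapDomain _ σ.injective, coeff_tau, exMult_mapDomain]

theorem exMult_sum {k : ℕ} (d : Fin k →₀ ℕ) : (exMult d).sum = d.degree := by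
  rw [Finsupp.degree_eq_sum]; rfl

theorem tau_homog {A : Type*} [CommRing A] {k : ℕ} (lam : Fin k → ℕ) :
    (tau A lam).IsHomogeneous (∑ i, lam i) := by
  unfold tau
  apply IsHomogeneous.sum
  intro d hd
  rw [mem_tau] at hd
  apply isHomogeneous_monomial
  rw [← exMult_sum, hd]; rfl

theorem mem_exMult {k : ℕ} (d : Fin k →₀ ℕ) (x : ℕ) : x ∈ exMult d ↔ ∃ i, d i = x := by
  simp [exMult, multisetOf]

theorem delta_add' {A : Type*} [CommRing A] {m : ℕ} (f g : MvPolynomial (Fin (m+2)) A) :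
    delta A 2 (m+2) (f + g) = delta A 2 (m+2) f + delta A 2 (m+2) g := by
  obtain ⟨φ0, φ1, φ2, φ3, hd, -⟩ := delta_eq (A := A) (m := m)
  simp only [hd, map_add]; ring

theorem delta_smul' {A : Type*} [CommRing A] {m : ℕ} (c : A) (g : MvPolynomial (Fin (m+2)) A) :
    delta A 2 (m+2) (c • g) = c • delta A 2 (m+2) g := by
  obtain ⟨φ0, φ1, φ2, φ3, hd, -⟩ := delta_eq (A := A) (m := m)
  simp only [hd, map_smul, smul_sub, smul_add]

theorem delta_zero' {A : Type*} [CommRing A] {m : ℕ} :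
    delta A 2 (m+2) (0 : MvPolynomial (Fin (m+2)) A) = 0 := by
  have := delta_smul' (0 : A) (0 : MvPolynomial (Fin (m+2)) A)
  simpa using this

theorem tau_delta (p : ℕ) (hp : p.Prime) {m : ℕ} (lam : Fin (m+2) → ℕ) 
    (h : ∀ i, ∃ a : ℕ, lam i = p ^ a) : delta (ZMod p) 2 (m+2) (tau (ZMod p) lam) = 0 := by
  unfold tau
  apply Finset.sum_induction (p := fun f => delta (ZMod p) 2 (m+2) f = 0)
  · intro a b ha hb; rw [delta_add', ha, hb, add_zero]
  · exact delta_zero'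
  · intro d hd
    rw [mem_tau] at hd
    apply delta_pow p hp
    intro i
    have : d i ∈ exMult d := (mem_exMult d _).2 ⟨i, rfl⟩
    rw [hd] at this
    simp only [multisetOf, Multiset.mem_map] at this
    obtain ⟨j, -, hj⟩ := this
    rw [← hj]; exact h j

theorem mem_span_tau {A : Type*} [CommRing A] {k : ℕ} (f : MvPolynomial (Fin k) A)
    (hf : f.IsSymmetric) (T : Set (MvPolynomial (Fin k) A)) 
    (hT : ∀ d ∈ f.support, tau A d ∈ T) : f ∈ Submodule.span A T := by
  rw [f.as_sum, ← Finset.sum_fiberwise_of_maps_to (t := f.support.image exMult) (g := exMult)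
    (fun d hd => Finset.mem_image_of_mem _ hd)]
  apply Submodule.sum_mem
  intro t ht
  obtain ⟨d, hd, rfl⟩ := Finset.mem_image.1 ht
  have : ∑ i ∈ f.support with exMult i = exMult d, monomial i (coeff i f) = 
      coeff d f • tau A d := by
    unfold tau
    rw [Finset.smul_sum]
    apply Finset.sum_congr
    · ext e
      rw [mem_tau, Finset.mem_filter, mem_support_iff]
      constructor
      · exact fun h => h.2
      · intro h
        refine ⟨?_, h⟩
        rw [symm_coeff f hf e d h]
        exact mem_support_iff.1 hd
    · intro e he
      rw [mem_tau] at he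
      rw [symm_coeff f hf e d he, smul_monomial, smul_eq_mul, mul_one]
  rw [this]
  exact Submodule.smul_mem _ _ (Submodule.subset_span (hT d hd))

theorem supp_pow (p : ℕ) (hp : p.Prime) (n m : ℕ) 
    (hex : ∃ μ : Multiset ℕ, IsPowOf p μ ∧ Multiset.card μ = m + 2 ∧ μ.sum = n) 
    (f : MvPolynomial (Fin (m+2)) (ZMod p)) (hs : f.IsSymmetric) (hh : f.IsHomogeneous n)
    (hd : delta (ZMod p) 2 (m+2) f = 0) (d : Fin (m+2) →₀ ℕ) (hc : coeff d f ≠ 0) :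
    ∀ i, ∃ a, d i = p ^ a := by
  have := Fact.mk hp
  obtain ⟨μ, h1, h2, h3⟩ := hex
  have he : ∃ e : Multiset ℕ, μ = e.map (p ^ ·) := by
    clear h2 h3
    induction μ using Multiset.induction with
    | empty => exact ⟨0, rfl⟩
    | cons a μ ih =>
      obtain ⟨e, rfl⟩ := ih (fun x hx => h1 x (Multiset.mem_cons_of_mem hx))
      obtain ⟨b, rfl⟩ := h1 a (Multiset.mem_cons_self _ _)
      exact ⟨b ::ₘ e, by simp⟩
  obtain ⟨e, rfl⟩ := he
  rw [Multiset.card_map] at h2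
  have hdn : (exMult d).sum = n := by
    rw [exMult_sum, Finsupp.degree_eq_weight_one]; exact hh hc
  have hcard : ∀ d : Fin (m+2) →₀ ℕ, Multiset.card (exMult d) = m+2 := by
    intro d; simp [exMult, multisetOf]
  have hn : 0 < n := by
    rw [← h3]
    apply tval_pos p hp
    rintro rfl
    simp at h2
  let P : Multiset ℕ → Prop := fun s => ∃ d, exMult d = s ∧ coeff d f ≠ 0
  have hP : ∀ a b u, P (a ::ₘ b ::ₘ u) → ∃ r : Fin m →₀ ℕ, exMult r = u ∧ 
      coeff (Finsupp.cons a (Finsupp.cons b r)) f ≠ 0 := by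
    rintro a b u ⟨d, hd, hc⟩
    have hcu := hcard d
    rw [hd] at hcu
    obtain ⟨r, rfl⟩ := exMult_exists (m := m) u (by simpa using hcu)
    refine ⟨r, rfl, ?_⟩
    rwa [symm_coeff f hs _ d]
    rw [hd, exMult_cons, exMult_cons]
  have step : ∀ a b y u, 0 < a → 0 < b → 0 < y → P ((a+b) ::ₘ y ::ₘ u) → 
      ¬ p ∣ (a+b).choose a → ¬ p ∣ (b+y).choose b ∧ P (a ::ₘ (b+y) ::ₘ u) := by
    intro a b y u ha hb hy hPP hdv
    obtain ⟨r, rfl, hr⟩ := hP _ _ _ hPP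
    have rel := delta_coeff f hd a b y r
    rw [if_neg ha.ne', if_neg hy.ne', zero_sub, sub_zero, neg_add_eq_zero] at rel
    rw [← ZMod.natCast_eq_zero_iff] at hdv ⊢
    have := mul_ne_zero hdv hr
    rw [rel] at this
    exact ⟨left_ne_zero_of_mul this, _, by rw [exMult_cons, exMult_cons], right_ne_zero_of_mul this⟩
  have hpos : ∀ x ∈ exMult d, 0 < x := by
    intro x hx
    by_contra hx0
    have hx0 : x = 0 := by omega
    subst hx0
    obtain ⟨u, hu⟩ := Multiset.exists_cons_of_mem hx
    have : ∃ y ∈ u, y ≠ 0 := by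
      by_contra hcon
      push Not at hcon
      rw [hu, Multiset.sum_cons, Multiset.sum_eq_zero hcon] at hdn
      omega
    obtain ⟨y, hy, hy0⟩ := this
    obtain ⟨v, rfl⟩ := Multiset.exists_cons_of_mem hy
    obtain ⟨r, -, hr⟩ := hP 0 y v ⟨d, hu, hc⟩
    have rel := delta_coeff f hd 0 0 y r
    simp [hy0] at rel
    exact hr rel
  have := comb p hp P step e (exMult d) ⟨d, rfl, hc⟩ hpos (by rw [hcard, h2]) (by rw [hdn, ← h3]; rfl)
  intro i
  exact this _ ((mem_exMult d _).2 ⟨i, rfl⟩)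

/-- If a power-of-`p` multiset of cardinality `k` and sum `n`
exists, then the symmetric `2`-cocycles over `ℤ/pℤ` of homogeneous degree `n` in
`k` variables are exactly the span of the `τλ` for power-of-`p` multi-indices
`λ` of length `k` and weight `n`. -/
theorem statement16 (p : ℕ) (hp : p.Prime) (n k : ℕ) (hk : 2 ≤ k)
    (hex : ∃ μ : Multiset ℕ, IsPowOf p μ ∧ Multiset.card μ = k ∧ μ.sum = n) :
    {f : MvPolynomial (Fin k) (ZMod p) |
        f.IsSymmetric ∧ f.IsHomogeneous n ∧ delta (ZMod p) 2 k f = 0}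
      = ↑(Submodule.span (ZMod p)
          {g : MvPolynomial (Fin k) (ZMod p) | ∃ lam : Fin k → ℕ,
            (∀ i, ∃ a : ℕ, lam i = p ^ a) ∧ (∑ i, lam i) = n ∧
            g = tau (ZMod p) lam}) := by
  obtain ⟨m, rfl⟩ := Nat.exists_eq_add_of_le' hk
  ext f
  simp only [Set.mem_ofPred_eq, SetLike.mem_coe]
  constructor
  · rintro ⟨hs, hh, hd⟩
    apply mem_span_tau f hs
    intro d hc
    rw [mem_support_iff] at hc
    refine ⟨d, supp_pow p hp n m hex f hs hh hd d hc, ?_, rfl⟩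
    have : d.degree = n := by rw [Finsupp.degree_eq_weight_one]; exact hh hc
    rw [← this, Finsupp.degree_eq_sum]
  · intro hf
    induction hf using Submodule.span_induction with
    | mem x hx =>
      obtain ⟨lam, h1, rfl, rfl⟩ := hx
      exact ⟨tau_symm lam, tau_homog lam, tau_delta p hp lam h1⟩
    | zero => exact ⟨IsSymmetric.zero, isHomogeneous_zero _ _ _, delta_zero'⟩
    | add x y _ _ hx hy =>
      exact ⟨hx.1.add hy.1, hx.2.1.add hy.2.1, by rw [delta_add', hx.2.2, hy.2.2, add_zero]⟩
    | smul c x _ hx =>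
      refine ⟨hx.1.smul c, ?_, by rw [delta_smul', hx.2.2, smul_zero]⟩
      exact (homogeneousSubmodule _ _ n).smul_mem c hx.2.1
end
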